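/- Let k ∈ ℤ with k ≠ −1 and let f = x² + k ∈ ℤ[x]. Then for every a₀ ∈ ℤ, the natural density of the set P(f, a₀) of prime divisors of the orbit of a₀ under f exists and equals 0. -/

import Mathlib

open Polynomial Filter

/-- The `n`-th iterate of a polynomial, with `f^0 = X`. -/
noncomputable def polyIter (f : Polynomial ℤ) : ℕ → Polynomial ℤ
  | 0 => X
  | n + 1 => f.comp (polyIter f n)

open scoped Classical in
/-- The number of elements of `S` that are at most `x`. -/
noncomputable def primeCount (S : Set ℕ) (x : ℕ) : ℕ :=
  ((Finset.range (x + 1)).filter (fun p => p ∈ S)).card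

/-- A set `S` of primes has natural density zero:
`lim_{x → ∞} #{p ∈ S : p ≤ x} / #{p prime : p ≤ x}` exists and equals `0`. -/
def HasPrimeDensityZero (S : Set ℕ) : Prop :=
  Tendsto (fun x : ℕ => (primeCount S x : ℝ) / (primeCount {p | p.Prime} x : ℝ))
    atTop (nhds 0)

/-- `P(f, a₀)`: the set of primes dividing some nonzero term of the orbit of `a₀` under `f`. -/
def orbitPrimes (f : Polynomial ℤ) (a₀ : ℤ) : Set ℕ :=
  {p | p.Prime ∧ ∃ n : ℕ, (fun x => Polynomial.eval x f)^[n] a₀ ≠ 0 ∧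
    (p : ℤ) ∣ (fun x => Polynomial.eval x f)^[n] a₀}


namespace Selberg
open Finset ArithmeticFunction

/-- Dirichlet convolution summation formula. -/
lemma sum_conv (h : ℕ → ℕ → ℝ) (x : ℝ) :
    ∑ n ∈ Ioc 0 ⌊x⌋₊, ∑ p ∈ n.divisorsAntidiagonal, h p.1 p.2 =
      ∑ d ∈ Ioc 0 ⌊x⌋₊, ∑ e ∈ Ioc 0 ⌊x / d⌋₊, h d e := by
  rw [Finset.sum_sigma', Finset.sum_sigma']
  refine Finset.sum_bij' (fun a _ => ⟨a.2.1, a.2.2⟩) (fun b _ => ⟨b.1 * b.2, (b.1, b.2)⟩)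
    ?_ ?_ ?_ ?_ ?_
  · rintro ⟨n, d, e⟩ ha
    simp only [mem_sigma, mem_Ioc, Nat.mem_divisorsAntidiagonal] at ha ⊢
    obtain ⟨⟨h0, h1⟩, rfl, h2⟩ := ha
    have hd : 0 < d := Nat.pos_of_ne_zero (by rintro rfl; simp at h2)
    have he : 0 < e := Nat.pos_of_ne_zero (by rintro rfl; simp at h2)
    refine ⟨⟨hd, le_trans (Nat.le_mul_of_pos_right d he) h1⟩, he, ?_⟩
    rw [Nat.floor_div_natCast, Nat.le_div_iff_mul_le hd, mul_comm]
    exact h1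
  · rintro ⟨d, e⟩ hb
    simp only [mem_sigma, mem_Ioc, Nat.mem_divisorsAntidiagonal] at hb ⊢
    obtain ⟨⟨hd, h1⟩, he, h2⟩ := hb
    rw [Nat.floor_div_natCast, Nat.le_div_iff_mul_le hd, mul_comm] at h2
    exact ⟨⟨Nat.mul_pos hd he, h2⟩, trivial, (Nat.mul_pos hd he).ne'⟩
  · rintro ⟨n, d, e⟩ ha
    simp only [mem_sigma, mem_Ioc, Nat.mem_divisorsAntidiagonal] at ha
    obtain ⟨_, rfl, _⟩ := ha
    rfl
  · rintro ⟨d, e⟩ _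
    rfl
  · rintro ⟨n, d, e⟩ _
    rfl

/-- Logarithmic derivation. -/
noncomputable def D (f : ArithmeticFunction ℝ) : ArithmeticFunction ℝ :=
  ⟨fun n => f n * Real.log n, by simp⟩

lemma D_apply (f : ArithmeticFunction ℝ) (n : ℕ) : D f n = f n * Real.log n := rfl

lemma D_mul (f g : ArithmeticFunction ℝ) : D (f * g) = D f * g + f * D g := by
  ext n
  simp only [D_apply, ArithmeticFunction.mul_apply, ArithmeticFunction.add_apply, Finset.sum_mul]
  rw [← Finset.sum_add_distrib]
  refine Finset.sum_congr rfl fun p hp => ?_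
  obtain ⟨h1, h2⟩ := Nat.mem_divisorsAntidiagonal.1 hp
  rw [← h1] at h2
  have h3 : (p.1 : ℝ) ≠ 0 := by
    intro h; apply h2; rw [Nat.cast_eq_zero.1 h]; simp
  have h4 : (p.2 : ℝ) ≠ 0 := by
    intro h; apply h2; rw [Nat.cast_eq_zero.1 h]; simp
  rw [← h1, Nat.cast_mul, Real.log_mul h3 h4]
  ring

lemma D_one : D 1 = 0 := by
  ext n
  rw [D_apply]
  by_cases h : n = 1
  · simp [h]
  · simp [ArithmeticFunction.one_apply_ne h]

lemma exists_mu (r Lam : ArithmeticFunction ℝ) (hr1 : r 1 = 1) 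
    (hL : ∀ n, 0 ≤ Lam n) (h : Lam * r = D r) :
    ∃ mu : ArithmeticFunction ℝ, mu * r = 1 ∧ mu * D r = Lam ∧ ∀ n, |mu n| ≤ r n := by
  have hu : IsUnit r := isUnit_iff_isUnit_apply_one.2 (by rw [hr1]; exact isUnit_one)
  obtain ⟨mu, hmu⟩ := hu.exists_left_inv
  have hmu' : mu * D r = Lam := by
    rw [← h, mul_comm Lam, ← mul_assoc, hmu, one_mul]
  have hd : D mu = - (Lam * mu) := by
    have h1 : D mu * r + mu * D r = 0 := by rw [← D_mul, hmu, D_one]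
    have h2 : D mu * (r * mu) = - (mu * D r * mu) := by
      linear_combination mu * h1
    rw [mul_comm r, hmu, mul_one, hmu'] at h2
    exact h2
  have hL1 : Lam 1 = 0 := by
    have := congrArg (fun f => f 1) h
    simpa [hr1, D_apply] using this
  refine ⟨mu, hmu, hmu', ?_⟩
  intro n
  induction n using Nat.strong_induction_on with
  | _ n ih =>
    rcases Nat.lt_or_ge n 2 with hn | hn
    · interval_cases n
      · simp
      · have := congrArg (fun f => f 1) hmu
        simp [hr1] at this
        simp [this, hr1]
    · have hlog : 0 < Real.log n := Real.log_pos (by exact_mod_cast hn)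
      have e1 : mu n * Real.log n = - ∑ p ∈ n.divisorsAntidiagonal, Lam p.1 * mu p.2 := by
        rw [← D_apply, hd]; simp [ArithmeticFunction.mul_apply]
      have e2 : r n * Real.log n = ∑ p ∈ n.divisorsAntidiagonal, Lam p.1 * r p.2 := by
        rw [← D_apply, ← h]; simp [ArithmeticFunction.mul_apply]
      have e3 : |mu n| * Real.log n ≤ r n * Real.log n := by
        rw [← abs_of_pos hlog, ← abs_mul, e1, abs_neg, abs_of_pos hlog, e2]
        refine (Finset.abs_sum_le_sum_abs _ _).trans (Finset.sum_le_sum fun p hp => ?_)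
        rw [abs_mul, abs_of_nonneg (hL _)]
        obtain ⟨h1, h2⟩ := Nat.mem_divisorsAntidiagonal.1 hp
        rcases eq_or_ne p.1 1 with hp1 | hp1
        · rw [hp1, hL1]; simp
        · apply mul_le_mul_of_nonneg_left _ (hL _)
          apply ih
          have hp0 : p.1 ≠ 0 := by intro h0; rw [h0] at h1; omega
          have hp2 : p.2 ≠ 0 := by intro h0; rw [h0] at h1; omega
          rw [← h1]
          have : 2 ≤ p.1 := by omega
          nlinarith [Nat.pos_of_ne_zero hp2]
      exact le_of_mul_le_mul_right e3 hlog

/-- Halving lemma. -/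
lemma sum_rpow_le (g : ℕ → ℝ) (hg : ∀ n, 0 ≤ g n) (C : ℝ) (hC : 0 ≤ C)
    (h : ∀ y : ℝ, 0 ≤ y → ∑ n ∈ Ioc 0 ⌊y⌋₊, g n ≤ C * y) (α : ℝ) (hα : 0 ≤ α) (hα1 : α < 1) :
    ∃ C', 0 ≤ C' ∧ ∀ x : ℝ, 0 ≤ x → ∑ n ∈ Ioc 0 ⌊x⌋₊, g n * (x / n) ^ α ≤ C' * x := by
  set q : ℝ := 2 ^ α with hq
  have hq0 : 0 < q := by positivity
  have hq2 : q < 2 := by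
    calc q < 2 ^ (1:ℝ) := Real.rpow_lt_rpow_of_exponent_lt (by norm_num) hα1
      _ = 2 := by simp
  refine ⟨2 * q * C / (2 - q), div_nonneg (by positivity) (by linarith), ?_⟩
  have key : ∀ N : ℕ, ∀ x : ℝ, 0 ≤ x → x < 2 ^ N →
      ∑ n ∈ Ioc 0 ⌊x⌋₊, g n * (x / n) ^ α ≤ 2 * q * C / (2 - q) * x := by
    have h2q : 0 < 2 - q := by linarith
    intro N
    induction N with
    | zero =>
      intro x hx0 hx1
      rw [pow_zero] at hx1
      rw [Nat.floor_eq_zero.2 hx1]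
      simp
      positivity
    | succ N ih =>
      intro x hx0 hx1
      have ih' := ih (x/2) (by linarith) (by rw [pow_succ] at hx1; linarith)
      have hle : ⌊x/2⌋₊ ≤ ⌊x⌋₊ := Nat.floor_le_floor (by linarith)
      rw [← Finset.sum_Ioc_consecutive _ (Nat.zero_le _) hle]
      have b1 : ∑ n ∈ Ioc 0 ⌊x/2⌋₊, g n * (x / n) ^ α =
          q * ∑ n ∈ Ioc 0 ⌊x/2⌋₊, g n * (x / 2 / n) ^ α := by
        rw [Finset.mul_sum]
        refine Finset.sum_congr rfl fun n hn => ?_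
        rw [show x / n = 2 * (x / 2 / n) by ring, Real.mul_rpow (by norm_num) (by positivity)]
        ring
      have b2 : ∑ n ∈ Ioc ⌊x/2⌋₊ ⌊x⌋₊, g n * (x / n) ^ α ≤ q * (C * x) := by
        calc ∑ n ∈ Ioc ⌊x/2⌋₊ ⌊x⌋₊, g n * (x / n) ^ α
            ≤ ∑ n ∈ Ioc ⌊x/2⌋₊ ⌊x⌋₊, g n * q := by
              refine Finset.sum_le_sum fun n hn => ?_
              apply mul_le_mul_of_nonneg_left _ (hg n)
              have hn1 := (Nat.floor_lt (by linarith)).1 (Finset.mem_Ioc.1 hn).1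
              apply Real.rpow_le_rpow (by positivity) _ hα
              have : (0:ℝ) < n := by linarith
              rw [div_le_iff₀ this]; linarith
          _ = q * ∑ n ∈ Ioc ⌊x/2⌋₊ ⌊x⌋₊, g n := by rw [← Finset.sum_mul, mul_comm]
          _ ≤ q * ∑ n ∈ Ioc 0 ⌊x⌋₊, g n := by
              apply mul_le_mul_of_nonneg_left _ hq0.le
              apply Finset.sum_le_sum_of_subset_of_nonneg
              · exact Finset.Ioc_subset_Ioc_left (Nat.zero_le _)
              · intros; exact hg _
          _ ≤ _ := mul_le_mul_of_nonneg_left (h x hx0) hq0.le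
      rw [b1]
      have b3 := mul_le_mul_of_nonneg_left ih' hq0.le
      have : q * (2 * q * C / (2 - q) * (x / 2)) + q * (C * x) = 2 * q * C / (2 - q) * x := by
        field_simp; ring
      linarith
  intro x hx
  obtain ⟨N, hN⟩ := pow_unbounded_of_one_lt x (by norm_num : (1:ℝ) < 2)
  exact key N x hx hN

end Selberg


namespace Selberg
open Finset ArithmeticFunction MeasureTheory

lemma abel_est (r : ArithmeticFunction ℝ) (κ C δ : ℝ) (hC : 0 ≤ C) (hδ : 0 < δ) (hδ1 : δ < 1)
    (h : ∀ x : ℝ, 1 ≤ x → |∑ n ∈ Ioc 0 ⌊x⌋₊, r n - κ * x| ≤ C * x ^ (1 - δ)) :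
    ∃ c0 C1 : ℝ, 0 ≤ C1 ∧ ∀ y : ℝ, 1 ≤ y →
      |∑ n ∈ Ioc 0 ⌊y⌋₊, r n * (Real.log n - y / n) - c0 * y| ≤ C1 * y ^ (1 - δ / 2) := by
  set A : ℝ → ℝ := fun t => ∑ n ∈ Icc 0 ⌊t⌋₊, r n with hA
  have hA' : ∀ t, ∑ n ∈ Ioc 0 ⌊t⌋₊, r n = A t := by
    intro t
    simp only [hA]
    rw [Finset.Icc_eq_cons_Ioc (Nat.zero_le _), Finset.sum_cons]; simp
  set e : ℝ → ℝ := fun t => A t - κ * t with he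
  have heb : ∀ t, 1 ≤ t → |e t| ≤ C * t ^ (1 - δ) := by
    intro t ht; simpa only [he, ← hA'] using h t ht
  have hAm : Measurable A := by
    exact (measurable_from_nat (f := fun m => ∑ n ∈ Icc 0 m, r n)).comp Nat.measurable_floor
  have hem : Measurable e := hAm.sub (measurable_const.mul measurable_id)
  -- integrability
  have hb2 : ∀ t : ℝ, 1 < t → ‖e t / t ^ 2‖ ≤ C * t ^ (-1 - δ) := by
    intro t ht
    have ht0 : 0 < t := by linarith
    rw [norm_div, Real.norm_eq_abs, Real.norm_eq_abs, abs_of_pos (by positivity : 0 < t ^ 2),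
      div_le_iff₀ (by positivity), mul_assoc, ← Real.rpow_natCast, ← Real.rpow_add ht0]
    rw [show -1 - δ + ((2:ℕ):ℝ) = 1 - δ by push_cast; ring]
    exact heb t ht.le
  have hb1 : ∀ t : ℝ, 1 < t → ‖e t / t‖ ≤ C * t ^ (- δ) := by
    intro t ht
    have ht0 : 0 < t := by linarith
    rw [norm_div, Real.norm_eq_abs, Real.norm_eq_abs, abs_of_pos ht0,
      div_le_iff₀ (by positivity), mul_assoc]
    have : t ^ (-δ) * t = t ^ (1 - δ) := by
      rw [← Real.rpow_add_one ht0.ne']; congr 1; ring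
    rw [this]
    exact heb t ht.le
  have hi2 : IntegrableOn (fun t => e t / t ^ 2) (Set.Ioi 1) := by
    refine Integrable.mono' ((integrableOn_Ioi_rpow_of_lt (a := -1 - δ) (c := 1) (by linarith)
      one_pos).const_mul C) ?_ ?_
    · exact (hem.div (measurable_id.pow_const 2)).aestronglyMeasurable
    · filter_upwards [ae_restrict_mem measurableSet_Ioi] with t ht using hb2 t ht
  have hJ : ∀ y : ℝ, 1 ≤ y → IntegrableOn (fun t : ℝ => C * t ^ (-δ)) (Set.Ioc 1 y) := by
    intro y hy
    apply Integrable.const_mul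
    have := (intervalIntegral.intervalIntegrable_rpow' (a := 1) (b := y) (r := -δ) (by linarith))
    exact (intervalIntegrable_iff_integrableOn_Ioc_of_le hy).1 this
  have hi1 : ∀ y : ℝ, 1 ≤ y → IntegrableOn (fun t => e t / t) (Set.Ioc 1 y) := by
    intro y hy
    refine Integrable.mono' (hJ y hy) (hem.div measurable_id).aestronglyMeasurable ?_
    filter_upwards [ae_restrict_mem measurableSet_Ioc] with t ht using hb1 t ht.1
  have hI1 : ∀ y : ℝ, 1 ≤ y → |∫ t in Set.Ioc 1 y, e t / t| ≤ C / (1 - δ) * y ^ (1 - δ) := by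
    intro y hy
    rw [← Real.norm_eq_abs]
    refine (norm_integral_le_of_norm_le (hJ y hy) ?_).trans ?_
    · filter_upwards [ae_restrict_mem measurableSet_Ioc] with t ht using hb1 t ht.1
    · rw [integral_const_mul, ← intervalIntegral.integral_of_le hy, integral_rpow (by left; linarith)]
      rw [div_mul_eq_mul_div, mul_div_assoc, show -δ + 1 = 1 - δ by ring]
      apply mul_le_mul_of_nonneg_left _ hC
      apply div_le_div_of_nonneg_right _ (by linarith)
      simp
  have hI2 : ∀ y : ℝ, 1 ≤ y → |∫ t in Set.Ioi y, e t / t ^ 2| ≤ C / δ * y ^ (- δ) := by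
    intro y hy
    rw [← Real.norm_eq_abs]
    refine (norm_integral_le_of_norm_le (g := fun t => C * t ^ (-1 - δ)) ?_ ?_).trans ?_
    · exact (integrableOn_Ioi_rpow_of_lt (by linarith) (by linarith)).const_mul C
    · filter_upwards [ae_restrict_mem measurableSet_Ioi] with t ht using hb2 t (lt_of_le_of_lt hy ht)
    · rw [integral_const_mul, integral_Ioi_rpow_of_lt (by linarith) (by linarith)]
      rw [show -1 - δ + 1 = -δ by ring, neg_div_neg_eq]
      apply le_of_eq; ring
  set γ : ℝ := ∫ t in Set.Ioi 1, e t / t ^ 2 with hγ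
  have hγy : ∀ y : ℝ, 1 ≤ y → ∫ t in Set.Ioc 1 y, e t / t ^ 2 = γ - ∫ t in Set.Ioi y, e t / t ^ 2 := by
    intro y hy
    have := setIntegral_union (μ := volume) (f := fun t => e t / t ^ 2) (s := Set.Ioc 1 y) (t := Set.Ioi y)
      (Set.Ioc_disjoint_Ioi le_rfl) measurableSet_Ioi
      (hi2.mono_set Set.Ioc_subset_Ioi_self) (hi2.mono_set (Set.Ioi_subset_Ioi hy))
    rw [Set.Ioc_union_Ioi_eq_Ioi hy] at this
    rw [hγ, this]; ring
  have habel : ∀ y : ℝ, 1 ≤ y → ∑ n ∈ Ioc 0 ⌊y⌋₊, r n * (Real.log n - y / n) =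
      (Real.log y - 1) * A y - (κ * (y - 1) + κ * y * Real.log y
        + (∫ t in Set.Ioc 1 y, e t / t) + y * (∫ t in Set.Ioc 1 y, e t / t ^ 2)) := by
    intro y hy
    have hder : ∀ t : ℝ, 1 ≤ t →
        HasDerivAt (fun t : ℝ => Real.log t - y / t) (t⁻¹ + y / t ^ 2) t := by
      intro t ht
      have ht0 : t ≠ 0 := by linarith
      have := (Real.hasDerivAt_log ht0).sub (((hasDerivAt_inv ht0).const_mul y))
      rw [show t⁻¹ + y / t ^ 2 = t⁻¹ - y * -(t ^ 2)⁻¹ by ring]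
      exact this
    have hcont : ContinuousOn (fun t : ℝ => t⁻¹ + y / t ^ 2) (Set.Icc 1 y) := by
      have hne : ∀ t ∈ Set.Icc 1 y, t ≠ 0 := fun t ht => by linarith [ht.1]
      refine (continuousOn_inv₀.mono fun t ht => hne t ht).add ?_
      exact continuousOn_const.div (by fun_prop) fun t ht => pow_ne_zero _ (hne t ht)
    have hintg : IntegrableOn (deriv (fun t : ℝ => Real.log t - y / t)) (Set.Icc 1 y) := by
      refine (hcont.integrableOn_Icc).congr_fun ?_ measurableSet_Icc
      intro t ht
      exact (hder t ht.1).deriv.symm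
    have := sum_mul_eq_sub_integral_mul₀ (f := fun t : ℝ => Real.log t - y / t) (fun n => r n)
      (by simp) y (fun t ht => (hder t ht.1).differentiableAt) hintg
    rw [Finset.Icc_eq_cons_Ioc (Nat.zero_le _), Finset.sum_cons] at this
    simp only [ArithmeticFunction.map_zero, mul_zero, zero_add] at this
    rw [← Finset.Icc_eq_cons_Ioc (Nat.zero_le _)] at this
    have h0 : ∑ n ∈ Ioc 0 ⌊y⌋₊, r n * (Real.log n - y / n) =
      ∑ n ∈ Ioc 0 ⌊y⌋₊, (Real.log n - y / n) * r n := Finset.sum_congr rfl fun _ _ => mul_comm _ _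
    rw [h0, this, div_self (by linarith : y ≠ 0)]
    congr 1
    have hcongr : ∫ t in Set.Ioc 1 y, deriv (fun t : ℝ => Real.log t - y / t) t * ∑ k ∈ Icc 0 ⌊t⌋₊, r k
        = ∫ t in Set.Ioc 1 y, ((κ + κ * y * t⁻¹) + (e t / t + y * (e t / t ^ 2))) := by
      refine setIntegral_congr_fun measurableSet_Ioc fun t ht => ?_
      have ht0 : t ≠ 0 := by linarith [ht.1]
      rw [(hder t ht.1.le).deriv]
      change (t⁻¹ + y / t ^ 2) * A t = _
      rw [show A t = κ * t + e t by simp [he]]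
      field_simp
    have hinv : IntegrableOn (fun t : ℝ => κ * y * t⁻¹) (Set.Ioc 1 y) := by
      apply Integrable.const_mul
      have : IntervalIntegrable (fun t : ℝ => t⁻¹) volume 1 y := by
        apply intervalIntegrable_inv_iff.2
        right
        rw [Set.uIcc_of_le hy]
        intro h; linarith [h.1]
      exact (intervalIntegrable_iff_integrableOn_Ioc_of_le hy).1 this
    have hconst : IntegrableOn (fun t : ℝ => κ) (Set.Ioc 1 y) := by
      exact integrableOn_const (by simp) (by simp)
    have h2 := (hi2.mono_set (Set.Ioc_subset_Ioi_self : Set.Ioc 1 y ⊆ Set.Ioi 1)).const_mul y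
    have hh1 := integral_add (hconst.add hinv) ((hi1 y hy).add h2)
    simp only [Pi.add_apply] at hh1
    rw [hcongr, hh1, integral_add hconst hinv,
      integral_add (hi1 y hy) h2, integral_const_mul, integral_const_mul,
      ← intervalIntegral.integral_of_le hy (f := fun t : ℝ => t⁻¹), integral_inv_of_pos one_pos (by linarith)]
    simp only [div_one, MeasureTheory.setIntegral_const, Real.volume_real_Ioc_of_le hy, smul_eq_mul]
    ring
  refine ⟨-2 * κ - γ, |κ| + C * (2 / δ) + C + C / (1 - δ) + C / δ, ?_, ?_⟩
  · have : 0 < 1 - δ := by linarith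
    positivity
  intro y hy
  have hy0 : 0 < y := by linarith
  rw [habel y hy, hγy y hy]
  set P := ∫ t in Set.Ioc 1 y, e t / t
  set Q := ∫ t in Set.Ioi y, e t / t ^ 2
  have hP := hI1 y hy
  have hQ := hI2 y hy
  have hE := heb y hy
  have hAe : A y = κ * y + e y := by simp [he]
  rw [hAe]
  have hid : (Real.log y - 1) * (κ * y + e y) - (κ * (y - 1) + κ * y * Real.log y + P + y * (γ - Q))
      - (-2 * κ - γ) * y = κ + e y * Real.log y + (- e y) + (- P) + y * Q := by ring
  rw [hid]
  set Z := y ^ (1 - δ / 2)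
  have hZ1 : 1 ≤ Z := Real.one_le_rpow hy (by linarith)
  have hZ2 : y ^ (1 - δ) ≤ Z := Real.rpow_le_rpow_of_exponent_le hy (by linarith)
  have hlog : y ^ (1 - δ) * Real.log y ≤ 2 / δ * Z := by
    have := Real.log_le_rpow_div hy0.le (by linarith : 0 < δ / 2)
    calc y ^ (1 - δ) * Real.log y ≤ y ^ (1 - δ) * (y ^ (δ / 2) / (δ / 2)) := by gcongr
      _ = 2 / δ * (y ^ (1 - δ) * y ^ (δ/2)) := by field_simp
      _ = _ := by rw [← Real.rpow_add hy0]; congr 2; ring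
  have hlog0 : 0 ≤ Real.log y := Real.log_nonneg hy
  have k1 : |e y * Real.log y| ≤ C * (2 / δ) * Z := by
    rw [abs_mul, abs_of_nonneg hlog0]
    calc |e y| * Real.log y ≤ C * y ^ (1 - δ) * Real.log y := by gcongr
      _ = C * (y ^ (1 - δ) * Real.log y) := by ring
      _ ≤ C * (2 / δ * Z) := by gcongr
      _ = _ := by ring
  have k2 : |-e y| ≤ C * Z := by
    rw [abs_neg]; exact hE.trans (by gcongr)
  have k3 : |-P| ≤ C / (1 - δ) * Z := by
    rw [abs_neg]
    have : 0 < 1 - δ := by linarith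
    exact hP.trans (by gcongr)
  have k4 : |y * Q| ≤ C / δ * Z := by
    rw [abs_mul, abs_of_pos hy0]
    calc y * |Q| ≤ y * (C / δ * y ^ (-δ)) := by gcongr
      _ = C / δ * (y ^ (1:ℝ) * y ^ (-δ)) := by rw [Real.rpow_one]; ring
      _ = C / δ * y ^ (1 - δ) := by rw [← Real.rpow_add hy0]; congr 2
      _ ≤ _ := by gcongr
  have k0 : |κ| ≤ |κ| * Z := le_mul_of_one_le_right (abs_nonneg _) hZ1
  calc |κ + e y * Real.log y + (- e y) + (- P) + y * Q|
      ≤ |κ| + |e y * Real.log y| + |-e y| + |-P| + |y * Q| := by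
        refine (abs_add_le _ _).trans ?_
        gcongr
        refine (abs_add_le _ _).trans ?_
        gcongr
        refine (abs_add_le _ _).trans ?_
        gcongr
        exact abs_add_le _ _
    _ ≤ _ := by
      linarith
end Selberg


namespace Selberg
open Finset ArithmeticFunction

theorem selberg_bound (r Lam : ArithmeticFunction ℝ) (hr1 : r 1 = 1) (hr : ∀ n, 0 ≤ r n)
    (hL : ∀ n, 0 ≤ Lam n) (h : Lam * r = D r) (κ C δ : ℝ) (hκ : 0 < κ) (hC : 0 ≤ C)
    (hδ : 0 < δ) (hδ1 : δ < 1)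
    (hA : ∀ x : ℝ, 1 ≤ x → |∑ n ∈ Ioc 0 ⌊x⌋₊, r n - κ * x| ≤ C * x ^ (1 - δ)) :
    ∃ C' : ℝ, ∀ x : ℝ, 2 ≤ x →
      ∑ n ∈ Ioc 0 ⌊x⌋₊, Lam n ≤ 2 * x + C' * (x / Real.log x) := by
  obtain ⟨mu, hmu1, hmu2, hmu3⟩ := exists_mu r Lam hr1 hL h
  obtain ⟨c0, C1, hC1, habel⟩ := abel_est r κ C δ hC hδ hδ1 hA
  set A : ℝ → ℝ := fun x => ∑ n ∈ Ioc 0 ⌊x⌋₊, r n with hAdef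
  set ψ : ℝ → ℝ := fun x => ∑ n ∈ Ioc 0 ⌊x⌋₊, Lam n with hψdef
  set M : ℝ → ℝ := fun x => ∑ n ∈ Ioc 0 ⌊x⌋₊, Lam n / n with hMdef
  set T : ℝ → ℝ := fun x => ∑ n ∈ Ioc 0 ⌊x⌋₊, r n * Real.log n with hTdef
  have hψ0 : ∀ x, 0 ≤ ψ x := fun x => Finset.sum_nonneg fun n _ => hL n
  have hM0 : ∀ x, 0 ≤ M x := fun x => Finset.sum_nonneg fun n _ => div_nonneg (hL n) (by positivity)
  have hmem : ∀ {x : ℝ} {n : ℕ}, 0 ≤ x → n ∈ Ioc 0 ⌊x⌋₊ → (1:ℝ) ≤ n ∧ (n:ℝ) ≤ x := by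
    intro x n hx hn
    rw [Finset.mem_Ioc] at hn
    exact ⟨by exact_mod_cast hn.1, (Nat.le_floor_iff hx).1 hn.2⟩
  have hdiv : ∀ {x : ℝ} {n : ℕ}, 0 ≤ x → n ∈ Ioc 0 ⌊x⌋₊ → 1 ≤ x / n := by
    intro x n hx hn
    obtain ⟨h1, h2⟩ := hmem hx hn
    rw [le_div_iff₀ (by linarith)]; linarith
  have hA1 : ∀ x, 0 ≤ x → A x ≤ (κ + C) * x := by
    intro x hx
    rcases lt_or_ge x 1 with hx1 | hx1
    · have : A x = 0 := by simp [hAdef, Nat.floor_eq_zero.2 hx1]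
      rw [this]; positivity
    · have h1 := (abs_le.1 (hA x hx1)).2
      have h2 : x ^ (1 - δ) ≤ x := by
        calc x ^ (1 - δ) ≤ x ^ (1:ℝ) := Real.rpow_le_rpow_of_exponent_le hx1 (by linarith)
          _ = x := Real.rpow_one x
      have h3 : A x - κ * x ≤ C * x ^ (1 - δ) := h1
      nlinarith
  -- lower bound
  obtain ⟨c, hc, hAc⟩ : ∃ c : ℝ, 0 < c ∧ ∀ y : ℝ, 1 ≤ y → c * y ≤ A y := by
    have ht : Tendsto (fun y : ℝ => y ^ (-δ)) atTop (nhds 0) := tendsto_rpow_neg_atTop hδ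
    have hev : ∀ᶠ y : ℝ in atTop, C * y ^ (-δ) < κ / 2 := by
      have := ht.const_mul C
      rw [mul_zero] at this
      exact this.eventually_lt_const (by positivity)
    obtain ⟨Y, hY⟩ := eventually_atTop.1 hev
    set Y0 := max Y 1
    have hY0 : 1 ≤ Y0 := le_max_right _ _
    refine ⟨min (κ / 2) (1 / Y0), by positivity, fun y hy => ?_⟩
    have hy0 : 0 < y := by linarith
    rcases le_or_gt Y0 y with hyY | hyY
    · have h1 := (abs_le.1 (hA y hy)).1
      have h2 := hY y (le_trans (le_max_left _ _) hyY)
      have h3 : y ^ (1 - δ) = y ^ (-δ) * y := by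
        rw [← Real.rpow_add_one hy0.ne']; congr 1; ring
      have h4 : A y ≥ κ * y - C * y ^ (1 - δ) := by simp only [hAdef]; linarith
      calc min (κ / 2) (1 / Y0) * y ≤ κ / 2 * y := by gcongr; exact min_le_left _ _
        _ ≤ A y := by rw [h3] at h4; nlinarith
    · have h1 : 1 ≤ A y := by
        have : r 1 ≤ A y := by
          apply Finset.single_le_sum (f := fun n => r n) (fun n _ => hr n)
          rw [Finset.mem_Ioc]
          exact ⟨one_pos, (Nat.one_le_floor_iff _).2 hy⟩
        rwa [hr1] at this
      calc min (κ / 2) (1 / Y0) * y ≤ 1 / Y0 * y := by gcongr; exact min_le_right _ _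
        _ ≤ 1 / Y0 * Y0 := by gcongr
        _ = 1 := by field_simp
        _ ≤ _ := h1
  have hT : ∀ x, T x = ∑ d ∈ Ioc 0 ⌊x⌋₊, Lam d * A (x / d) := by
    intro x
    have := sum_conv (fun d e => Lam d * r e) x
    simp only [← Finset.mul_sum] at this
    rw [← this]
    refine Finset.sum_congr rfl fun n _ => ?_
    rw [← D_apply, ← h, ArithmeticFunction.mul_apply]
  have hT' : ∀ x, T x = ∑ d ∈ Ioc 0 ⌊x⌋₊, r d * ψ (x / d) := by
    intro x
    have := sum_conv (fun d e => r d * Lam e) x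
    simp only [← Finset.mul_sum] at this
    rw [← this]
    refine Finset.sum_congr rfl fun n _ => ?_
    rw [← D_apply, ← h, mul_comm, ArithmeticFunction.mul_apply]
  have hTle : ∀ x, 1 ≤ x → T x ≤ A x * Real.log x := by
    intro x hx
    simp only [hTdef, hAdef]
    rw [Finset.sum_mul]
    refine Finset.sum_le_sum fun n hn => ?_
    obtain ⟨h1, h2⟩ := hmem (by linarith) hn
    exact mul_le_mul_of_nonneg_left (Real.log_le_log (by linarith) h2) (hr n)
  have hM1 : ∀ x, 1 ≤ x → M x ≤ (κ + C) / c * Real.log x := by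
    intro x hx
    have hx0 : 0 < x := by linarith
    have h1 : c * x * M x ≤ T x := by
      rw [hT, Finset.mul_sum]
      refine Finset.sum_le_sum fun n hn => ?_
      have := hAc (x / n) (hdiv hx0.le hn)
      calc c * x * (Lam n / n) = Lam n * (c * (x / n)) := by ring
        _ ≤ _ := mul_le_mul_of_nonneg_left this (hL n)
    have hlog := Real.log_nonneg hx
    have h2 : T x ≤ (κ + C) * x * Real.log x :=
      (hTle x hx).trans (mul_le_mul_of_nonneg_right (hA1 x hx0.le) hlog)
    rw [div_mul_eq_mul_div, le_div_iff₀ hc]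
    have : x * (M x * c) ≤ x * ((κ + C) * Real.log x) := by linarith
    exact le_of_mul_le_mul_left this hx0
  -- the function F and R
  set c1 : ℝ := c0 / κ with hc1
  set F : ℝ → ℝ := fun y => ψ y - y - c1 with hF
  set R : ℝ → ℝ := fun y => ∑ n ∈ Ioc 0 ⌊y⌋₊, r n * F (y / n) with hRdef
  have hR : ∀ y, 1 ≤ y → |R y| ≤ (C1 + |c1| * C) * y ^ (1 - δ / 2) := by
    intro y hy
    have e1 : R y = (∑ n ∈ Ioc 0 ⌊y⌋₊, r n * (Real.log n - y / n) - c0 * y)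
        - c1 * (A y - κ * y) := by
      have e2 : R y = T y - ∑ n ∈ Ioc 0 ⌊y⌋₊, r n * (y / n) - c1 * A y := by
        rw [hT']
        simp only [hRdef, hF, hAdef]
        rw [Finset.mul_sum, ← Finset.sum_sub_distrib, ← Finset.sum_sub_distrib]
        exact Finset.sum_congr rfl fun n _ => by ring
      have e3 : ∑ n ∈ Ioc 0 ⌊y⌋₊, r n * (Real.log n - y / n) =
          T y - ∑ n ∈ Ioc 0 ⌊y⌋₊, r n * (y / n) := by
        simp only [hTdef]
        rw [← Finset.sum_sub_distrib]
        exact Finset.sum_congr rfl fun n _ => by ring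
      rw [e2, e3]
      have : c0 = c1 * κ := by rw [hc1]; field_simp
      rw [this]
      ring
    rw [e1]
    have h1 := habel y hy
    have h2 : |c1 * (A y - κ * y)| ≤ |c1| * C * y ^ (1 - δ / 2) := by
      rw [abs_mul, mul_assoc]
      gcongr
      exact (hA y hy).trans (by gcongr; linarith)
    refine (abs_sub _ _).trans ?_
    rw [add_mul]
    exact add_le_add h1 h2
  set C3 := C1 + |c1| * C with hC3
  have hC30 : 0 ≤ C3 := by positivity
  -- Tatuzawa-Iseki
  have hTI : ∀ x, 1 ≤ x → ∑ n ∈ Ioc 0 ⌊x⌋₊, mu n * (Real.log (x / n) * R (x / n)) =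
      F x * Real.log x + ∑ n ∈ Ioc 0 ⌊x⌋₊, F (x / n) * Lam n := by
    intro x hx
    have hx0 : 0 < x := by linarith
    have hh := sum_conv (fun n m => mu n * (r m * F (x / (n * m : ℕ)) *
      (Real.log (x / (n * m : ℕ)) + Real.log m))) x
    have l1 : ∑ n ∈ Ioc 0 ⌊x⌋₊, mu n * (Real.log (x / n) * R (x / n)) =
        ∑ n ∈ Ioc 0 ⌊x⌋₊, ∑ m ∈ Ioc 0 ⌊x / n⌋₊, mu n * (r m * F (x / (n * m : ℕ)) *
      (Real.log (x / (n * m : ℕ)) + Real.log m)) := by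
      refine Finset.sum_congr rfl fun n hn => ?_
      have hn0 := (hmem hx0.le hn).1
      rw [← Finset.mul_sum]
      simp only [hRdef]
      rw [Finset.mul_sum]
      congr 1
      refine Finset.sum_congr rfl fun m hm => ?_
      have hm0 := (hmem (by positivity) hm).1
      have : Real.log (x / n) = Real.log (x / (n * m : ℕ)) + Real.log m := by
        rw [← Real.log_mul (by push_cast; positivity) (by positivity)]
        congr 1
        push_cast
        field_simp
      rw [← this, show x / n / m = x / (n * m : ℕ) by push_cast; field_simp]
      ring
    rw [l1, ← hh]
    have l2 : ∀ N ∈ Ioc 0 ⌊x⌋₊, ∑ p ∈ N.divisorsAntidiagonal,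
        mu p.1 * (r p.2 * F (x / (p.1 * p.2 : ℕ)) * (Real.log (x / (p.1 * p.2 : ℕ)) + Real.log p.2))
        = F (x / N) * Real.log (x / N) * (1 : ArithmeticFunction ℝ) N + F (x / N) * Lam N := by
      intro N hN
      rw [← hmu1, ← hmu2, ArithmeticFunction.mul_apply, ArithmeticFunction.mul_apply,
        Finset.mul_sum, Finset.mul_sum, ← Finset.sum_add_distrib]
      refine Finset.sum_congr rfl fun p hp => ?_
      rw [(Nat.mem_divisorsAntidiagonal.1 hp).1, D_apply]
      ring
    rw [Finset.sum_congr rfl l2, Finset.sum_add_distrib]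
    congr 1
    rw [Finset.sum_eq_single 1]
    · simp
    · intro N _ hN
      rw [ArithmeticFunction.one_apply_ne hN]; simp
    · intro hh
      exfalso; apply hh
      rw [Finset.mem_Ioc]
      exact ⟨one_pos, (Nat.one_le_floor_iff _).2 hx⟩
  obtain ⟨C4, hC4, hS4⟩ := sum_rpow_le (fun n => r n) hr (κ + C) (by positivity) hA1 (1 - δ / 4)
    (by linarith) (by linarith)
  have hSel : ∀ x, 1 ≤ x → |F x * Real.log x + ∑ n ∈ Ioc 0 ⌊x⌋₊, F (x / n) * Lam n| ≤
      C3 * (4 / δ) * C4 * x := by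
    intro x hx
    have hx0 : 0 < x := by linarith
    rw [← hTI x hx]
    calc |∑ n ∈ Ioc 0 ⌊x⌋₊, mu n * (Real.log (x / n) * R (x / n))|
        ≤ ∑ n ∈ Ioc 0 ⌊x⌋₊, |mu n * (Real.log (x / n) * R (x / n))| := Finset.abs_sum_le_sum_abs _ _
      _ ≤ ∑ n ∈ Ioc 0 ⌊x⌋₊, C3 * (4 / δ) * (r n * (x / n) ^ (1 - δ / 4)) := by
        refine Finset.sum_le_sum fun n hn => ?_
        have hy := hdiv hx0.le hn
        have hy0 : 0 < x / n := by linarith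
        set y := x / n
        have hlog := Real.log_nonneg hy
        have hl := Real.log_le_rpow_div hy0.le (by linarith : 0 < δ / 4)
        rw [abs_mul, abs_mul, abs_of_nonneg hlog]
        calc |mu n| * (Real.log y * |R y|)
            ≤ r n * (y ^ (δ / 4) / (δ / 4) * (C3 * y ^ (1 - δ / 2))) := by
              gcongr
              · exact hr n
              · exact hmu3 n
              · exact hR y hy
          _ = C3 * (4 / δ) * (r n * (y ^ (δ / 4) * y ^ (1 - δ / 2))) := by field_simp
          _ = _ := by
            rw [← Real.rpow_add hy0, show δ / 4 + (1 - δ / 2) = 1 - δ / 4 by ring]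
      _ = C3 * (4 / δ) * ∑ n ∈ Ioc 0 ⌊x⌋₊, r n * (x / n) ^ (1 - δ / 4) := by rw [Finset.mul_sum]
      _ ≤ C3 * (4 / δ) * (C4 * x) := mul_le_mul_of_nonneg_left (hS4 x hx0.le) (by positivity)
      _ = _ := by ring
  set C5 := C3 * (4 / δ) * C4 with hC5
  have hC50 : 0 ≤ C5 := by positivity
  have hmain : ∀ x, 1 ≤ x → ψ x * Real.log x ≤
      x * Real.log x + |c1| * x + x * M x + |c1| * ψ x + C5 * x := by
    intro x hx
    have hx0 : 0 < x := by linarith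
    have h1 := (abs_le.1 (hSel x hx)).2
    have e1 : ∑ n ∈ Ioc 0 ⌊x⌋₊, F (x / n) * Lam n =
        ∑ n ∈ Ioc 0 ⌊x⌋₊, ψ (x / n) * Lam n - x * M x - c1 * ψ x := by
      simp only [hF, hMdef]
      conv_rhs => rw [hψdef]
      simp only [Finset.mul_sum]
      rw [← Finset.sum_sub_distrib, ← Finset.sum_sub_distrib]
      exact Finset.sum_congr rfl fun n _ => by ring
    have e2 : 0 ≤ ∑ n ∈ Ioc 0 ⌊x⌋₊, ψ (x / n) * Lam n :=
      Finset.sum_nonneg fun n _ => mul_nonneg (hψ0 _) (hL _)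
    rw [e1] at h1
    have hlog := Real.log_nonneg hx
    have hlogx : Real.log x ≤ x := (Real.log_le_sub_one_of_pos hx0).trans (by linarith)
    have e3 : c1 * Real.log x ≤ |c1| * x := by
      calc c1 * Real.log x ≤ |c1| * Real.log x := by gcongr; exact le_abs_self _
        _ ≤ _ := by gcongr
    have e4 : c1 * ψ x ≤ |c1| * ψ x := mul_le_mul_of_nonneg_right (le_abs_self _) (hψ0 x)
    have e5 : F x * Real.log x = ψ x * Real.log x - x * Real.log x - c1 * Real.log x := by
      simp only [hF]; ring
    rw [e5] at h1
    linarith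
  have hψmono : ∀ x y : ℝ, x ≤ y → ψ x ≤ ψ y := by
    intro x y hxy
    apply Finset.sum_le_sum_of_subset_of_nonneg
    · exact Finset.Ioc_subset_Ioc_right (Nat.floor_le_floor hxy)
    · intros; exact hL _
  -- Chebyshev bound
  obtain ⟨C6, hC6, hcheb⟩ : ∃ C6 : ℝ, 0 ≤ C6 ∧ ∀ x, 0 ≤ x → ψ x ≤ C6 * x := by
    set X0 := Real.exp (2 * |c1| + 1) with hX0
    set K := 1 + (κ + C) / c + |c1| + C5 with hK
    have hK0 : 0 ≤ K := by positivity
    refine ⟨max (2 * K) (ψ X0), le_max_of_le_left (by positivity), fun x hx => ?_⟩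
    rcases lt_or_ge x 1 with hx1 | hx1
    · have : ψ x = 0 := by simp [hψdef, Nat.floor_eq_zero.2 hx1]
      rw [this]
      exact mul_nonneg (le_max_of_le_left (by positivity)) hx
    rcases le_or_gt x X0 with hxX | hxX
    · calc ψ x ≤ ψ X0 := hψmono _ _ hxX
        _ ≤ ψ X0 * x := le_mul_of_one_le_right (hψ0 _) hx1
        _ ≤ _ := by gcongr; exact le_max_right _ _
    · have hx0 : 0 < x := by linarith
      have hl : 2 * |c1| + 1 ≤ Real.log x := by
        rw [Real.le_log_iff_exp_le hx0]; exact hxX.le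
      have h0 := abs_nonneg c1
      have h1 := hmain x hx1
      have h2 : x * M x ≤ x * ((κ + C) / c * Real.log x) := mul_le_mul_of_nonneg_left (hM1 x hx1) hx
      have h3 : |c1| * ψ x ≤ Real.log x / 2 * ψ x :=
        mul_le_mul_of_nonneg_right (by linarith) (hψ0 x)
      have h4 : (|c1| + C5) * x ≤ (|c1| + C5) * x * Real.log x :=
        le_mul_of_one_le_right (by positivity) (by linarith)
      have h5 : Real.log x * ψ x ≤ Real.log x * (2 * K * x) := by
        simp only [hK]; linarith
      calc ψ x ≤ 2 * K * x := le_of_mul_le_mul_left h5 (by linarith)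
        _ ≤ _ := by gcongr; exact le_max_left _ _
  obtain ⟨C7, hC7, hS7⟩ := sum_rpow_le (fun n => Lam n) hL C6 hC6 hcheb (1 - δ)
    (by linarith) (by linarith)
  have hM2 : ∀ x, 1 ≤ x → M x ≤ Real.log x + (C / δ + C * C7) / κ := by
    intro x hx
    have hx0 : 0 < x := by linarith
    have h1 : κ * x * M x ≤ T x + C * (C7 * x) := by
      have : κ * x * M x ≤ ∑ n ∈ Ioc 0 ⌊x⌋₊, (Lam n * A (x / n) + C * (Lam n * (x / n) ^ (1 - δ))) := by
        rw [Finset.mul_sum]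
        refine Finset.sum_le_sum fun n hn => ?_
        have h2 := (abs_le.1 (hA (x / n) (hdiv hx0.le hn))).1
        have h3 : κ * (x / n) ≤ A (x / n) + C * (x / n) ^ (1 - δ) := by
          simp only [hAdef]; linarith
        calc κ * x * (Lam n / n) = Lam n * (κ * (x / n)) := by ring
          _ ≤ Lam n * (A (x / n) + C * (x / n) ^ (1 - δ)) := mul_le_mul_of_nonneg_left h3 (hL n)
          _ = _ := by ring
      rw [Finset.sum_add_distrib, ← Finset.mul_sum, ← hT] at this
      exact this.trans (by gcongr; exact hS7 x hx0.le)
    have hlog := Real.log_nonneg hx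
    have h2 : T x ≤ κ * x * Real.log x + C / δ * x := by
      have h3 : A x ≤ κ * x + C * x ^ (1 - δ) := by
        have := (abs_le.1 (hA x hx)).2
        simp only [hAdef]; linarith
      have h4 : x ^ (1 - δ) * Real.log x ≤ x / δ := by
        calc x ^ (1 - δ) * Real.log x ≤ x ^ (1 - δ) * (x ^ δ / δ) := by
              gcongr; exact Real.log_le_rpow_div hx0.le hδ
          _ = (x ^ (1 - δ) * x ^ δ) / δ := by ring
          _ = x / δ := by rw [← Real.rpow_add hx0]; simp
      calc T x ≤ A x * Real.log x := hTle x hx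
        _ ≤ (κ * x + C * x ^ (1 - δ)) * Real.log x := by gcongr
        _ = κ * x * Real.log x + C * (x ^ (1 - δ) * Real.log x) := by ring
        _ ≤ κ * x * Real.log x + C * (x / δ) := by gcongr
        _ = _ := by ring
    have h5 : (κ * x) * M x ≤ (κ * x) * (Real.log x + (C / δ + C * C7) / κ) := by
      have : (κ * x) * (Real.log x + (C / δ + C * C7) / κ) =
        κ * x * Real.log x + C / δ * x + C * (C7 * x) := by field_simp; ring
      rw [this]; linarith
    exact le_of_mul_le_mul_left h5 (by positivity)
  set C8 := (C / δ + C * C7) / κ with hC8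
  refine ⟨|c1| + C8 + |c1| * C6 + C5, fun x hx => ?_⟩
  have hx0 : 0 < x := by linarith
  have hx1 : 1 ≤ x := by linarith
  have hlog : 0 < Real.log x := Real.log_pos (by linarith)
  have h1 := hmain x hx1
  have h2 : x * M x ≤ x * (Real.log x + C8) := mul_le_mul_of_nonneg_left (hM2 x hx1) hx0.le
  have h3 : |c1| * ψ x ≤ |c1| * (C6 * x) := mul_le_mul_of_nonneg_left (hcheb x hx0.le) (abs_nonneg _)
  have h4 : Real.log x * ψ x ≤
      Real.log x * (2 * x + (|c1| + C8 + |c1| * C6 + C5) * (x / Real.log x)) := by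
    have : Real.log x * (2 * x + (|c1| + C8 + |c1| * C6 + C5) * (x / Real.log x)) =
      2 * x * Real.log x + (|c1| + C8 + |c1| * C6 + C5) * x := by field_simp
    rw [this]; linarith
  exact le_of_mul_le_mul_left h4 hlog
end Selberg


namespace IdealCount
open MeasureTheory Module

/-- Riemann sum estimate for Lipschitz functions on a lattice. -/
theorem riemann_sum {E : Type*} [NormedAddCommGroup E] [NormedSpace ℝ E] [FiniteDimensional ℝ E]
    [MeasurableSpace E] [BorelSpace E] (Λ : Submodule ℤ E) [DiscreteTopology Λ] [IsZLattice ℝ Λ]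
    (R : ℝ) (hR : 0 < R) :
    ∃ C : ℝ, 0 ≤ C ∧ ∀ (φ : E → ℝ) (L : ℝ), 0 ≤ L → (∀ x y, |φ x - φ y| ≤ L * ‖x - y‖) →
      (∀ x, R < ‖x‖ → φ x = 0) → ∃ c : ℝ, ∀ T : ℝ, 1 ≤ T →
        |∑' β : Λ, φ (T⁻¹ • (β : E)) - c * T ^ finrank ℝ E| * T ≤ C * L * T ^ finrank ℝ E := by
  classical
  set μ : Measure E := Measure.addHaar
  have hinst : VAddInvariantMeasure Λ E μ :=
    inferInstanceAs (VAddInvariantMeasure Λ.toAddSubgroup E μ)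
  set b := Free.chooseBasis ℤ Λ
  set D : Set E := ZSpan.fundamentalDomain (b.ofZLatticeBasis ℝ) with hD
  have hfd : IsAddFundamentalDomain Λ D μ := ZLattice.isAddFundamentalDomain b μ
  have hDm : MeasurableSet D := ZSpan.fundamentalDomain_measurableSet _
  have hD0 : μ D ≠ 0 := ZSpan.measure_fundamentalDomain_ne_zero _
  have hDb : Bornology.IsBounded D := ZSpan.fundamentalDomain_isBounded _
  have hDt : μ D < ⊤ := hDb.measure_lt_top
  obtain ⟨ρ, hρ0, hρ⟩ : ∃ ρ : ℝ, 0 < ρ ∧ ∀ x ∈ D, ‖x‖ ≤ ρ := by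
    obtain ⟨ρ, h⟩ := isBounded_iff_forall_norm_le.1 hDb
    exact ⟨max ρ 1, by positivity, fun x hx => (h x hx).trans (le_max_left _ _)⟩
  set v : ℝ := μ.real D with hv
  have hv0 : 0 < v := ENNReal.toReal_pos hD0 hDt.ne
  set V : ℝ := μ.real (Metric.closedBall 0 (R + 2 * ρ)) with hV
  set d := finrank ℝ E
  refine ⟨V / v * ρ, by positivity, ?_⟩
  intro φ L hL hLip hsupp
  refine ⟨(∫ x, φ x ∂μ) / v, fun T hT => ?_⟩
  have hT0 : 0 < T := by linarith
  have hcont : Continuous φ := by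
    have : LipschitzWith ⟨L, hL⟩ φ := LipschitzWith.of_dist_le_mul fun x y => by
      rw [Real.dist_eq, dist_eq_norm]; exact hLip x y
    exact this.continuous
  have hnT : ∀ x : E, ‖T⁻¹ • x‖ = T⁻¹ * ‖x‖ := fun x => by
    rw [norm_smul, Real.norm_of_nonneg (by positivity)]
  have hcs : HasCompactSupport fun x => φ (T⁻¹ • x) := by
    refine HasCompactSupport.intro (isCompact_closedBall 0 (R * T)) fun x hx => ?_
    apply hsupp
    rw [mem_closedBall_zero_iff, not_le] at hx
    rw [hnT, ← div_eq_inv_mul, lt_div_iff₀ hT0]; exact hx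
  have hcont' : Continuous fun x => φ (T⁻¹ • x) := hcont.comp (continuous_const_smul _)
  have hintg : Integrable (fun x => φ (T⁻¹ • x)) μ := hcont'.integrable_of_hasCompactSupport hcs
  have h1 : T ^ d * ∫ x, φ x ∂μ = ∑' β : Λ, ∫ x in D, φ (T⁻¹ • ((β : E) + x)) ∂μ := by
    have h2 := hfd.integral_eq_tsum'' _ hintg
    rw [Measure.integral_comp_inv_smul_of_nonneg μ φ hT0.le, smul_eq_mul] at h2
    exact h2
  have hfin : {β : Λ | ‖(β : E)‖ ≤ (R + ρ) * T}.Finite := by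
    have := Metric.finite_isBounded_inter_isClosed (s := (Λ : Set E)) (K := Metric.closedBall 0 ((R + ρ) * T))
      DiscreteTopology.isDiscrete Metric.isBounded_closedBall
      (AddSubgroup.isClosed_of_discrete (H := Λ.toAddSubgroup))
    refine Set.Finite.of_finite_image (f := fun β : Λ => (β : E)) (this.subset ?_)
      Subtype.val_injective.injOn
    rintro _ ⟨β, hβ, rfl⟩
    exact ⟨mem_closedBall_zero_iff.2 hβ, β.2⟩
  set S := hfin.toFinset with hS
  have hzero : ∀ β : Λ, β ∉ S → ∀ x : E, ‖x‖ ≤ ρ → φ (T⁻¹ • ((β : E) + x)) = 0 := by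
    intro β hβ x hx
    rw [hS, Set.Finite.mem_toFinset, Set.mem_setOf_eq, not_le] at hβ
    apply hsupp
    rw [hnT, ← div_eq_inv_mul, lt_div_iff₀ hT0]
    have : ‖(β : E)‖ ≤ ‖(β : E) + x‖ + ‖x‖ := by
      have := norm_sub_le ((β : E) + x) x
      rwa [add_sub_cancel_right] at this
    nlinarith
  have e1 : ∑' β : Λ, φ (T⁻¹ • (β : E)) = ∑ β ∈ S, φ (T⁻¹ • (β : E)) := by
    apply tsum_eq_sum
    intro β hβ
    simpa using hzero β hβ 0 (by simpa using hρ0.le)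
  have e2 : ∑' β : Λ, ∫ x in D, φ (T⁻¹ • ((β : E) + x)) ∂μ =
      ∑ β ∈ S, ∫ x in D, φ (T⁻¹ • ((β : E) + x)) ∂μ := by
    apply tsum_eq_sum
    intro β hβ
    rw [setIntegral_congr_fun (g := fun _ => (0:ℝ)) hDm fun x hx => hzero β hβ x (hρ x hx)]
    simp
  have e3 : ∀ β : Λ, |v * φ (T⁻¹ • (β : E)) - ∫ x in D, φ (T⁻¹ • ((β : E) + x)) ∂μ| ≤
      L * (T⁻¹ * ρ) * v := by
    intro β
    have i1 : v * φ (T⁻¹ • (β : E)) = ∫ x in D, φ (T⁻¹ • (β : E)) ∂μ := by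
      rw [setIntegral_const, smul_eq_mul]
    have i2 : IntegrableOn (fun x => φ (T⁻¹ • ((β : E) + x))) D μ := by
      have : Integrable (fun x => φ (T⁻¹ • ((β : E) + x))) μ := hintg.comp_add_left (β : E)
      exact this.integrableOn
    have i3 : IntegrableOn (fun _ : E => φ (T⁻¹ • (β : E))) D μ := integrableOn_const hDt.ne (by simp)
    rw [i1, ← integral_sub i3 i2, ← Real.norm_eq_abs]
    refine norm_setIntegral_le_of_norm_le_const hDt fun x hx => ?_
    rw [Real.norm_eq_abs]
    refine (hLip _ _).trans ?_
    gcongr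
    rw [← smul_sub, hnT]
    gcongr
    simpa using hρ x hx
  have e4 : (S.card : ℝ) * v ≤ V * T ^ d := by
    have k1 := hfd.measure_eq_tsum' (Metric.closedBall 0 ((R + 2 * ρ) * T))
    have k2 : ∑ β ∈ S, μ D ≤ μ (Metric.closedBall 0 ((R + 2 * ρ) * T)) := by
      rw [k1]
      refine le_trans (Finset.sum_le_sum fun β hβ => ?_) (ENNReal.sum_le_tsum S)
      rw [Set.inter_eq_self_of_subset_right]
      · rw [measure_vadd]
      · rintro _ ⟨x, hx, rfl⟩
        rw [mem_closedBall_zero_iff]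
        rw [hS, Set.Finite.mem_toFinset, Set.mem_setOf_eq] at hβ
        refine (norm_add_le (β : E) x).trans ?_
        have := hρ x hx
        nlinarith
    rw [mul_comm (R + 2 * ρ), Measure.addHaar_closedBall_mul μ 0 hT0.le (by positivity)] at k2
    rw [Finset.sum_const, nsmul_eq_mul] at k2
    have k3 := ENNReal.toReal_mono (ENNReal.mul_ne_top ENNReal.ofReal_ne_top
      (measure_closedBall_lt_top.ne)) k2
    rw [ENNReal.toReal_mul, ENNReal.toReal_mul, ENNReal.toReal_natCast,
      ENNReal.toReal_ofReal (by positivity)] at k3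
    rw [mul_comm V]
    exact k3
  rw [e2] at h1
  have e5 : |v * ∑ β ∈ S, φ (T⁻¹ • (β : E)) - T ^ d * ∫ x, φ x ∂μ| ≤ S.card * (L * (T⁻¹ * ρ) * v) := by
    rw [h1, Finset.mul_sum, ← Finset.sum_sub_distrib]
    refine (Finset.abs_sum_le_sum_abs _ _).trans ?_
    refine (Finset.sum_le_sum fun β _ => e3 β).trans ?_
    rw [Finset.sum_const, nsmul_eq_mul]
  rw [e1]
  have e6 : v * ∑ β ∈ S, φ (T⁻¹ • (β : E)) - T ^ d * ∫ x, φ x ∂μ =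
      v * (∑ β ∈ S, φ (T⁻¹ • (β : E)) - (∫ x, φ x ∂μ) / v * T ^ d) := by
    field_simp
  rw [e6, abs_mul, abs_of_pos hv0] at e5
  set Z := |∑ β ∈ S, φ (T⁻¹ • (β : E)) - (∫ x, φ x ∂μ) / v * T ^ d|
  have e7 : v * (Z * T) ≤ v * (V / v * ρ * L * T ^ d) := by
    calc v * (Z * T) = v * Z * T := by ring
      _ ≤ S.card * (L * (T⁻¹ * ρ) * v) * T := by gcongr
      _ = (S.card * v) * (L * ρ) := by field_simp
      _ ≤ (V * T ^ d) * (L * ρ) := by gcongr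
      _ = _ := by field_simp
  exact le_of_mul_le_mul_left e7 hv0
end IdealCount

namespace IdealCount
open NumberField NumberField.mixedEmbedding NumberField.mixedEmbedding.fundamentalCone NumberField.Units NumberField.Units.dirichletUnitTheorem

noncomputable def hat (x : ℝ) : ℝ := max 0 (1 - |x|)

lemma hat_nonneg (x : ℝ) : 0 ≤ hat x := le_max_left _ _
lemma hat_le_one (x : ℝ) : hat x ≤ 1 := max_le zero_le_one (by linarith [abs_nonneg x])
lemma hat_lip (x y : ℝ) : |hat x - hat y| ≤ |x - y| := by
  unfold hat
  rw [max_comm 0, max_comm 0]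
  refine (abs_max_sub_max_le_abs _ _ _).trans ?_
  rw [show (1 - |x|) - (1 - |y|) = |y| - |x| by ring, abs_sub_comm x y]
  exact abs_abs_sub_abs_le y x
lemma hat_zero {x : ℝ} (h : 1 ≤ |x|) : hat x = 0 := max_eq_left (by linarith)

lemma hasSum_hat_pi {ι : Type*} [Fintype ι] (c : ι → ℝ) :
    HasSum (fun m : ι → ℤ => ∏ i, hat (c i + m i)) 1 := by
  classical
  have key := hasSum_sum_of_ne_finset_zero (L := SummationFilter.unconditional _) (f := fun m : ι → ℤ => ∏ i, hat (c i + m i))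
    (s := Fintype.piFinset (fun i => ({-⌊c i⌋, -⌊c i⌋ - 1} : Finset ℤ))) ?_
  · rw [← Finset.prod_univ_sum (f := fun i (n : ℤ) => hat (c i + n))] at key
    convert key
    symm
    apply Finset.prod_eq_one
    intro i _
    rw [Finset.sum_pair (by omega)]
    have h1 := Int.floor_le (c i)
    have h2 := Int.lt_floor_add_one (c i)
    unfold hat
    push_cast
    rw [abs_of_nonneg (a := c i + -(⌊c i⌋ : ℝ)) (by linarith), abs_of_nonpos (by linarith),
      max_eq_right (by linarith), max_eq_right (by linarith)]
    ring
  · intro m hm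
    simp only [Fintype.mem_piFinset, Finset.mem_insert, Finset.mem_singleton, not_forall, not_or] at hm
    obtain ⟨i, hi1, hi2⟩ := hm
    apply Finset.prod_eq_zero (Finset.mem_univ i)
    apply hat_zero
    have h1 := Int.floor_le (c i)
    have h2 := Int.lt_floor_add_one (c i)
    have : m i ≤ -⌊c i⌋ - 2 ∨ -⌊c i⌋ + 1 ≤ m i := by omega
    rcases this with h | h
    · have : (m i : ℝ) ≤ -⌊c i⌋ - 2 := by exact_mod_cast h
      rw [le_abs]; right; linarith
    · have : -(⌊c i⌋ : ℝ) + 1 ≤ m i := by exact_mod_cast h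
      rw [le_abs]; left; linarith

lemma prod_lip {ι : Type*} (s : Finset ι) (f g : ι → ℝ) (hf : ∀ i, 0 ≤ f i ∧ f i ≤ 1)
    (hg : ∀ i, 0 ≤ g i ∧ g i ≤ 1) : |∏ i ∈ s, f i - ∏ i ∈ s, g i| ≤ ∑ i ∈ s, |f i - g i| := by
  classical
  induction s using Finset.induction_on with
  | empty => simp
  | insert a s ha ih =>
    rw [Finset.prod_insert ha, Finset.prod_insert ha, Finset.sum_insert ha]
    have h1 : |∏ i ∈ s, f i| ≤ 1 := by
      rw [abs_of_nonneg (Finset.prod_nonneg fun i _ => (hf i).1)]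
      exact Finset.prod_le_one (fun i _ => (hf i).1) (fun i _ => (hf i).2)
    have h2 : |g a| ≤ 1 := by rw [abs_of_nonneg (hg a).1]; exact (hg a).2
    calc |f a * ∏ i ∈ s, f i - g a * ∏ i ∈ s, g i|
        = |(f a - g a) * ∏ i ∈ s, f i + g a * (∏ i ∈ s, f i - ∏ i ∈ s, g i)| := by ring_nf
      _ ≤ |f a - g a| * |∏ i ∈ s, f i| + |g a| * |∏ i ∈ s, f i - ∏ i ∈ s, g i| := by
        rw [← abs_mul, ← abs_mul]; exact abs_add_le _ _
      _ ≤ _ := by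
        gcongr
        · exact mul_le_of_le_one_right (abs_nonneg _) h1
        · exact (mul_le_of_le_one_left (abs_nonneg _) h2).trans ih

variable {K : Type*} [Field K] [NumberField K]

/-- admissible weight -/
structure Adm (ω : ℝ → ℝ) (L : ℝ) : Prop where
  one_le : 1 ≤ L
  nonneg : ∀ x, 0 ≤ ω x
  le_one : ∀ x, ω x ≤ 1
  lip : ∀ x y, |ω x - ω y| ≤ L * |x - y|
  supp : ∀ x, 2 < |x| → ω x = 0

variable (K) in
noncomputable def Om (ω : ℝ → ℝ) (v : realSpace K) : ℝ :=
  ω (∑ w, v w) * ∏ i : Fin (rank K), hat ((completeBasis K).repr v (equivFinRank i).1)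

variable (K) in
lemma Om_lip : ∃ C, 0 ≤ C ∧ ∀ ω L, Adm ω L → ∀ v v', |Om K ω v - Om K ω v'| ≤ C * L * ‖v - v'‖ := by
  classical
  let cf : InfinitePlace K → (realSpace K →L[ℝ] ℝ) := fun i => LinearMap.toContinuousLinearMap ((completeBasis K).coord i)
  refine ⟨Fintype.card (InfinitePlace K) + ∑ i : Fin (rank K), ‖cf (equivFinRank i).1‖, by positivity, ?_⟩
  intro ω L hω v v'
  have h1 : |ω (∑ w, v w) - ω (∑ w, v' w)| ≤ L * (Fintype.card (InfinitePlace K) * ‖v - v'‖) := by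
    refine (hω.lip _ _).trans ?_
    have := hω.one_le
    gcongr
    rw [← Finset.sum_sub_distrib]
    refine (Finset.abs_sum_le_sum_abs _ _).trans ?_
    rw [← nsmul_eq_mul, ← Finset.card_univ]
    apply Finset.sum_le_card_nsmul
    intro w _
    exact norm_le_pi_norm (v - v') w
  have h2 : |∏ i : Fin (rank K), hat ((completeBasis K).repr v (equivFinRank i).1) -
      ∏ i : Fin (rank K), hat ((completeBasis K).repr v' (equivFinRank i).1)| ≤ (∑ i : Fin (rank K), ‖cf (equivFinRank i).1‖) * ‖v - v'‖ := by
    refine (prod_lip _ _ _ (fun i => ⟨hat_nonneg _, hat_le_one _⟩) (fun i => ⟨hat_nonneg _, hat_le_one _⟩)).trans ?_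
    rw [Finset.sum_mul]
    refine Finset.sum_le_sum fun i _ => ?_
    refine (hat_lip _ _).trans ?_
    have := (cf (equivFinRank i).1).le_opNorm (v - v')
    simpa [cf, Module.Basis.coord_apply] using this
  unfold Om
  set P := ∏ i : Fin (rank K), hat ((completeBasis K).repr v (equivFinRank i).1)
  set P' := ∏ i : Fin (rank K), hat ((completeBasis K).repr v' (equivFinRank i).1)
  have hP : |P| ≤ 1 := by
    rw [abs_of_nonneg (Finset.prod_nonneg fun i _ => hat_nonneg _)]
    exact Finset.prod_le_one (fun i _ => hat_nonneg _) (fun i _ => hat_le_one _)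
  have hw : |ω (∑ w, v' w)| ≤ 1 := by rw [abs_of_nonneg (hω.nonneg _)]; exact hω.le_one _
  calc |ω (∑ w, v w) * P - ω (∑ w, v' w) * P'|
      = |(ω (∑ w, v w) - ω (∑ w, v' w)) * P + ω (∑ w, v' w) * (P - P')| := by ring_nf
    _ ≤ |ω (∑ w, v w) - ω (∑ w, v' w)| * |P| + |ω (∑ w, v' w)| * |P - P'| := by
        rw [← abs_mul, ← abs_mul]; exact abs_add_le _ _
    _ ≤ L * (Fintype.card (InfinitePlace K) * ‖v - v'‖) + L * ((∑ i : Fin (rank K), ‖cf (equivFinRank i).1‖) * ‖v - v'‖) := by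
        refine add_le_add ((mul_le_of_le_one_right (abs_nonneg _) hP).trans h1)
          ((mul_le_of_le_one_left (abs_nonneg _) hw).trans (h2.trans ?_))
        exact le_mul_of_one_le_left (by positivity) hω.one_le
    _ = _ := by ring

lemma sum_basis_ne (i : {w : InfinitePlace K // w ≠ w₀}) : ∑ w, completeBasis K i w = 0 := by
  rw [completeBasis_apply_of_ne]
  rw [sum_expMap_symm_apply (by simp)]
  simp

lemma sum_eq_coord (v : realSpace K) : ∑ w, v w = Module.finrank ℚ K * (completeBasis K).repr v w₀ := by
  classical
  conv_lhs => rw [← (completeBasis K).sum_repr v]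
  simp only [Finset.sum_apply, Pi.smul_apply, smul_eq_mul]
  rw [Finset.sum_comm]
  simp_rw [← Finset.mul_sum]
  rw [Finset.sum_eq_single w₀]
  · rw [completeBasis_apply_of_eq, ← InfinitePlace.sum_mult_eq]; push_cast; ring
  · intro i _ hi
    rw [sum_basis_ne ⟨i, hi⟩, mul_zero]
  · simp

variable (K) in
lemma Om_supp : ∃ B, 0 < B ∧ ∀ ω L, Adm ω L → ∀ v, Om K ω v ≠ 0 → ∀ w, |v w| ≤ B := by
  classical
  refine ⟨∑ i, 2 * ‖completeBasis K i‖ + 1, by positivity, ?_⟩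
  intro ω L hω v hv w
  have hw : ω (∑ w, v w) ≠ 0 := left_ne_zero_of_mul hv
  have h1 : |∑ w, v w| ≤ 2 := by
    by_contra h; exact hw (hω.supp _ (not_le.mp h))
  have hc : ∀ i, |(completeBasis K).repr v i| ≤ 2 := by
    intro i
    by_cases hi : i = w₀
    · subst hi
      rw [sum_eq_coord, abs_mul, Nat.abs_cast] at h1
      refine h1.trans' (le_mul_of_one_le_left (abs_nonneg _) ?_)
      exact_mod_cast Module.finrank_pos
    · have := Finset.prod_ne_zero_iff.mp (right_ne_zero_of_mul hv) (equivFinRank.symm ⟨i, hi⟩) (Finset.mem_univ _)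
      rw [Equiv.apply_symm_apply] at this
      have h2 : ¬ 1 ≤ |(completeBasis K).repr v i| := fun h => this (hat_zero h)
      linarith
  rw [← (completeBasis K).sum_repr v, Finset.sum_apply]
  refine (Finset.abs_sum_le_sum_abs _ _).trans ?_
  refine (Finset.sum_le_sum (g := fun i => 2 * ‖completeBasis K i‖) fun i _ => ?_).trans (by linarith)
  rw [Pi.smul_apply, smul_eq_mul, abs_mul]
  have := norm_le_pi_norm (completeBasis K i) w
  rw [Real.norm_eq_abs] at this
  gcongr
  exact hc i

end IdealCount

namespace IdealCount
open NumberField NumberField.mixedEmbedding NumberField.mixedEmbedding.fundamentalCone NumberField.Units NumberField.Units.dirichletUnitTheorem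

open scoped Classical

variable {K : Type*} [Field K] [NumberField K]

noncomputable def lg (x : mixedSpace K) : realSpace K := fun w => w.mult * Real.log (normAtPlace w x)
noncomputable def clg (B : ℝ) (x : mixedSpace K) : realSpace K :=
  fun w => w.mult * Real.log (max (normAtPlace w x) (Real.exp (-B)))

lemma log_lip {m a b : ℝ} (hm : 0 < m) (ha : m ≤ a) (hb : m ≤ b) : |Real.log a - Real.log b| ≤ m⁻¹ * |a - b| := by
  wlog h : b ≤ a generalizing a b
  · rw [abs_sub_comm, abs_sub_comm a]; exact this hb ha (not_le.mp h).le
  have hb0 : 0 < b := hm.trans_le hb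
  rw [abs_of_nonneg (sub_nonneg.mpr (Real.log_le_log hb0 h)), abs_of_nonneg (sub_nonneg.mpr h),
    ← Real.log_div (by linarith) hb0.ne']
  refine (Real.log_le_sub_one_of_pos (div_pos (hb0.trans_le h) hb0)).trans ?_
  rw [show a / b - 1 = b⁻¹ * (a - b) by field_simp]
  gcongr

lemma normAtPlace_le_norm (w : InfinitePlace K) (x : mixedSpace K) : normAtPlace w x ≤ ‖x‖ := by
  rw [norm_eq_sup'_normAtPlace]
  exact Finset.le_sup' (fun w => normAtPlace w x) (Finset.mem_univ w)

lemma normAtPlace_sub_le (w : InfinitePlace K) (x y : mixedSpace K) : |normAtPlace w x - normAtPlace w y| ≤ ‖x - y‖ := by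
  rw [abs_le]
  have h1 := normAtPlace_add_le w (x - y) y
  have h2 := normAtPlace_add_le w (y - x) x
  rw [sub_add_cancel] at h1 h2
  have h3 := normAtPlace_le_norm w (x - y)
  have h4 := normAtPlace_le_norm w (y - x)
  rw [norm_sub_rev] at h4
  constructor <;> linarith

lemma mult_le_two (w : InfinitePlace K) : (w.mult : ℝ) ≤ 2 := by
  unfold InfinitePlace.mult; split_ifs <;> norm_num
lemma one_le_mult' (w : InfinitePlace K) : (1 : ℝ) ≤ w.mult := by
  exact_mod_cast w.mult_pos

lemma clg_lip (B : ℝ) (x y : mixedSpace K) : ‖clg B x - clg B y‖ ≤ 2 * Real.exp B * ‖x - y‖ := by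
  rw [pi_norm_le_iff_of_nonneg (by positivity)]
  intro w
  rw [Pi.sub_apply, Real.norm_eq_abs]
  unfold clg
  rw [← mul_sub, abs_mul, Nat.abs_cast, mul_assoc]
  refine mul_le_mul (mult_le_two w) ?_ (abs_nonneg _) (by norm_num)
  refine (log_lip (Real.exp_pos (-B)) (le_max_right _ _) (le_max_right _ _)).trans ?_
  rw [Real.exp_neg, inv_inv]
  gcongr
  exact (abs_max_sub_max_le_abs _ _ _).trans (normAtPlace_sub_le w x y)

variable (K) in
lemma exists_phi : ∃ R, 0 < R ∧ ∃ C, 0 ≤ C ∧ ∀ ω L, Adm ω L → ∃ φ : mixedSpace K → ℝ,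
    (∀ x y, |φ x - φ y| ≤ C * L * ‖x - y‖) ∧ (∀ x, R < ‖x‖ → φ x = 0) ∧
    (∀ x, mixedEmbedding.norm x = 0 → φ x = 0) ∧
    (∀ x, mixedEmbedding.norm x ≠ 0 → φ x = Om K ω (lg x)) := by
  obtain ⟨C, hC, hlip⟩ := Om_lip K
  obtain ⟨B, hB, hsupp⟩ := Om_supp K
  refine ⟨Real.exp B, Real.exp_pos _, C * (2 * Real.exp (B + 1)), by positivity, ?_⟩
  intro ω L hω
  have hL := hω.one_le
  refine ⟨fun x => Om K ω (clg (B + 1) x), ?_, ?_, ?_, ?_⟩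
  · intro x y
    refine (hlip ω L hω _ _).trans ?_
    calc C * L * ‖clg (B+1) x - clg (B+1) y‖ ≤ C * L * (2 * Real.exp (B + 1) * ‖x - y‖) := by
          gcongr
          exact clg_lip _ _ _
      _ = _ := by ring
  · intro x hx
    by_contra h
    have h1 := hsupp ω L hω _ h
    have : ‖x‖ ≤ Real.exp B := by
      rw [norm_eq_sup'_normAtPlace]
      apply Finset.sup'_le
      intro w _
      have h2 := h1 w
      unfold clg at h2
      rw [abs_mul, abs_of_nonneg (by positivity)] at h2
      have h3 : Real.log (max (normAtPlace w x) (Real.exp (-(B + 1)))) ≤ B :=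
        (le_abs_self _).trans ((le_mul_of_one_le_left (abs_nonneg _) (one_le_mult' w)).trans h2)
      rw [Real.log_le_iff_le_exp (lt_max_of_lt_right (Real.exp_pos _))] at h3
      exact (le_max_left _ _).trans h3
    linarith
  · intro x hx
    by_contra h
    have h1 := hsupp ω L hω _ h
    rw [mixedEmbedding.norm_eq_zero_iff] at hx
    obtain ⟨w, hw⟩ := hx
    have h2 := h1 w
    unfold clg at h2
    rw [hw, max_eq_right (Real.exp_pos _).le, Real.log_exp, abs_mul, abs_of_nonneg (by positivity), abs_neg, abs_of_pos (by linarith)] at h2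
    nlinarith [one_le_mult' w]
  · intro x hx
    rw [mixedEmbedding.norm_ne_zero_iff] at hx
    by_cases hcl : ∀ w, Real.exp (-(B + 1)) ≤ normAtPlace w x
    · show Om K ω (clg (B+1) x) = _
      congr 1
      funext w
      unfold clg lg
      rw [max_eq_left (hcl w)]
    · push Not at hcl
      obtain ⟨w, hw⟩ := hcl
      have e1 : Om K ω (clg (B + 1) x) = 0 := by
        by_contra h
        have h2 := hsupp ω L hω _ h w
        unfold clg at h2
        rw [max_eq_right hw.le, Real.log_exp, abs_mul, abs_of_nonneg (by positivity), abs_neg, abs_of_pos (by linarith)] at h2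
        nlinarith [one_le_mult' w]
      have e2 : Om K ω (lg x) = 0 := by
        by_contra h
        have h2 := hsupp ω L hω _ h w
        unfold lg at h2
        have h3 : Real.log (normAtPlace w x) < -(B+1) := by
          rw [Real.log_lt_iff_lt_exp (lt_of_le_of_ne (normAtPlace_nonneg _ _) (hx w).symm)]
          exact hw
        rw [abs_mul, abs_of_nonneg (by positivity), abs_of_neg (by linarith)] at h2
        nlinarith [one_le_mult' w]
      show Om K ω (clg (B+1) x) = _
      rw [e1, e2]

lemma lg_mul (x y : mixedSpace K) (hx : mixedEmbedding.norm x ≠ 0) (hy : mixedEmbedding.norm y ≠ 0) :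
    lg (x * y) = lg x + lg y := by
  rw [mixedEmbedding.norm_ne_zero_iff] at hx hy
  funext w
  simp only [lg, map_mul, Pi.add_apply]
  rw [Real.log_mul (hx w) (hy w)]; ring

lemma sum_lg (x : mixedSpace K) (hx : mixedEmbedding.norm x ≠ 0) : ∑ w, lg x w = Real.log (mixedEmbedding.norm x) := by
  rw [mixedEmbedding.norm_apply, Real.log_prod]
  · simp [lg, Real.log_pow]
  · intro w _
    exact pow_ne_zero _ (mixedEmbedding.norm_ne_zero_iff.mp hx w)

noncomputable def ulg : (𝓞 K)ˣ →* Multiplicative (realSpace K) where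
  toFun u := Multiplicative.ofAdd (lg (mixedEmbedding K (u : K)))
  map_one' := by
    rw [← ofAdd_zero]; congr 1; funext w; simp [lg]
  map_mul' u v := by
    rw [← ofAdd_add, ← lg_mul _ _ (by simp) (by simp)]
    simp

lemma ulg_fund (i : Fin (rank K)) : (ulg (fundSystem K i)).toAdd = completeBasis K (equivFinRank i).1 := by
  rw [completeBasis_apply_of_ne]
  funext w
  simp [ulg, lg]

lemma ulg_tors (ζ : torsion K) : ulg (ζ : (𝓞 K)ˣ) = 1 := by
  show Multiplicative.ofAdd _ = _
  rw [← ofAdd_zero]; congr 1; funext w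
  have := (mem_torsion K).mp ζ.2 w
  simp [lg, normAtPlace_apply, this]

noncomputable def uEquiv : torsion K × (Fin (rank K) → ℤ) ≃ (𝓞 K)ˣ :=
  Equiv.ofBijective (fun ζe => (ζe.1 : (𝓞 K)ˣ) * ∏ i, (fundSystem K i) ^ (ζe.2 i)) (by
    rw [Function.bijective_iff_existsUnique]
    intro u
    obtain ⟨a, h1, h2⟩ := exist_unique_eq_mul_prod K u
    exact ⟨a, h1.symm, fun y hy => h2 y hy.symm⟩)

lemma ulg_uEquiv (p : torsion K × (Fin (rank K) → ℤ)) :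
    lg (mixedEmbedding K ((uEquiv p : (𝓞 K)ˣ) : K)) = ∑ i, (p.2 i : ℝ) • completeBasis K (equivFinRank i).1 := by
  have : (ulg (uEquiv p)).toAdd = ∑ i, (p.2 i : ℝ) • completeBasis K (equivFinRank i).1 := by
    show (ulg ((p.1 : (𝓞 K)ˣ) * ∏ i, (fundSystem K i) ^ (p.2 i))).toAdd = _
    rw [map_mul, ulg_tors, one_mul, map_prod, toAdd_prod]
    refine Finset.sum_congr rfl fun i _ => ?_
    rw [map_zpow, toAdd_zpow, ulg_fund]
    exact (Int.cast_smul_eq_zsmul ℝ _ _).symm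
  exact this

lemma hasSum_aux {T κ : Type*} [Finite T] (f : κ → ℝ) (a : ℝ) (hf : HasSum f 1) (h0 : ∀ k, 0 ≤ f k) :
    HasSum (fun p : T × κ => a * f p.2) (Nat.card T * a) := by
  haveI : Fintype T := Fintype.ofFinite _
  have h2 := (hasSum_fintype (fun _ : T => (1:ℝ)))
  have h3 := h2.mul hf (h2.summable.mul_of_nonneg hf.summable (fun _ => zero_le_one) h0)
  have h4 := h3.mul_left a
  simp only [one_mul] at h4
  have e : a * ((∑ _b : T, (1:ℝ)) * 1) = Nat.card T * a := by rw [mul_comm]; simp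
  rw [e] at h4
  exact h4

lemma unit_sum (ω : ℝ → ℝ) (x : mixedSpace K) (hx : mixedEmbedding.norm x ≠ 0) :
    HasSum (fun u : (𝓞 K)ˣ => Om K ω (lg (mixedEmbedding K (u : K) * x)))
      (torsionOrder K * ω (Real.log (mixedEmbedding.norm x))) := by
  rw [← uEquiv.hasSum_iff]
  have key : ∀ p : torsion K × (Fin (rank K) → ℤ), ((fun u : (𝓞 K)ˣ => Om K ω (lg (mixedEmbedding K (u : K) * x))) ∘ uEquiv) p =
      ω (Real.log (mixedEmbedding.norm x)) * ∏ i, hat ((completeBasis K).repr (lg x) (equivFinRank i).1 + p.2 i) := by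
    intro p
    simp only [Function.comp]
    unfold Om
    rw [sum_lg _ (by simp [hx]), lg_mul _ _ (by simp) hx, ulg_uEquiv]
    congr 1
    · simp
    · refine Finset.prod_congr rfl fun i _ => ?_
      congr 1
      rw [map_add, Finsupp.add_apply, add_comm]
      congr 1
      rw [map_sum, Finset.sum_apply']
      simp only [map_smul, Module.Basis.repr_self, Finsupp.smul_single, smul_eq_mul, mul_one]
      rw [Finset.sum_eq_single i]
      · simp
      · intro j _ hj
        rw [Finsupp.single_apply, if_neg]
        intro h
        exact hj (equivFinRank.injective (Subtype.ext h))
      · simp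
  have h := hasSum_aux (T := torsion K) _ (ω (Real.log (mixedEmbedding.norm x)))
    (hasSum_hat_pi (fun i => (completeBasis K).repr (lg x) (equivFinRank i).1))
    (fun _ => Finset.prod_nonneg fun _ _ => hat_nonneg _)
  have e := funext key
  simp only [Function.comp_def] at e ⊢
  rw [e]
  exact h

end IdealCount

namespace IdealCount
open NumberField NumberField.mixedEmbedding NumberField.mixedEmbedding.fundamentalCone NumberField.Units NumberField.Units.dirichletUnitTheorem
open scoped Classical nonZeroDivisors

variable {K : Type*} [Field K] [NumberField K]

abbrev Cls (J : (Ideal (𝓞 K))⁰) := {I : (Ideal (𝓞 K))⁰ // ClassGroup.mk0 I = (ClassGroup.mk0 J)⁻¹}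

lemma exists_gen (J : (Ideal (𝓞 K))⁰) (I : Cls J) : ∃ b : 𝓞 K, Ideal.span {b} = (I.1 : Ideal (𝓞 K)) * J := by
  have h : ClassGroup.mk0 (I.1 * J) = 1 := by rw [map_mul, I.2, inv_mul_cancel]
  have hI : ((I.1 * J : (Ideal (𝓞 K))⁰) : Ideal (𝓞 K)).IsPrincipal := (ClassGroup.mk0_eq_one_iff (I.1 * J).2).mp h
  obtain ⟨b, hb⟩ := hI
  exact ⟨b, hb.symm⟩

noncomputable def gen (J : (Ideal (𝓞 K))⁰) (I : Cls J) : 𝓞 K := (exists_gen J I).choose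
lemma gen_spec (J : (Ideal (𝓞 K))⁰) (I : Cls J) : Ideal.span {gen J I} = (I.1 : Ideal (𝓞 K)) * J :=
  (exists_gen J I).choose_spec

lemma gen_ne (J : (Ideal (𝓞 K))⁰) (I : Cls J) : gen J I ≠ 0 := by
  intro h
  have := gen_spec J I
  rw [h] at this
  simp only [Set.singleton_zero, Ideal.span_zero] at this
  exact nonZeroDivisors.ne_zero (I.1 * J).2 this.symm

noncomputable def elt (J : (Ideal (𝓞 K))⁰) (p : Cls J × (𝓞 K)ˣ) : 𝓞 K := p.2 * gen J p.1

lemma elt_inj (J : (Ideal (𝓞 K))⁰) : Function.Injective (elt J) := by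
  rintro ⟨I, u⟩ ⟨I', u'⟩ h
  simp only [elt] at h
  have h1 : Ideal.span {gen J I} = Ideal.span {gen J I'} := by
    have := congrArg (fun z => Ideal.span {z}) h
    simpa [Ideal.span_singleton_mul_left_unit] using this
  rw [gen_spec, gen_spec] at h1
  have h2 : (I.1 : Ideal (𝓞 K)) = I'.1 := mul_right_cancel₀ (nonZeroDivisors.ne_zero J.2) h1
  have h3 : I = I' := Subtype.ext (Subtype.ext h2)
  subst h3
  have := mul_right_cancel₀ (gen_ne J I) h
  rw [Prod.mk.injEq]
  exact ⟨rfl, Units.ext this⟩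

lemma elt_surj (J : (Ideal (𝓞 K))⁰) (b : 𝓞 K) (hb : b ∈ (J : Ideal (𝓞 K))) (h0 : b ≠ 0) : ∃ p, elt J p = b := by
  have h1 : (J : Ideal (𝓞 K)) ∣ Ideal.span {b} := Ideal.dvd_span_singleton.mpr hb
  obtain ⟨I, hI⟩ := h1
  have hb0 : Ideal.span {b} ≠ 0 := by simpa using h0
  have hI0 : I ≠ 0 := by rintro rfl; simp at hI; exact h0 hI
  have hIm : I ∈ (Ideal (𝓞 K))⁰ := mem_nonZeroDivisors_of_ne_zero hI0
  have hc : ClassGroup.mk0 ⟨I, hIm⟩ = (ClassGroup.mk0 J)⁻¹ := by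
    rw [eq_inv_iff_mul_eq_one, ← map_mul, ClassGroup.mk0_eq_one_iff]
    refine ⟨b, ?_⟩
    show I * J = _
    rw [mul_comm, ← hI]
  let I' : Cls J := ⟨⟨I, hIm⟩, hc⟩
  have h2 : Ideal.span {gen J I'} = Ideal.span {b} := by rw [gen_spec, hI, mul_comm]
  rw [Ideal.span_singleton_eq_span_singleton] at h2
  obtain ⟨u, hu⟩ := h2
  exact ⟨(I', u), by rw [← hu, elt, mul_comm]⟩

lemma gen_mem (J : (Ideal (𝓞 K))⁰) (I : Cls J) : gen J I ∈ (J : Ideal (𝓞 K)) := by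
  have h : Ideal.span {gen J I} ≤ (J : Ideal (𝓞 K)) := (gen_spec J I).le.trans Ideal.mul_le_right
  exact (Ideal.span_singleton_le_iff_mem _).mp h

lemma elt_mem (J : (Ideal (𝓞 K))⁰) (p : Cls J × (𝓞 K)ˣ) : elt J p ∈ (J : Ideal (𝓞 K)) :=
  Ideal.mul_mem_left (J : Ideal (𝓞 K)) (p.2 : 𝓞 K) (gen_mem J p.1)

lemma norm_gen (J : (Ideal (𝓞 K))⁰) (I : Cls J) : mixedEmbedding.norm (mixedEmbedding K (gen J I : K)) =
    Ideal.absNorm (I.1 : Ideal (𝓞 K)) * Ideal.absNorm (J : Ideal (𝓞 K)) := by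
  rw [norm_eq_norm, ← Nat.cast_mul, ← map_mul, ← gen_spec, Ideal.absNorm_span_singleton, Nat.cast_natAbs, ← Algebra.coe_norm_int]
  norm_cast

/-- the fractional ideal unit -/
noncomputable def fu (J : (Ideal (𝓞 K))⁰) : (FractionalIdeal (𝓞 K)⁰ K)ˣ := FractionalIdeal.mk0 K J

noncomputable def gmap (J : (Ideal (𝓞 K))⁰) (p : Cls J × (𝓞 K)ˣ) : idealLattice K (fu J) :=
  ⟨mixedEmbedding K (elt J p : K), by
    rw [mem_idealLattice]
    refine ⟨_, ?_, rfl⟩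
    simp [fu]
    exact elt_mem J p⟩

lemma gmap_inj (J : (Ideal (𝓞 K))⁰) : Function.Injective (gmap J) := by
  intro p q h
  have := congrArg Subtype.val h
  simp only [gmap] at this
  exact elt_inj J (RingOfIntegers.ext (mixedEmbedding_injective K this))

lemma gmap_range (J : (Ideal (𝓞 K))⁰) (x : idealLattice K (fu J)) (hx : x ≠ 0) : x ∈ Set.range (gmap J) := by
  obtain ⟨x, hx'⟩ := x
  obtain ⟨y, hy, rfl⟩ := (mem_idealLattice K (fu J)).mp hx'
  simp only [fu, FractionalIdeal.coe_mk0, FractionalIdeal.coe_coeIdeal] at hy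
  obtain ⟨b, hb, rfl⟩ : ∃ b ∈ (J : Ideal (𝓞 K)), (b : K) = y := by
    simpa using hy
  have hb0 : b ≠ 0 := by
    rintro rfl
    exact hx (Subtype.ext (by simp))
  obtain ⟨p, hp⟩ := elt_surj J b hb hb0
  exact ⟨p, Subtype.ext (by simp [gmap, hp])⟩

lemma norm_smul_gen (J : (Ideal (𝓞 K))⁰) (I : Cls J) (T : ℝ) (hT : 0 < T) : mixedEmbedding.norm (T⁻¹ • mixedEmbedding K (gen J I : K)) =
    Ideal.absNorm (I.1 : Ideal (𝓞 K)) * Ideal.absNorm (J : Ideal (𝓞 K)) / T ^ Module.finrank ℚ K := by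
  rw [mixedEmbedding.norm_smul, norm_gen, abs_of_pos (by positivity), inv_pow]; field_simp

lemma absNorm_pos (I : (Ideal (𝓞 K))⁰) : (0:ℝ) < Ideal.absNorm (I : Ideal (𝓞 K)) := by
  have : Ideal.absNorm (I : Ideal (𝓞 K)) ≠ 0 := by
    rw [Ideal.absNorm_ne_zero_iff_mem_nonZeroDivisors]; exact I.2
  positivity

lemma finite_supp (ω : ℝ → ℝ) (L : ℝ) (hω : Adm ω L) (y c : ℝ) (hc : 0 < c) :
    {I : (Ideal (𝓞 K))⁰ | ω (Real.log (Ideal.absNorm (I : Ideal (𝓞 K)) * c) - y) ≠ 0}.Finite := by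
  have hf := Ideal.finite_setOf_absNorm_le₀ (S := 𝓞 K) ⌈Real.exp (y + 2) / c⌉₊
  refine hf.subset ?_
  intro I hI
  simp only [Set.mem_setOf_eq] at hI ⊢
  have h1 : |Real.log (Ideal.absNorm (I : Ideal (𝓞 K)) * c) - y| ≤ 2 := by
    by_contra h; exact hI (hω.supp _ (not_le.mp h))
  have h2 := (abs_le.mp h1).2
  have h3 : Real.log (Ideal.absNorm (I : Ideal (𝓞 K)) * c) ≤ y + 2 := by linarith
  rw [Real.log_le_iff_le_exp (mul_pos (absNorm_pos I) hc)] at h3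
  have h4 : (Ideal.absNorm (I : Ideal (𝓞 K)) : ℝ) ≤ ⌈Real.exp (y + 2) / c⌉₊ := by
    refine le_trans ?_ (Nat.le_ceil _)
    rwa [le_div_iff₀ hc]
  exact_mod_cast h4

lemma lattice_sum (J : (Ideal (𝓞 K))⁰) (ω : ℝ → ℝ) (L : ℝ) (hω : Adm ω L) (φ : mixedSpace K → ℝ)
    (h0 : ∀ x, mixedEmbedding.norm x = 0 → φ x = 0)
    (h1 : ∀ x, mixedEmbedding.norm x ≠ 0 → φ x = Om K ω (lg x)) (T : ℝ) (hT : 0 < T) :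
    ∑' β : idealLattice K (fu J), φ (T⁻¹ • (β : mixedSpace K)) =
      torsionOrder K * ∑' I : Cls J, ω (Real.log (Ideal.absNorm (I.1 : Ideal (𝓞 K)) * Ideal.absNorm (J : Ideal (𝓞 K)))
        - Module.finrank ℚ K * Real.log T) := by
  have hφ : ∀ x, 0 ≤ φ x := by
    intro x
    by_cases h : mixedEmbedding.norm x = 0
    · rw [h0 x h]
    · rw [h1 x h]; exact mul_nonneg (hω.nonneg _) (Finset.prod_nonneg fun _ _ => hat_nonneg _)
  rw [← (gmap_inj J).tsum_eq]
  swap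
  · intro x hx
    apply gmap_range
    rintro rfl
    apply hx
    apply h0
    simp
  have hn : ∀ I : Cls J, mixedEmbedding.norm (T⁻¹ • mixedEmbedding K (gen J I : K)) ≠ 0 := by
    intro I
    rw [norm_smul_gen J I T hT]
    have := absNorm_pos I.1
    have := absNorm_pos J
    positivity
  have hval : ∀ p : Cls J × (𝓞 K)ˣ, φ (T⁻¹ • (gmap J p : mixedSpace K)) =
      Om K ω (lg (mixedEmbedding K (p.2 : K) * (T⁻¹ • mixedEmbedding K (gen J p.1 : K)))) := by
    intro p
    have e : (T⁻¹ • (gmap J p : mixedSpace K)) = mixedEmbedding K (p.2 : K) * (T⁻¹ • mixedEmbedding K (gen J p.1 : K)) := by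
      simp [gmap, elt]
    rw [e, h1]
    rw [map_mul]
    exact mul_ne_zero (by simp) (hn _)
  have hlog : ∀ I : Cls J, Real.log (mixedEmbedding.norm (T⁻¹ • mixedEmbedding K (gen J I : K))) =
      Real.log (Ideal.absNorm (I.1 : Ideal (𝓞 K)) * Ideal.absNorm (J : Ideal (𝓞 K))) - Module.finrank ℚ K * Real.log T := by
    intro I
    have := absNorm_pos I.1
    have := absNorm_pos J
    rw [norm_smul_gen J I T hT, Real.log_div (by positivity) (by positivity), Real.log_pow]
  have hus : ∀ I : Cls J, HasSum (fun u : (𝓞 K)ˣ => φ (T⁻¹ • (gmap J (I, u) : mixedSpace K)))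
    (torsionOrder K * ω (Real.log (Ideal.absNorm (I.1 : Ideal (𝓞 K)) * Ideal.absNorm (J : Ideal (𝓞 K)))
        - Module.finrank ℚ K * Real.log T)) := by
    intro I
    simp_rw [hval]
    rw [← hlog]
    exact unit_sum ω _ (hn I)
  have hsummable : Summable (fun p : Cls J × (𝓞 K)ˣ => φ (T⁻¹ • (gmap J p : mixedSpace K))) := by
    rw [summable_prod_of_nonneg (fun p => hφ _)]
    refine ⟨fun I => (hus I).summable, ?_⟩
    simp_rw [fun I => (hus I).tsum_eq]
    apply Summable.mul_left
    apply summable_of_hasFiniteSupport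
    refine ((finite_supp ω L hω (Module.finrank ℚ K * Real.log T) (Ideal.absNorm (J : Ideal (𝓞 K))) (absNorm_pos J)).preimage Subtype.val_injective.injOn).subset ?_
    intro I hI
    exact hI
  rw [hsummable.tsum_prod]
  simp_rw [fun I => (hus I).tsum_eq]
  rw [tsum_mul_left]

end IdealCount

namespace IdealCount
open NumberField NumberField.mixedEmbedding NumberField.Units 
open scoped Classical nonZeroDivisors

variable {K : Type*} [Field K] [NumberField K]

lemma class_sum (J : (Ideal (𝓞 K))⁰) : ∃ C, 0 ≤ C ∧ ∀ ω L, Adm ω L → ∃ c : ℝ, ∀ s : ℝ, 1 ≤ s →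
    |∑' I : Cls J, ω (Real.log (Ideal.absNorm (I.1 : Ideal (𝓞 K))) - Real.log s) - c * s| ≤
      C * L * s ^ (1 - 1 / (Module.finrank ℚ K : ℝ)) := by
  obtain ⟨R, hR, C1, hC1, hphi⟩ := exists_phi K
  obtain ⟨C2, hC2, hrs⟩ := riemann_sum (idealLattice K (fu J)) R hR
  set d := Module.finrank ℚ K with hd
  have hdpos : 0 < d := Module.finrank_pos
  have hfr : Module.finrank ℝ (mixedSpace K) = d := mixedEmbedding.finrank K
  set N : ℝ := ((Ideal.absNorm (J : Ideal (𝓞 K)) : ℕ) : ℝ) with hN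
  have hN0 : 0 < N := absNorm_pos J
  have hN1 : 1 ≤ N := by
    have : 0 < Ideal.absNorm (J : Ideal (𝓞 K)) := Nat.cast_pos.mp hN0
    rw [hN]; exact_mod_cast this
  set t : ℝ := ((torsionOrder K : ℕ) : ℝ) with ht
  have ht0 : 0 < t := by rw [ht]; exact_mod_cast torsionOrder_pos K
  refine ⟨t⁻¹ * (C2 * C1) * N, by positivity, ?_⟩
  intro ω L hω
  have hL0 : 0 ≤ L := by linarith [hω.one_le]
  obtain ⟨φ, hφ1, hφ2, hφ3, hφ4⟩ := hphi ω L hω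
  obtain ⟨c, hc⟩ := hrs φ (C1 * L) (by positivity) hφ1 hφ2
  refine ⟨t⁻¹ * c * N, ?_⟩
  intro s hs
  have hsN : 1 ≤ s * N := by nlinarith
  set T : ℝ := (s * N) ^ (1 / (d:ℝ)) with hT
  have hT1 : 1 ≤ T := Real.one_le_rpow hsN (by positivity)
  have hTd : T ^ d = s * N := by
    rw [hT, ← Real.rpow_natCast, ← Real.rpow_mul (by positivity)]
    rw [one_div_mul_cancel (by positivity), Real.rpow_one]
  have h1 := hc T hT1
  rw [lattice_sum J ω L hω φ hφ3 hφ4 T (by linarith), hfr, ← ht, ← hN, ← hd] at h1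
  have e1 : ∀ I : Cls J, Real.log (Ideal.absNorm (I.1 : Ideal (𝓞 K)) * N) - d * Real.log T =
      Real.log (Ideal.absNorm (I.1 : Ideal (𝓞 K))) - Real.log s := by
    intro I
    have hI := absNorm_pos I.1
    rw [← Real.log_pow, hTd, Real.log_mul hI.ne' hN0.ne', Real.log_mul (by linarith) hN0.ne']
    ring
  simp_rw [e1, hTd] at h1
  set S := ∑' I : Cls J, ω (Real.log (Ideal.absNorm (I.1 : Ideal (𝓞 K))) - Real.log s)
  have e2 : |S - t⁻¹ * c * N * s| = t⁻¹ * |t * S - c * (s * N)| := by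
    rw [← abs_of_pos (inv_pos.mpr ht0), ← abs_mul, abs_of_pos (inv_pos.mpr ht0)]
    congr 1
    field_simp
  have e3 : |t * S - c * (s * N)| ≤ C2 * (C1 * L) * ((s * N) ^ (1 - 1 / (d:ℝ))) := by
    rw [Real.rpow_sub (by positivity), Real.rpow_one, ← hT, ← mul_div_assoc, le_div_iff₀ (by linarith)]
    exact h1
  have e4 : (s * N) ^ (1 - 1 / (d:ℝ)) ≤ N * s ^ (1 - 1 / (d:ℝ)) := by
    rw [Real.mul_rpow (by positivity) (by positivity), mul_comm]
    gcongr
    refine (Real.rpow_le_rpow_of_exponent_le hN1 (y := 1 - 1 / (d:ℝ)) (z := 1) ?_).trans_eq (Real.rpow_one _)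
    have : 0 < 1 / (d:ℝ) := by positivity
    linarith
  rw [e2]
  calc t⁻¹ * |t * S - c * (s * N)| ≤ t⁻¹ * (C2 * (C1 * L) * (N * s ^ (1 - 1 / (d:ℝ)))) := by
        gcongr
        exact e3.trans (by gcongr)
    _ = _ := by ring

variable (K) in
noncomputable def WS (ω : ℝ → ℝ) (s : ℝ) : ℝ :=
  ∑' I : (Ideal (𝓞 K))⁰, ω (Real.log (Ideal.absNorm (I : Ideal (𝓞 K))) - Real.log s)

lemma finite_supp' (ω : ℝ → ℝ) (L : ℝ) (hω : Adm ω L) (y : ℝ) :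
    (Function.support fun I : (Ideal (𝓞 K))⁰ => ω (Real.log (Ideal.absNorm (I : Ideal (𝓞 K))) - y)).Finite := by
  simpa [Function.support] using finite_supp (K := K) ω L hω y 1 one_pos

variable (K) in
lemma weighted : ∃ C, 0 ≤ C ∧ ∀ ω L, Adm ω L → ∃ c : ℝ, ∀ s : ℝ, 1 ≤ s →
    |WS K ω s - c * s| ≤ C * L * s ^ (1 - 1 / (Module.finrank ℚ K : ℝ)) := by
  have hJ : ∀ c : ClassGroup (𝓞 K), ∃ J : (Ideal (𝓞 K))⁰, ClassGroup.mk0 J = c⁻¹ := fun c => ClassGroup.mk0_surjective _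
  choose J hJ using hJ
  choose C hC0 hC using fun c => class_sum (J c)
  refine ⟨∑ c, C c, Finset.sum_nonneg fun c _ => hC0 c, ?_⟩
  intro ω L hω
  choose a ha using fun c => hC c ω L hω
  refine ⟨∑ c, a c, ?_⟩
  intro s hs
  have key : WS K ω s = ∑ c, ∑' I : Cls (J c), ω (Real.log (Ideal.absNorm (I.1 : Ideal (𝓞 K))) - Real.log s) := by
    unfold WS
    have hsum : Summable fun I : (Ideal (𝓞 K))⁰ => ω (Real.log (Ideal.absNorm (I : Ideal (𝓞 K))) - Real.log s) :=
      summable_of_hasFiniteSupport (finite_supp' ω L hω _)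
    let e := Equiv.sigmaFiberEquiv (ClassGroup.mk0 : (Ideal (𝓞 K))⁰ → ClassGroup (𝓞 K))
    have hs2 := ((e.summable_iff).mpr hsum)
    simp only [Function.comp_def] at hs2
    rw [← e.tsum_eq, hs2.tsum_sigma, tsum_fintype]
    refine Finset.sum_congr rfl fun c _ => ?_
    let e' : {x : (Ideal (𝓞 K))⁰ // ClassGroup.mk0 x = c} ≃ Cls (J c) :=
      Equiv.subtypeEquivRight (fun x => by rw [hJ, inv_inv])
    exact (e'.tsum_eq (fun I : Cls (J c) => ω (Real.log (Ideal.absNorm (I.1 : Ideal (𝓞 K))) - Real.log s)))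
  rw [key, Finset.sum_mul, ← Finset.sum_sub_distrib, Finset.sum_mul, Finset.sum_mul]
  refine (Finset.abs_sum_le_sum_abs _ _).trans (Finset.sum_le_sum fun c _ => ha c s hs)

end IdealCount

namespace IdealCount
open NumberField NumberField.Units 
open scoped Classical nonZeroDivisors

variable {K : Type*} [Field K] [NumberField K]

noncomputable def trap (a b η u : ℝ) : ℝ := max 0 (min 1 (min ((u - a) / η) ((b - u) / η)))

lemma trap_adm {a b η : ℝ} (h0 : 0 < η) (h1 : η ≤ 1) (ha : -2 ≤ a) (hb : b ≤ 2) : Adm (trap a b η) (1 / η) where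
  one_le := by rw [le_div_iff₀ h0]; linarith
  nonneg x := le_max_left _ _
  le_one x := max_le zero_le_one (min_le_left _ _)
  lip x y := by
    unfold trap
    have e1 : |(x - a) / η - (y - a) / η| = 1 / η * |x - y| := by
      rw [← sub_div, abs_div, abs_of_pos h0]; ring_nf
    have e2 : |(b - x) / η - (b - y) / η| = 1 / η * |x - y| := by
      rw [← sub_div, abs_div, abs_of_pos h0, abs_sub_comm x y]; ring_nf
    have h3 := abs_min_sub_min_le_max ((x - a) / η) ((b - x) / η) ((y - a) / η) ((b - y) / η)
    rw [e1, e2, max_self] at h3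
    rw [max_comm 0, max_comm 0, min_comm 1, min_comm 1]
    refine (abs_max_sub_max_le_abs _ _ _).trans (le_trans ?_ h3)
    have h4 := abs_min_sub_min_le_max (min ((x - a) / η) ((b - x) / η)) 1 (min ((y - a) / η) ((b - y) / η)) 1
    simpa using h4
  supp x hx := by
    apply max_eq_left
    rcases lt_abs.mp hx with h | h
    · exact (min_le_right _ _).trans ((min_le_right _ _).trans (div_nonpos_of_nonpos_of_nonneg (by linarith) h0.le))
    · exact (min_le_right _ _).trans ((min_le_left _ _).trans (div_nonpos_of_nonpos_of_nonneg (by linarith) h0.le))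

lemma trap_ne {a b η u : ℝ} (h0 : 0 < η) (h : trap a b η u ≠ 0) : a < u ∧ u < b := by
  constructor
  · by_contra hc
    exact h (max_eq_left ((min_le_right _ _).trans ((min_le_left _ _).trans (div_nonpos_of_nonpos_of_nonneg (by linarith) h0.le))))
  · by_contra hc
    exact h (max_eq_left ((min_le_right _ _).trans ((min_le_right _ _).trans (div_nonpos_of_nonpos_of_nonneg (by linarith) h0.le))))

lemma trap_one {a b η u : ℝ} (h0 : 0 < η) (h1 : a + η ≤ u) (h2 : u ≤ b - η) : trap a b η u = 1 := by
  unfold trap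
  rw [min_eq_left, max_eq_right zero_le_one]
  refine le_min ?_ ?_ <;> rw [le_div_iff₀ h0] <;> linarith

variable (K) in
def AS (s : ℝ) : Set (Ideal (𝓞 K))⁰ := {I | (Ideal.absNorm (I : Ideal (𝓞 K)) : ℝ) ≤ s}

lemma AS_fin (s : ℝ) : (AS K s).Finite := by
  refine (Ideal.finite_setOf_absNorm_le₀ (S := 𝓞 K) ⌈s⌉₊).subset ?_
  intro I hI
  have h : (Ideal.absNorm (I : Ideal (𝓞 K)) : ℝ) ≤ s := hI
  have h2 := h.trans (Nat.le_ceil s)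
  simp only [Set.mem_setOf_eq]
  exact_mod_cast h2

variable (K) in
noncomputable def A (s : ℝ) : ℝ := (AS K s).ncard

lemma card_diff {lo hi : ℝ} (h : lo ≤ hi) : (((AS_fin (K := K) hi).subset (Set.diff_subset (t := AS K lo))).toFinset.card : ℝ) = A K hi - A K lo := by
  have hsub : AS K lo ⊆ AS K hi := fun I (hI : _ ≤ _) => hI.trans h
  rw [← Set.ncard_eq_toFinset_card _ _, Set.ncard_diff hsub (AS_fin lo), Nat.cast_sub (Set.ncard_le_ncard hsub (AS_fin hi))]
  rfl

lemma WS_le (ω : ℝ → ℝ) (s lo hi : ℝ) (h : lo ≤ hi) (h1 : ∀ x, ω x ≤ 1)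
    (h2 : ∀ I : (Ideal (𝓞 K))⁰, ω (Real.log (Ideal.absNorm (I : Ideal (𝓞 K))) - Real.log s) ≠ 0 →
      lo < (Ideal.absNorm (I : Ideal (𝓞 K)) : ℝ) ∧ (Ideal.absNorm (I : Ideal (𝓞 K)) : ℝ) ≤ hi) :
    WS K ω s ≤ A K hi - A K lo := by
  rw [← card_diff h]
  unfold WS
  rw [tsum_eq_sum (s := ((AS_fin (K := K) hi).subset (Set.diff_subset (t := AS K lo))).toFinset)]
  · refine (Finset.sum_le_card_nsmul _ _ 1 fun I _ => h1 _).trans (by simp)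
  · intro I hI
    by_contra hc
    apply hI
    rw [Set.Finite.mem_toFinset]
    exact ⟨(h2 I hc).2, not_le.mpr (h2 I hc).1⟩

lemma le_WS (ω : ℝ → ℝ) (L s lo hi : ℝ) (hω : Adm ω L) (h : lo ≤ hi) 
    (h2 : ∀ I : (Ideal (𝓞 K))⁰, lo < (Ideal.absNorm (I : Ideal (𝓞 K)) : ℝ) → (Ideal.absNorm (I : Ideal (𝓞 K)) : ℝ) ≤ hi → ω (Real.log (Ideal.absNorm (I : Ideal (𝓞 K))) - Real.log s) = 1) :
    A K hi - A K lo ≤ WS K ω s := by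
  rw [← card_diff h]
  unfold WS
  refine le_trans ?_ (Summable.sum_le_tsum ((AS_fin (K := K) hi).subset (Set.diff_subset (t := AS K lo))).toFinset (fun I _ => hω.nonneg _) (summable_of_hasFiniteSupport (finite_supp' ω L hω _)))
  rw [Finset.sum_congr rfl (g := fun _ => (1:ℝ))]
  · simp
  · intro I hI
    rw [Set.Finite.mem_toFinset] at hI
    exact h2 I (not_le.mp hI.2) hI.1

variable (K) in
lemma A_tendsto : ∃ κ, 0 < κ ∧ Tendsto (fun s => A K s / s) atTop (nhds κ) := by
  refine ⟨_, ?_, NumberField.Ideal.tendsto_norm_le_div_atTop₀ K⟩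
  have h1 : (0:ℝ) < torsionOrder K := by exact_mod_cast torsionOrder_pos K
  have h2 : (0:ℝ) < regulator K := regulator_pos K
  have h3 : (0:ℝ) < classNumber K := by
    have : 0 < classNumber K := Fintype.card_pos
    exact_mod_cast this
  have h4 : (0:ℝ) < |(discr K : ℝ)| := abs_pos.mpr (by exact_mod_cast discr_ne_zero K)
  positivity

lemma A_scale {κ : ℝ} (hA : Tendsto (fun s => A K s / s) atTop (nhds κ)) (r : ℝ) (hr : 0 < r) :
    Tendsto (fun s => A K (s * r) / s) atTop (nhds (κ * r)) := by
  have h := (hA.comp (tendsto_id.atTop_mul_const hr)).mul_const r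
  refine h.congr' ?_
  filter_upwards [eventually_gt_atTop 0] with s hs
  simp only [Function.comp, id]
  field_simp

variable (K) in
lemma dyadic : ∃ κ, 0 < κ ∧ Tendsto (fun s => A K s / s) atTop (nhds κ) ∧ ∃ C, 0 ≤ C ∧ ∀ s : ℝ, 1 ≤ s →
    |A K s - A K (s / 2) - κ * s / 2| ≤ C * s ^ (1 - 1 / (2 * (Module.finrank ℚ K : ℝ))) := by
  obtain ⟨κ, hκ, hA⟩ := A_tendsto K
  obtain ⟨C, hC, hW⟩ := weighted K
  refine ⟨κ, hκ, hA, 3 * κ + C, by positivity, ?_⟩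
  set d := (Module.finrank ℚ K : ℝ) with hd
  have hd1 : 1 ≤ d := by rw [hd]; exact_mod_cast Module.finrank_pos
  have hlim : ∀ ω L, Adm ω L → ∀ c, (∀ s : ℝ, 1 ≤ s → |WS K ω s - c * s| ≤ C * L * s ^ (1 - 1 / d)) →
      Tendsto (fun s => WS K ω s / s) atTop (nhds c) := by
    intro ω L hω c hc
    rw [tendsto_iff_norm_sub_tendsto_zero]
    have h0 : Tendsto (fun s : ℝ => C * L * s ^ (-(1 / d))) atTop (nhds 0) := by
      simpa using (tendsto_rpow_neg_atTop (y := 1 / d) (by positivity)).const_mul (C * L)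
    refine squeeze_zero' (Eventually.of_forall fun s => norm_nonneg _) ?_ h0
    filter_upwards [eventually_ge_atTop 1] with s hs
    have hs0 : 0 < s := by linarith
    rw [Real.norm_eq_abs, show WS K ω s / s - c = (WS K ω s - c * s) / s by field_simp, abs_div, abs_of_pos hs0, div_le_iff₀ hs0]
    refine (hc s hs).trans_eq ?_
    rw [mul_assoc (C * L), ← Real.rpow_add_one hs0.ne']
    ring_nf
  have hl2 : 0 < Real.log 2 := Real.log_pos (by norm_num)
  have hl2' : Real.log 2 < 0.7 := by linarith [Real.log_two_lt_d9]
  have main : ∀ η : ℝ, 0 < η → η ≤ 1 → ∀ s : ℝ, 1 ≤ s →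
      |A K s - A K (s / 2) - κ * s / 2| ≤ 3 * κ * η * s + C * (1 / η) * s ^ (1 - 1 / d) := by
    intro η h0 h1 s hs
    have hs0 : 0 < s := by linarith
    have habm := trap_adm (a := -Real.log 2) (b := 0) h0 h1 (by linarith) (by norm_num)
    have habp := trap_adm (a := -Real.log 2 - η) (b := η) h0 h1 (by linarith) (by linarith)
    obtain ⟨cm, hcm⟩ := hW _ _ habm
    obtain ⟨cp, hcp⟩ := hW _ _ habp
    have hIlog : ∀ (s : ℝ), 0 < s → ∀ (I : (Ideal (𝓞 K))⁰) (x : ℝ), (x < Real.log (Ideal.absNorm (I : Ideal (𝓞 K))) - Real.log s ↔ s * Real.exp x < (Ideal.absNorm (I : Ideal (𝓞 K)) : ℝ)) := by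
      intro s hs0 I x
      rw [lt_sub_iff_add_lt, Real.lt_log_iff_exp_lt (absNorm_pos I), Real.exp_add, Real.exp_log hs0, mul_comm]
    have hIlog' : ∀ (s : ℝ), 0 < s → ∀ (I : (Ideal (𝓞 K))⁰) (x : ℝ), (Real.log (Ideal.absNorm (I : Ideal (𝓞 K))) - Real.log s ≤ x ↔ (Ideal.absNorm (I : Ideal (𝓞 K)) : ℝ) ≤ s * Real.exp x) := by
      intro s hs0 I x
      rw [← not_lt, hIlog s hs0, not_lt]
    have he2 : Real.exp (-Real.log 2) = 1 / 2 := by rw [Real.exp_neg, Real.exp_log (by norm_num)]; norm_num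
    have hupper : A K s - A K (s / 2) ≤ WS K (trap (-Real.log 2 - η) η η) s := by
      apply le_WS _ _ _ _ _ habp (by linarith)
      intro I h1 h2
      apply trap_one h0
      · have := (hIlog s hs0 I (-Real.log 2)).mpr (by rw [he2]; linarith)
        linarith
      · have := (hIlog' s hs0 I 0).mpr (by simpa using h2)
        linarith
    have hlower : WS K (trap (-Real.log 2) 0 η) s ≤ A K s - A K (s / 2) := by
      apply WS_le _ _ _ _ (by linarith) habm.le_one
      intro I hI
      obtain ⟨h1, h2⟩ := trap_ne h0 hI
      constructor
      · have := (hIlog s hs0 I _).mp h1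
        rw [he2] at this; linarith
      · have := (hIlog' s hs0 I _).mp h2.le
        simpa using this
    have hexp1 : Real.exp η ≤ 1 + 2 * η := by
      have := Real.abs_exp_sub_one_le (x := η) (by rw [abs_of_pos h0]; exact h1)
      rw [abs_of_pos h0] at this
      linarith [(abs_le.mp this).2]
    have hcp' : cp ≤ κ * (1 / 2 + 3 * η) := by
      have hle : cp ≤ κ * Real.exp η - κ * Real.exp (-Real.log 2 - η) := by
        refine le_of_tendsto_of_tendsto (hlim _ _ habp cp hcp) ((A_scale hA _ (Real.exp_pos _)).sub (A_scale hA _ (Real.exp_pos _))) ?_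
        filter_upwards [eventually_gt_atTop 0] with s hs0
        rw [← sub_div]
        gcongr
        apply WS_le _ _ _ _ _ habp.le_one
        · intro I hI
          obtain ⟨h1, h2⟩ := trap_ne h0 hI
          exact ⟨(hIlog s hs0 I _).mp h1, (hIlog' s hs0 I _).mp h2.le⟩
        · gcongr; linarith
      have h3 : Real.exp (-Real.log 2 - η) ≥ 1 / 2 * (1 - η) := by
        rw [sub_eq_add_neg, Real.exp_add, he2]
        have := Real.add_one_le_exp (-η)
        gcongr; linarith
      refine hle.trans ?_
      rw [← mul_sub]
      gcongr
      linarith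
    have hcm' : κ * (1 / 2 - 2 * η) ≤ cm := by
      have hle : κ * Real.exp (-η) - κ * Real.exp (-Real.log 2 + η) ≤ cm ∨ η > 1/4 := by
        by_cases hη : η > 1/4
        · exact Or.inr hη
        left
        refine le_of_tendsto_of_tendsto ((A_scale hA _ (Real.exp_pos _)).sub (A_scale hA _ (Real.exp_pos _))) (hlim _ _ habm cm hcm) ?_
        filter_upwards [eventually_gt_atTop 0] with s hs0
        rw [← sub_div]
        gcongr
        apply le_WS _ _ _ _ _ habm
        · gcongr; linarith [Real.log_two_gt_d9]
        · intro I h1 h2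
          apply trap_one h0
          · exact ((hIlog s hs0 I _).mpr h1).le
          · rw [zero_sub]; exact ((hIlog' s hs0 I _).mpr h2)
      rcases hle with hle | hle
      · refine le_trans ?_ hle
        rw [← mul_sub]
        refine mul_le_mul_of_nonneg_left ?_ hκ.le
        rw [Real.exp_add, he2]
        have := Real.add_one_le_exp (-η)
        linarith
      · have hcm0 : 0 ≤ cm := by
          refine ge_of_tendsto (hlim _ _ habm cm hcm) ?_
          filter_upwards [eventually_gt_atTop 0] with s hs0
          exact div_nonneg (tsum_nonneg fun I => habm.nonneg _) hs0.le
        refine le_trans ?_ hcm0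
        nlinarith
    have a1 := abs_le.mp (hcp s hs)
    have a2 := abs_le.mp (hcm s hs)
    rw [abs_le]
    have b1 : cp * s ≤ κ * (1 / 2 + 3 * η) * s := by gcongr
    have b2 : κ * (1 / 2 - 2 * η) * s ≤ cm * s := by gcongr
    have b3 : 0 ≤ κ * η * s := by positivity
    constructor <;> nlinarith
  intro s hs
  have hs0 : 0 < s := by linarith
  have h1 := main (s ^ (-(1 / (2 * d)))) (Real.rpow_pos_of_pos hs0 _) (Real.rpow_le_one_of_one_le_of_nonpos hs (by
    have : 0 < 1 / (2 * d) := by positivity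
    linarith)) s hs
  refine h1.trans_eq ?_
  rw [add_mul, mul_assoc (3 * κ), ← Real.rpow_add_one hs0.ne', one_div (s ^ _), ← Real.rpow_neg hs0.le, mul_assoc C, ← Real.rpow_add hs0]
  congr 2
  · ring_nf
  · congr 1
    field_simp
    ring

end IdealCount

namespace IdealCount
open NumberField NumberField.Units 
open scoped Classical nonZeroDivisors

variable {K : Type*} [Field K] [NumberField K]

lemma A_zero {s : ℝ} (hs : s < 1) : A K s = 0 := by
  have : AS K s = ∅ := by
    ext I
    simp only [AS, Set.mem_setOf_eq, Set.mem_empty_iff_false, iff_false, not_le]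
    have h := absNorm_pos I
    have h1 : 1 ≤ Ideal.absNorm (I : Ideal (𝓞 K)) := by exact_mod_cast h
    have h2 : (1:ℝ) ≤ Ideal.absNorm (I : Ideal (𝓞 K)) := by exact_mod_cast h1
    linarith
  rw [A, this]; simp

variable (K) in
lemma A_est : ∃ κ C δ : ℝ, 0 < κ ∧ 0 ≤ C ∧ 0 < δ ∧ δ < 1 ∧ ∀ s : ℝ, 0 < s → |A K s - κ * s| ≤ C * s ^ (1 - δ) := by
  obtain ⟨κ, hκ, -, C, hC, h⟩ := dyadic K
  set d := (Module.finrank ℚ K : ℝ) with hd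
  have hd1 : 1 ≤ d := by rw [hd]; exact_mod_cast Module.finrank_pos
  set δ := 1 / (2 * d) with hδ
  have hδ0 : 0 < δ := by positivity
  have hδ1 : δ ≤ 1 / 2 := by
    rw [hδ]; apply one_div_le_one_div_of_le <;> linarith
  refine ⟨κ, 4 * C + κ, δ, hκ, by positivity, hδ0, by linarith, ?_⟩
  have main : ∀ n : ℕ, ∀ s : ℝ, 0 < s → s < 2 ^ n → |A K s - κ * s| ≤ (4 * C + κ) * s ^ (1 - δ) := by
    intro n
    induction n with
    | zero =>
      intro s h0 h1
      rw [pow_zero] at h1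
      rw [A_zero h1, zero_sub, abs_neg, abs_of_pos (by positivity)]
      have : s ≤ s ^ (1 - δ) := by
        conv_lhs => rw [← Real.rpow_one s]
        exact Real.rpow_le_rpow_of_exponent_ge h0 h1.le (by linarith)
      have h3 := Real.rpow_nonneg h0.le (1 - δ)
      nlinarith
    | succ n ih =>
      intro s h0 h1
      by_cases hs : s < 1
      · exact (fun h => h) (by
          rw [A_zero hs, zero_sub, abs_neg, abs_of_pos (by positivity)]
          have : s ≤ s ^ (1 - δ) := by
            conv_lhs => rw [← Real.rpow_one s]
            exact Real.rpow_le_rpow_of_exponent_ge h0 hs.le (by linarith)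
          have h3 := Real.rpow_nonneg h0.le (1 - δ)
          nlinarith)
      have h2 := ih (s / 2) (by linarith) (by rw [pow_succ] at h1; linarith)
      have h3 := h s (not_lt.mp hs)
      have h4 : (s / 2) ^ (1 - δ) ≤ 3 / 4 * s ^ (1 - δ) := by
        rw [Real.div_rpow h0.le (by norm_num), div_eq_inv_mul]
        gcongr
        rw [inv_le_comm₀ (by positivity) (by norm_num)]
        have h5 : (2:ℝ) ^ (1/2 : ℝ) ≤ 2 ^ (1 - δ) := Real.rpow_le_rpow_of_exponent_le (by norm_num) (by linarith)
        refine le_trans ?_ h5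
        rw [← Real.sqrt_eq_rpow]
        apply Real.le_sqrt_of_sq_le
        norm_num
      calc |A K s - κ * s| = |(A K s - A K (s / 2) - κ * s / 2) + (A K (s/2) - κ * (s / 2))| := by ring_nf
        _ ≤ C * s ^ (1 - δ) + (4 * C + κ) * (3 / 4 * s ^ (1 - δ)) :=
          (abs_add_le _ _).trans (add_le_add h3 (h2.trans (by gcongr)))
        _ ≤ _ := by
          have h3 := Real.rpow_nonneg h0.le (1 - δ)
          nlinarith [mul_nonneg hκ.le h3]
  intro s hs
  obtain ⟨n, hn⟩ := pow_unbounded_of_one_lt s (show (1:ℝ) < 2 by norm_num)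
  exact main n s hs hn

variable (K) in
def NS (n : ℕ) : Set (Ideal (𝓞 K)) := {I | Ideal.absNorm I = n}

lemma NS_fin (n : ℕ) (hn : n ≠ 0) : (NS K n).Finite := Ideal.finite_setOf_absNorm_eq n 

variable (K) in
/-- number of ideals of norm `n` -/
noncomputable def rr : ArithmeticFunction ℝ := ⟨fun n => if n = 0 then 0 else (NS K n).ncard, by simp⟩

lemma rr_apply {n : ℕ} (hn : n ≠ 0) : rr K n = (NS K n).ncard := by simp [rr, hn]

lemma rr_one : rr K 1 = 1 := by
  rw [rr_apply one_ne_zero]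
  have : NS K 1 = {⊤} := by
    ext I; simp [NS, Ideal.absNorm_eq_one_iff]
  rw [this]; simp

lemma sum_rr (x : ℝ) (hx : 0 ≤ x) : ∑ n ∈ Finset.Ioc 0 ⌊x⌋₊, rr K n = A K x := by
  have e : A K x = ((AS_fin (K := K) x).toFinset.card : ℝ) := by
    rw [A, Set.ncard_eq_toFinset_card _ (AS_fin x)]
  rw [e, Finset.card_eq_sum_card_fiberwise (s := (AS_fin (K := K) x).toFinset) (f := fun I : (Ideal (𝓞 K))⁰ => Ideal.absNorm (I : Ideal (𝓞 K))) (t := Finset.Ioc 0 ⌊x⌋₊)]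
  · push_cast
    refine Finset.sum_congr rfl fun n hn => ?_
    rw [Finset.mem_Ioc] at hn
    rw [rr_apply (by omega), ← Set.ncard_coe_finset]
    congr 1
    symm
    refine Set.ncard_congr (fun I _ => (I : Ideal (𝓞 K))) ?_ ?_ ?_
    · intro I hI
      simp at hI
      exact hI.2
    · intro I J _ _ h; exact Subtype.ext h
    · intro I hI
      have hI : Ideal.absNorm I = n := hI
      have h0 : I ∈ (Ideal (𝓞 K))⁰ := by
        rw [← Ideal.absNorm_ne_zero_iff_mem_nonZeroDivisors]; omega
      refine ⟨⟨I, h0⟩, ?_, rfl⟩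
      simp [AS, hI]
      exact (Nat.le_floor_iff hx).mp hn.2
  · intro I hI
    simp [AS] at hI
    have := absNorm_pos I
    simp
    exact ⟨by exact_mod_cast this, Nat.le_floor hI⟩

end IdealCount

namespace IdealCount
open NumberField UniqueFactorizationMonoid
open scoped Classical nonZeroDivisors

variable {K : Type*} [Field K] [NumberField K]

variable (K) in
def PS (n : ℕ) : Set (Ideal (𝓞 K)) := {P | P.IsPrime ∧ P ≠ ⊥ ∧ Ideal.absNorm P ≤ n}

lemma PS_fin (n : ℕ) : (PS K n).Finite :=
  (Ideal.finite_setOf_absNorm_le (S := 𝓞 K) n).subset fun P hP => hP.2.2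

variable (K) in
noncomputable def PF (n : ℕ) : Finset (Ideal (𝓞 K)) := (PS_fin (K := K) n).toFinset

lemma mem_PF {n : ℕ} {P : Ideal (𝓞 K)} : P ∈ PF K n ↔ P.IsPrime ∧ P ≠ ⊥ ∧ Ideal.absNorm P ≤ n := by
  simp [PF, PS]

lemma two_le {P : Ideal (𝓞 K)} (h : P.IsPrime) (h0 : P ≠ ⊥) : 2 ≤ Ideal.absNorm P := by
  have h1 : Ideal.absNorm P ≠ 0 := by rwa [Ne, Ideal.absNorm_eq_zero_iff]
  have h2 : Ideal.absNorm P ≠ 1 := by rw [Ne, Ideal.absNorm_eq_one_iff]; exact h.ne_top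
  omega

variable (K) in
noncomputable def LL (m n : ℕ) : ℝ := ∑ P ∈ PF K m, ∑ j ∈ Finset.Icc 1 m,
  if Ideal.absNorm P ^ j = n then Real.log (Ideal.absNorm P) else 0

variable (K) in
noncomputable def Lam : ArithmeticFunction ℝ := ⟨fun n => LL K n n, by simp [LL]⟩

lemma LL_ext {m n : ℕ} (h : n ≤ m) (hn : n ≠ 0) : LL K n n = LL K m n := by
  unfold LL
  have hsub : PF K n ⊆ PF K m := fun P hP => by
    rw [mem_PF] at hP ⊢; exact ⟨hP.1, hP.2.1, hP.2.2.trans h⟩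
  rw [← Finset.sum_subset hsub]
  · refine Finset.sum_congr rfl fun P hP => ?_
    apply Finset.sum_subset (Finset.Icc_subset_Icc_right h)
    intro j hj hj2
    rw [if_neg]
    intro he
    apply hj2
    rw [Finset.mem_Icc] at hj ⊢
    refine ⟨hj.1, ?_⟩
    have hP' := mem_PF.mp hP
    rw [← he]
    exact (Nat.lt_pow_self (by have := two_le hP'.1 hP'.2.1; omega)).le
  · intro P hP hP2
    apply Finset.sum_eq_zero
    intro j hj
    rw [if_neg]
    intro he
    apply hP2
    rw [mem_PF] at hP ⊢
    refine ⟨hP.1, hP.2.1, ?_⟩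
    rw [← he]
    rw [Finset.mem_Icc] at hj
    exact Nat.le_self_pow (by omega) _

lemma Lam_nonneg (n : ℕ) : 0 ≤ Lam K n := by
  refine Finset.sum_nonneg fun P _ => Finset.sum_nonneg fun j _ => ?_
  split_ifs
  · exact Real.log_natCast_nonneg _
  · exact le_rfl

lemma count_le {P I : Ideal (𝓞 K)} (hP : P.IsPrime) (h0 : P ≠ ⊥) (hI : I ≠ ⊥) (j : ℕ) :
    P ^ j ∣ I ↔ j ≤ (normalizedFactors I).count P := by
  have hp := (Ideal.prime_of_isPrime h0 hP).irreducible
  rw [pow_dvd_iff_le_emultiplicity, emultiplicity_eq_count_normalizedFactors hp hI, normalize_eq]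
  norm_cast

lemma log_norm {n : ℕ} (hn : n ≠ 0) {I : Ideal (𝓞 K)} (hI : Ideal.absNorm I = n) :
    Real.log n = ∑ P ∈ PF K n, ∑ j ∈ Finset.Icc 1 n, if P ^ j ∣ I then Real.log (Ideal.absNorm P) else 0 := by
  have hI0 : I ≠ ⊥ := by
    rintro rfl; simp at hI; exact hn hI.symm
  have hprime : ∀ P ∈ normalizedFactors I, P.IsPrime ∧ P ≠ ⊥ := fun P hP => by
    have := prime_of_normalized_factor P hP
    exact ⟨Ideal.isPrime_of_prime this, this.ne_zero⟩
  have e1 : ∀ P ∈ PF K n, (∑ j ∈ Finset.Icc 1 n, if P ^ j ∣ I then Real.log (Ideal.absNorm P) else 0) =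
      (normalizedFactors I).count P * Real.log (Ideal.absNorm P) := by
    intro P hP
    obtain ⟨h1, h2, h3⟩ := mem_PF.mp hP
    set c := (normalizedFactors I).count P
    have hc : c ≤ n := by
      have hd : P ^ c ∣ I := (count_le h1 h2 hI0 c).mpr le_rfl
      have := Ideal.absNorm_dvd_absNorm_of_le (Ideal.le_of_dvd hd)
      rw [map_pow, hI] at this
      have h4 := Nat.le_of_dvd (by omega) this
      exact (Nat.lt_pow_self (by have := two_le h1 h2; omega)).le.trans h4
    simp_rw [count_le h1 h2 hI0]
    rw [← Finset.sum_filter, Finset.sum_const, nsmul_eq_mul]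
    congr 2
    have : (Finset.Icc 1 n).filter (fun j => j ≤ c) = Finset.Icc 1 c := by
      ext j; simp only [Finset.mem_filter, Finset.mem_Icc]; omega
    rw [this]; simp
  rw [Finset.sum_congr rfl e1]
  have e2 : Real.log n = ((normalizedFactors I).map (fun P => Real.log (Ideal.absNorm P))).sum := by
    have hprod : (normalizedFactors I).prod = I := by
      have := prod_normalizedFactors hI0
      rwa [associated_iff_eq] at this
    rw [← hI]
    conv_lhs => rw [← hprod]
    generalize hs : normalizedFactors I = s at hprime
    clear hs hprod
    induction s using Multiset.induction_on with
    | empty => simp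
    | cons a s ih =>
      rw [Multiset.prod_cons, Multiset.map_cons, Multiset.sum_cons, map_mul, Nat.cast_mul, Real.log_mul, ih]
      · intro P hP; exact hprime P (Multiset.mem_cons_of_mem hP)
      · have := hprime a (Multiset.mem_cons_self a s)
        have := two_le this.1 this.2
        positivity
      · have : Ideal.absNorm s.prod ≠ 0 := by
          rw [Ne, Ideal.absNorm_eq_zero_iff]
          show s.prod ≠ 0
          apply Multiset.prod_ne_zero
          intro h0
          exact (hprime 0 (Multiset.mem_cons_of_mem h0)).2 rfl
        exact_mod_cast this
  rw [e2, Finset.sum_multiset_map_count]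
  simp only [nsmul_eq_mul]
  apply Finset.sum_subset
  · intro P hP
    rw [Multiset.mem_toFinset] at hP
    rw [mem_PF]
    refine ⟨(hprime P hP).1, (hprime P hP).2, ?_⟩
    rw [← hI]
    exact Nat.le_of_dvd (by omega) (Ideal.absNorm_dvd_absNorm_of_le (Ideal.le_of_dvd (dvd_of_mem_normalizedFactors hP)))
  · intro P _ hP
    rw [Multiset.mem_toFinset] at hP
    simp [Multiset.count_eq_zero_of_notMem hP]

lemma count_bij {n m : ℕ} (hn : n ≠ 0) {Q : Ideal (𝓞 K)} (hQ : Ideal.absNorm Q * m = n) :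
    ((NS K m).ncard : ℝ) = {I ∈ NS K n | Q ∣ I}.ncard := by
  congr 1
  refine Set.ncard_congr (fun I _ => Q * I) ?_ ?_ ?_
  · intro I hI
    have hI : Ideal.absNorm I = m := hI
    refine ⟨?_, dvd_mul_right _ _⟩
    show Ideal.absNorm _ = n
    rw [map_mul, hI, hQ]
  · intro I J _ _ h
    have : Q ≠ 0 := by rintro rfl; simp at hQ; exact hn hQ.symm
    exact mul_left_cancel₀ this h
  · rintro J ⟨hJ, I, rfl⟩
    have hJ : Ideal.absNorm (Q * I) = n := hJ
    refine ⟨I, ?_, rfl⟩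
    rw [map_mul, ← hQ] at hJ
    have h0 : Ideal.absNorm Q ≠ 0 := by intro h; rw [h] at hQ; simp at hQ; exact hn hQ.symm
    exact mul_left_cancel₀ h0 hJ

lemma lam_mul : Lam K * rr K = Selberg.D (rr K) := by
  ext n
  by_cases hn : n = 0
  · subst hn; simp
  rw [Selberg.D_apply, ArithmeticFunction.mul_apply, rr_apply hn]
  have e1 : ∑ x ∈ n.divisorsAntidiagonal, Lam K x.1 * rr K x.2 =
      ∑ x ∈ n.divisorsAntidiagonal, LL K n x.1 * rr K x.2 := by
    refine Finset.sum_congr rfl fun x hx => ?_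
    rw [Nat.mem_divisorsAntidiagonal] at hx
    have hx1 : x.1 ≠ 0 := by rintro h; rw [h] at hx; simp at hx; exact hx.2 hx.1.symm
    have : x.1 ≤ n := Nat.le_of_dvd (by omega) ⟨_, hx.1.symm⟩
    rw [← LL_ext this hx1]; rfl
  rw [e1]
  have e2 : ∑ x ∈ n.divisorsAntidiagonal, LL K n x.1 * rr K x.2 =
      ∑ P ∈ PF K n, ∑ j ∈ Finset.Icc 1 n, Real.log (Ideal.absNorm P) * ({I ∈ NS K n | P ^ j ∣ I}.ncard : ℝ) := by
    unfold LL
    simp_rw [Finset.sum_mul]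
    rw [Finset.sum_comm]
    refine Finset.sum_congr rfl fun P hP => ?_
    rw [Finset.sum_comm]
    refine Finset.sum_congr rfl fun j _ => ?_
    by_cases hd : Ideal.absNorm P ^ j ∣ n
    · obtain ⟨m, hm⟩ := hd
      have hm0 : m ≠ 0 := by rintro rfl; simp at hm; exact hn hm
      rw [Finset.sum_eq_single (Ideal.absNorm P ^ j, m)]
      · rw [if_pos rfl, rr_apply hm0, count_bij (Q := P ^ j) hn (by rw [map_pow, hm])]
      · rintro ⟨x, y⟩ hx hne
        rw [Nat.mem_divisorsAntidiagonal] at hx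
        simp only at hx ⊢
        rw [if_neg, zero_mul]
        intro h
        apply hne
        rw [← h] at hx ⊢
        have : Ideal.absNorm P ^ j ≠ 0 := by rintro h; rw [h] at hm; simp at hm; exact hn hm
        rw [mul_left_cancel₀ this (hx.1.trans hm)]
      · intro h
        exact absurd (Nat.mem_divisorsAntidiagonal.mpr ⟨hm.symm, hn⟩) h
    · have hempty : {I ∈ NS K n | P ^ j ∣ I} = ∅ := by
        ext I
        simp only [Set.mem_setOf_eq, Set.mem_empty_iff_false, iff_false, not_and]
        intro hI hdv
        apply hd
        have hI : Ideal.absNorm I = n := hI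
        have := Ideal.absNorm_dvd_absNorm_of_le (Ideal.le_of_dvd hdv)
        rwa [map_pow, hI] at this
      rw [hempty, Set.ncard_empty, Nat.cast_zero, mul_zero]
      apply Finset.sum_eq_zero
      intro x hx
      rw [Nat.mem_divisorsAntidiagonal] at hx
      rw [if_neg, zero_mul]
      intro h
      exact hd ⟨x.2, by rw [h, hx.1]⟩
  have e3 : ((NS K n).ncard : ℝ) * Real.log n = ∑ I ∈ (NS_fin (K := K) n hn).toFinset, Real.log n := by
    rw [Finset.sum_const, nsmul_eq_mul, Set.ncard_eq_toFinset_card _ (NS_fin n hn)]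
  rw [e2, e3]
  have e4 : ∀ I ∈ (NS_fin (K := K) n hn).toFinset, Real.log n = ∑ P ∈ PF K n, ∑ j ∈ Finset.Icc 1 n, if P ^ j ∣ I then Real.log (Ideal.absNorm P) else 0 := by
    intro I hI
    rw [Set.Finite.mem_toFinset] at hI
    exact log_norm hn hI
  refine Eq.trans ?_ (Finset.sum_congr rfl e4).symm
  refine Eq.trans ?_ Finset.sum_comm
  refine Finset.sum_congr rfl fun P hP => ?_
  refine Eq.trans ?_ Finset.sum_comm
  refine Finset.sum_congr rfl fun j _ => ?_
  rw [← Finset.sum_filter, Finset.sum_const, nsmul_eq_mul, mul_comm]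
  congr 2
  rw [← Set.ncard_coe_finset]
  congr 1
  ext I; simp

end IdealCount

namespace IdealCount
open NumberField
open scoped Classical nonZeroDivisors

variable {K : Type*} [Field K] [NumberField K]

lemma rr_nonneg (n : ℕ) : 0 ≤ rr K n := by
  by_cases hn : n = 0
  · subst hn; simp
  · rw [rr_apply hn]; positivity

variable (K) in
lemma psi_bound : ∃ C' : ℝ, ∀ x : ℝ, 2 ≤ x → ∑ n ∈ Finset.Ioc 0 ⌊x⌋₊, Lam K n ≤ 2 * x + C' * (x / Real.log x) := by
  obtain ⟨κ, C, δ, hκ, hC, hδ, hδ1, h⟩ := A_est K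
  refine Selberg.selberg_bound (rr K) (Lam K) rr_one rr_nonneg Lam_nonneg lam_mul κ C δ hκ hC hδ hδ1 ?_
  intro x hx
  rw [sum_rr x (by linarith)]
  exact h x (by linarith)

lemma psi_ge (x : ℕ) : ∑ P ∈ PF K x, Real.log (Ideal.absNorm P) ≤ ∑ n ∈ Finset.Ioc 0 x, Lam K n := by
  have e : ∑ n ∈ Finset.Ioc 0 x, Lam K n = ∑ n ∈ Finset.Ioc 0 x, LL K x n := by
    refine Finset.sum_congr rfl fun n hn => ?_
    rw [Finset.mem_Ioc] at hn
    exact LL_ext hn.2 (by omega)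
  rw [e]
  unfold LL
  rw [Finset.sum_comm]
  refine Finset.sum_le_sum fun P hP => ?_
  rw [mem_PF] at hP
  have h2 := two_le hP.1 hP.2.1
  have hl : 0 ≤ Real.log (Ideal.absNorm P) := Real.log_natCast_nonneg _
  calc Real.log (Ideal.absNorm P) = if Ideal.absNorm P ^ 1 = Ideal.absNorm P then Real.log (Ideal.absNorm P) else 0 := by simp
    _ ≤ ∑ j ∈ Finset.Icc 1 x, if Ideal.absNorm P ^ j = Ideal.absNorm P then Real.log (Ideal.absNorm P) else 0 :=
      Finset.single_le_sum (f := fun j => if Ideal.absNorm P ^ j = Ideal.absNorm P then Real.log (Ideal.absNorm P) else 0) (fun j _ => by split_ifs <;> simp [hl]) (Finset.mem_Icc.mpr ⟨le_refl 1, by omega⟩)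
    _ ≤ _ := Finset.single_le_sum (f := fun n => ∑ j ∈ Finset.Icc 1 x, if Ideal.absNorm P ^ j = n then Real.log (Ideal.absNorm P) else 0) (fun n _ => Finset.sum_nonneg fun j _ => by split_ifs <;> simp [hl]) (Finset.mem_Ioc.mpr ⟨by omega, hP.2.2⟩)

lemma small_le (x : ℕ) (y : ℝ) : (((PF K x).filter (fun P => (Ideal.absNorm P : ℝ) ≤ y)).card : ℝ) ≤ A K y := by
  rw [A, Nat.cast_le, ← Set.ncard_coe_finset]
  refine Set.ncard_le_ncard_of_injOn (fun P => if h : P = ⊥ then (1 : (Ideal (𝓞 K))⁰) else ⟨P, mem_nonZeroDivisors_of_ne_zero h⟩) ?_ ?_ (AS_fin y)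
  · intro P hP
    simp only [Finset.coe_filter, Set.mem_setOf_eq, mem_PF] at hP
    rw [dif_neg hP.1.2.1]
    exact hP.2
  · intro P hP Q hQ h
    simp only [Finset.coe_filter, Set.mem_setOf_eq, mem_PF] at hP hQ
    dsimp only at h
    rw [dif_neg hP.1.2.1, dif_neg hQ.1.2.1] at h
    exact congrArg Subtype.val h

variable (K) in
theorem prime_ideal_bound : ∀ᶠ x : ℕ in atTop, ((PF K x).card : ℝ) ≤ 5 * (x / Real.log x) := by
  obtain ⟨κ, C, δ, hκ, hC, hδ, hδ1, hA⟩ := A_est K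
  obtain ⟨C', hC'⟩ := psi_bound K
  have t1 : ∀ᶠ x : ℝ in atTop, (κ + C) * Real.log x ≤ (1/2) * x ^ (1/2 : ℝ) := by
    have := (isLittleO_log_rpow_atTop (r := 1/2) (by norm_num)).def (c := 1/2/(κ+C)) (by positivity)
    filter_upwards [this, eventually_ge_atTop 1] with x hx h1
    rw [Real.norm_of_nonneg (Real.log_nonneg h1), Real.norm_of_nonneg (by positivity)] at hx
    calc _ ≤ (κ + C) * (1/2/(κ+C) * x ^ (1/2 : ℝ)) := by gcongr
      _ = _ := by field_simp
  have t2 : ∀ᶠ x : ℝ in atTop, 4 * |C'| ≤ Real.log x := Real.tendsto_log_atTop.eventually_ge_atTop _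
  filter_upwards [tendsto_natCast_atTop_atTop.eventually t1, tendsto_natCast_atTop_atTop.eventually t2, eventually_ge_atTop 2] with x h1 h2 hx
  have hx' : (2:ℝ) ≤ x := by exact_mod_cast hx
  have hl : 0 < Real.log x := Real.log_pos (by linarith)
  set y := (x:ℝ) ^ (1/2 : ℝ) with hy
  have hy1 : 1 ≤ y := Real.one_le_rpow (by linarith) (by norm_num)
  have hyy : y * y = x := by rw [hy, ← Real.rpow_add (by linarith)]; norm_num
  have hly : Real.log y = Real.log x / 2 := by rw [hy, Real.log_rpow (by linarith)]; ring
  have s1 : A K y ≤ (κ + C) * y := by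
    have := (abs_le.mp (hA y (by linarith))).2
    have h3 : y ^ (1 - δ) ≤ y := by
      conv_rhs => rw [← Real.rpow_one y]
      exact Real.rpow_le_rpow_of_exponent_le hy1 (by linarith)
    nlinarith
  have s2 := small_le (K := K) x y
  have s3 : (((PF K x).filter (fun P => ¬ (Ideal.absNorm P : ℝ) ≤ y)).card : ℝ) * (Real.log x / 2) ≤ 2 * x + C' * (x / Real.log x) := by
    have e := (psi_ge (K := K) x).trans (by simpa using hC' x hx')
    refine le_trans ?_ e
    rw [← nsmul_eq_mul]
    refine le_trans (Finset.card_nsmul_le_sum _ (fun P => Real.log (Ideal.absNorm P)) _ ?_) (Finset.sum_le_sum_of_subset_of_nonneg (Finset.filter_subset _ _) fun P _ _ => Real.log_natCast_nonneg _)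
    intro P hP
    rw [Finset.mem_filter] at hP
    rw [← hly]
    exact Real.log_le_log (by linarith) (le_of_lt (not_le.mp hP.2))
  have s4 := Finset.card_filter_add_card_filter_not (s := PF K x) (fun P => (Ideal.absNorm P : ℝ) ≤ y)
  rw [← s4]
  push_cast
  set a := (((PF K x).filter (fun P => (Ideal.absNorm P : ℝ) ≤ y)).card : ℝ)
  set b := (((PF K x).filter (fun P => ¬ (Ideal.absNorm P : ℝ) ≤ y)).card : ℝ)
  have b1 : a * Real.log x ≤ (1/2) * x := by
    calc a * Real.log x ≤ ((κ + C) * y) * Real.log x := by gcongr; linarith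
      _ = y * ((κ + C) * Real.log x) := by ring
      _ ≤ y * (1/2 * y) := by gcongr
      _ = _ := by rw [← hyy]; ring
  have b2 : C' * (x / Real.log x) ≤ x / 4 := by
    rw [mul_div_assoc', div_le_iff₀ hl]
    nlinarith [le_abs_self C']
  have b3 : b * Real.log x ≤ (9/2) * x := by linarith
  rw [mul_div_assoc', le_div_iff₀ hl]
  linarith

end IdealCount

namespace DensB
open NumberField
open scoped Pointwise Classical
variable {L : Type*} [Field L] [NumberField L] [IsGalois ℚ L]

/-- the fixed field of the group generated by σ -/
noncomputable abbrev KK (σ : Gal(L/ℚ)) : IntermediateField ℚ L := IntermediateField.fixedField (Subgroup.zpowers σ)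

lemma smul_coe (σ : Gal(L/ℚ)) (x : 𝓞 L) : ((σ • x : 𝓞 L) : L) = σ (x : L) := rfl

lemma fix_of_mem {σ τ : Gal(L/ℚ)} (h : τ ∈ Subgroup.zpowers σ) (x : 𝓞 (KK σ)) :
    τ • (algebraMap (𝓞 (KK σ)) (𝓞 L) x) = algebraMap (𝓞 (KK σ)) (𝓞 L) x := by
  apply RingOfIntegers.coe_injective
  have h2 := (IntermediateField.mem_fixedField_iff (Subgroup.zpowers σ) ((x : KK σ) : L)).mp (x : KK σ).2 τ h
  exact h2

lemma inj_aux {σ : Gal(L/ℚ)} {Q Q' : Ideal (𝓞 L)} [hQ : Q.IsPrime] [hQ' : Q'.IsPrime]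
    (h : MulAction.stabilizer Gal(L/ℚ) Q = Subgroup.zpowers σ)
    (e : Q.under (𝓞 (KK σ)) = Q'.under (𝓞 (KK σ))) : Q = Q' := by
  obtain ⟨g, hg⟩ := Algebra.IsInvariant.exists_smul_of_under_eq (𝓞 (KK σ)) (𝓞 L) Gal(L/(KK σ)) Q Q' e
  have h1 : g.restrictScalars ℚ ∈ Subgroup.zpowers σ := by
    rw [← IntermediateField.fixingSubgroup_fixedField (Subgroup.zpowers σ), IntermediateField.mem_fixingSubgroup_iff]
    intro x hx
    exact g.commutes ⟨x, hx⟩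
  rw [← h] at h1
  have h2 : g.restrictScalars ℚ • Q = Q := h1
  have h3 : g.restrictScalars ℚ • Q = g • Q := by
    ext y
    rw [Ideal.mem_pointwise_smul_iff_inv_smul_mem, Ideal.mem_pointwise_smul_iff_inv_smul_mem]
    rfl
  rw [hg, ← h3, h2]

lemma card_quot {p : ℕ} (hp : p.Prime) {Q : Ideal (𝓞 L)} [hQ : Q.IsPrime] (hpQ : (p : 𝓞 L) ∈ Q) :
    Nat.card (ℤ ⧸ Q.under ℤ) = p := by
  have : Q.under ℤ = Ideal.span {(p : ℤ)} := by
    have hm : (Ideal.span {(p:ℤ)}).IsMaximal := PrincipalIdealRing.isMaximal_of_irreducible (Nat.prime_iff_prime_int.mp hp).irreducible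
    refine (hm.eq_of_le (Ideal.IsPrime.ne_top inferInstance) ?_).symm
    rw [Ideal.span_singleton_le_iff_mem, Ideal.under_def, Ideal.mem_comap]
    simpa using hpQ
  rw [this]
  have := Int.card_ideal_quot p
  exact this

lemma frob {p : ℕ} (hp : p.Prime) {Q : Ideal (𝓞 L)} [hQ : Q.IsPrime] (hpQ : (p : 𝓞 L) ∈ Q) :
    ∃ φ : Gal(L/ℚ), φ ∈ MulAction.stabilizer Gal(L/ℚ) Q ∧ ∀ x : 𝓞 L, φ • x - x ^ p ∈ Q := by
  have hQ0 : Q ≠ ⊥ := by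
    rintro rfl
    simp at hpQ
    exact hp.ne_zero hpQ
  have : Finite (𝓞 L ⧸ Q) := Ideal.finiteQuotientOfFreeOfNeBot Q hQ0
  obtain ⟨φ, h⟩ := IsArithFrobAt.exists_of_isInvariant ℤ Gal(L/ℚ) Q
  refine ⟨φ, h.mem_stabilizer, fun x => ?_⟩
  have := h x
  rw [card_quot hp hpQ] at this
  exact this

lemma card_le_of_pow {B : Type*} [CommRing B] [IsDomain B] {p : ℕ} (hp : 1 < p) (key : ∀ x : B, x ^ p = x) :
    Nat.card B ≤ p := by
  set P : B[X] := X ^ p - X with hP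
  have hP0 : P ≠ 0 := by
    intro h
    have := congrArg (fun Q => coeff Q p) h
    simp [hP, coeff_X, hp.ne] at this
  have hfin : (P.roots.toFinset : Set B) = Set.univ := by
    ext x
    have : P.eval x = 0 := by simp [hP, key x]
    simp [hP0, this]
  have hc : Nat.card B = P.roots.toFinset.card := by
    rw [← Set.ncard_univ, ← hfin, Set.ncard_coe_finset]
  rw [hc]
  refine (Multiset.toFinset_card_le _).trans ((Polynomial.card_roots' _).trans ?_)
  rw [hP]
  refine (natDegree_sub_le _ _).trans ?_
  simp [hp.le]

lemma norm_le {p : ℕ} (hp : p.Prime) {Q : Ideal (𝓞 L)} [hQ : Q.IsPrime] (hpQ : (p : 𝓞 L) ∈ Q) {σ : Gal(L/ℚ)}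
    (h : MulAction.stabilizer Gal(L/ℚ) Q = Subgroup.zpowers σ) :
    Ideal.absNorm (Q.under (𝓞 (KK σ))) ≤ p := by
  obtain ⟨φ, h1, h2⟩ := frob hp hpQ
  rw [h] at h1
  have key : ∀ x : 𝓞 (KK σ) ⧸ Q.under (𝓞 (KK σ)), x ^ p = x := by
    intro x
    obtain ⟨x, rfl⟩ := Ideal.Quotient.mk_surjective x
    rw [← map_pow, eq_comm, Ideal.Quotient.mk_eq_mk_iff_sub_mem, Ideal.under_def, Ideal.mem_comap]
    have := h2 (algebraMap _ _ x)
    rw [fix_of_mem h1] at this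
    rwa [map_sub, map_pow]
  rw [Ideal.absNorm_apply, Submodule.cardQuot_apply]
  exact card_le_of_pow hp.one_lt key

/-- unramified case : stabilizer generated by Frobenius -/
lemma stab_eq {p : ℕ} (hp : p.Prime) {Q : Ideal (𝓞 L)} [hQ : Q.IsPrime] (hpQ : (p : 𝓞 L) ∈ Q)
    (hin : ∀ σ : Gal(L/ℚ), (∀ x : 𝓞 L, σ • x - x ∈ Q) → σ = 1) :
    ∃ φ : Gal(L/ℚ), MulAction.stabilizer Gal(L/ℚ) Q = Subgroup.zpowers φ := by
  have hQ0 : Q ≠ ⊥ := by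
    rintro rfl
    simp at hpQ
    exact hp.ne_zero hpQ
  have hf1 : Finite (𝓞 L ⧸ Q) := Ideal.finiteQuotientOfFreeOfNeBot Q hQ0
  have hmax : Q.IsMaximal := Ideal.IsPrime.isMaximal hQ hQ0
  let _ : Field (𝓞 L ⧸ Q) := Ideal.Quotient.field Q
  have hmax2 : (Q.under ℤ).IsMaximal := inferInstance
  let _ : Field (ℤ ⧸ Q.under ℤ) := Ideal.Quotient.field (Q.under ℤ)
  have hcyc : IsCyclic (MulAction.stabilizer Gal(L/ℚ) Q) := by
    refine isCyclic_of_injective (Ideal.Quotient.stabilizerHom Q (Q.under ℤ) Gal(L/ℚ)) ?_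
    rw [injective_iff_map_eq_one]
    rintro ⟨σ, hσ⟩ h
    apply Subtype.ext
    apply hin
    intro x
    have := DFunLike.congr_fun h (Ideal.Quotient.mk Q x)
    rw [← Ideal.Quotient.mk_eq_mk_iff_sub_mem]
    exact this
  obtain ⟨⟨φ, hφ⟩, h⟩ := hcyc.exists_generator
  refine ⟨φ, le_antisymm ?_ ?_⟩
  · intro σ hσ
    obtain ⟨n, hn⟩ := Subgroup.mem_zpowers_iff.mp (h ⟨σ, hσ⟩)
    exact Subgroup.mem_zpowers_iff.mpr ⟨n, congrArg Subtype.val hn⟩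
  · rwa [Subgroup.zpowers_le]
end DensB

namespace DensB
open NumberField IdealCount
open scoped Pointwise Classical
variable {L : Type*} [Field L] [NumberField L] [IsGalois ℚ L]

lemma exists_prime_over {p : ℕ} (hp : p.Prime) : ∃ Q : Ideal (𝓞 L), Q.IsPrime ∧ (p : 𝓞 L) ∈ Q := by
  have : ¬ IsUnit (p : 𝓞 L) := by
    intro h
    have h2 : Ideal.absNorm (Ideal.span {(p : 𝓞 L)}) = 1 := by
      rw [Ideal.absNorm_eq_one_iff, Ideal.span_singleton_eq_top]; exact h
    rw [Ideal.absNorm_span_natCast] at h2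
    have h3 : Module.finrank ℤ (𝓞 L) ≠ 0 := Module.finrank_pos.ne'
    exact hp.ne_one ((Nat.pow_eq_one.mp h2).resolve_right h3)
  obtain ⟨Q, hQ, h⟩ := exists_max_ideal_of_mem_nonunits (a := (p : 𝓞 L)) this
  exact ⟨Q, hQ.isPrime, h⟩

lemma pair_count {p : ℕ} (hp : p.Prime) (h2 : IsPGroup 2 Gal(L/ℚ))
    (hin : ∀ Q : Ideal (𝓞 L), Q.IsPrime → (p : 𝓞 L) ∈ Q → ∀ σ : Gal(L/ℚ), (∀ x : 𝓞 L, σ • x - x ∈ Q) → σ = 1) :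
    ∃ T : Finset (Gal(L/ℚ) × Ideal (𝓞 L)), Nat.card Gal(L/ℚ) ≤ 2 * T.card ∧
      ∀ t ∈ T, t.2.IsPrime ∧ (p : 𝓞 L) ∈ t.2 ∧ MulAction.stabilizer Gal(L/ℚ) t.2 = Subgroup.zpowers t.1 := by
  obtain ⟨Q, hQ, hpQ⟩ := exists_prime_over (L := L) hp
  obtain ⟨φ, hφ⟩ := stab_eq hp hpQ (hin Q hQ hpQ)
  set gens : Finset Gal(L/ℚ) := Finset.univ.filter (fun σ => Subgroup.zpowers σ = Subgroup.zpowers φ) with hg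
  set S := (Finset.univ : Finset Gal(L/ℚ)) ×ˢ gens with hS
  set f : Gal(L/ℚ) × Gal(L/ℚ) → Gal(L/ℚ) × Ideal (𝓞 L) := fun x => (x.1 * x.2 * x.1⁻¹, x.1 • Q) with hf
  have hfib : ∀ a ∈ S.image f, (S.filter (fun x => f x = a)).card ≤ orderOf φ := by
    intro a ha
    obtain ⟨⟨τ, s⟩, -, rfl⟩ := Finset.mem_image.mp ha
    have : (S.filter (fun x => f x = f (τ, s))).card ≤ (Finset.univ.filter (fun σ => σ ∈ Subgroup.zpowers φ)).card := by
      refine Finset.card_le_card_of_injOn (fun x => τ⁻¹ * x.1) ?_ ?_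
      · rintro ⟨τ', s'⟩ hx
        simp only [hf, Finset.coe_filter, Set.mem_setOf_eq, Prod.mk.injEq] at hx
        simp only [Finset.coe_filter, Set.mem_setOf_eq, Finset.mem_univ, true_and, ← hφ, MulAction.mem_stabilizer_iff, mul_smul]
        rw [hx.2.2, inv_smul_smul]
      · rintro ⟨τ', s'⟩ hx ⟨τ'', s''⟩ hy he
        simp only [hf, Finset.coe_filter, Set.mem_setOf_eq, Prod.mk.injEq] at hx hy
        have h1 : τ' = τ'' := mul_left_cancel he
        subst h1
        have := hx.2.1.trans hy.2.1.symm
        simpa using this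
    refine this.trans (le_of_eq ?_)
    rw [← Nat.card_zpowers, ← Set.ncard_coe_finset]
    simp only [Finset.coe_filter, Finset.mem_univ, true_and]
    rfl
  have h1 := Finset.card_le_mul_card_image S (orderOf φ) hfib
  have hgc : gens.card = Nat.totient (orderOf φ) := by
    have e : gens = ((Finset.range (orderOf φ)).filter (fun n => (orderOf φ).Coprime n)).image (fun n => φ ^ n) := by
      ext σ
      simp only [hg, Finset.mem_filter, Finset.mem_univ, true_and, Finset.mem_image, Finset.mem_range]
      constructor
      · intro h
        have : σ ∈ Subgroup.zpowers φ := by rw [← h]; exact Subgroup.mem_zpowers σ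
        obtain ⟨n, hn, rfl⟩ := (isOfFinOrder_of_finite φ).mem_zpowers_iff_mem_range_orderOf.mp this |> Finset.mem_image.mp
        rw [Finset.mem_range] at hn
        refine ⟨n, ⟨hn, ?_⟩, rfl⟩
        have h3 : orderOf (φ ^ n) = orderOf φ := by rw [← Nat.card_zpowers, h, Nat.card_zpowers]
        rw [orderOf_pow] at h3
        have h4 := Nat.div_mul_cancel (Nat.gcd_dvd_left (orderOf φ) n)
        rw [h3] at h4
        have h5 : 0 < orderOf φ := orderOf_pos φ
        exact Nat.eq_of_mul_eq_mul_left h5 (by rw [h4, mul_one])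
      · rintro ⟨n, ⟨hn, hc⟩, rfl⟩
        apply Subgroup.eq_of_le_of_card_ge
        · rw [Subgroup.zpowers_le]; exact Subgroup.pow_mem _ (Subgroup.mem_zpowers φ) n
        · rw [Nat.card_zpowers, Nat.card_zpowers, Nat.Coprime.orderOf_pow hc]
    rw [e, Finset.card_image_of_injOn, Nat.totient]
    intro a ha b hb h
    simp only [Finset.coe_filter, Finset.mem_range, Set.mem_setOf_eq] at ha hb
    exact pow_injOn_Iio_orderOf ha.1 hb.1 h
  obtain ⟨m, hm⟩ := (IsPGroup.iff_orderOf.mp h2) φ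
  have htot : orderOf φ ≤ 2 * Nat.totient (orderOf φ) := by
    rw [hm]
    rcases m with _ | m
    · simp
    · rw [Nat.totient_prime_pow_succ Nat.prime_two, pow_succ]; omega
  have hpos : 0 < orderOf φ := orderOf_pos φ
  refine ⟨S.image f, ?_, ?_⟩
  · rw [hS, Finset.card_product, hgc, Finset.card_univ, ← Nat.card_eq_fintype_card] at h1
    have : orderOf φ * Nat.card Gal(L/ℚ) ≤ orderOf φ * (2 * (S.image f).card) := by
      calc _ ≤ 2 * Nat.totient (orderOf φ) * Nat.card Gal(L/ℚ) := Nat.mul_le_mul_right _ htot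
        _ = 2 * (Nat.card Gal(L/ℚ) * Nat.totient (orderOf φ)) := by ring
        _ ≤ 2 * _ := Nat.mul_le_mul_left _ h1
        _ = _ := by ring
    exact Nat.le_of_mul_le_mul_left this hpos
  · intro t ht
    obtain ⟨⟨τ, s⟩, hs, rfl⟩ := Finset.mem_image.mp ht
    simp only [hS, hg, Finset.mem_product, Finset.mem_univ, true_and, Finset.mem_filter] at hs
    refine ⟨?_, ?_, ?_⟩
    · exact Ideal.IsPrime.smul τ
    · simp only [hf]
      rw [Ideal.mem_pointwise_smul_iff_inv_smul_mem]
      have : τ⁻¹ • (p : 𝓞 L) = p := by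
        have := map_natCast (MulSemiringAction.toRingHom Gal(L/ℚ) (𝓞 L) τ⁻¹) p
        exact this
      rwa [this]
    · simp only [hf]
      rw [MulAction.stabilizer_smul_eq_stabilizer_map_conj, hφ, ← hs, MonoidHom.map_zpowers]
      simp
end DensB

namespace DensB
open NumberField IdealCount
open scoped Pointwise Classical
variable {L : Type*} [Field L] [NumberField L] [IsGalois ℚ L]

lemma prime_eq {p q : ℕ} (hp : p.Prime) (hq : q.Prime) {Q : Ideal (𝓞 L)} (hQ : Q.IsPrime) (h1 : (p : 𝓞 L) ∈ Q) (h2 : (q : 𝓞 L) ∈ Q) : p = q := by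
  by_contra hne
  have hc := (Nat.coprime_primes hp hq).mpr hne
  have hc2 : IsCoprime (p : ℤ) (q : ℤ) := Nat.isCoprime_iff_coprime.mpr hc
  obtain ⟨a, b, hab⟩ := hc2
  apply hQ.ne_top
  rw [Ideal.eq_top_iff_one]
  have : (1 : 𝓞 L) = (a : 𝓞 L) * p + b * q := by exact_mod_cast (congrArg (fun z : ℤ => (z : 𝓞 L)) hab).symm
  rw [this]
  exact Ideal.add_mem _ (Ideal.mul_mem_left _ _ h1) (Ideal.mul_mem_left _ _ h2)

lemma count_bound (Fx : Finset Gal(L/ℚ)) (P : Finset ℕ) (x : ℕ) (h2 : IsPGroup 2 Gal(L/ℚ))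
    (hP : ∀ p ∈ P, p.Prime ∧ p ≤ x ∧ ∀ Q : Ideal (𝓞 L), Q.IsPrime → (p : 𝓞 L) ∈ Q →
      (∀ σ : Gal(L/ℚ), (∀ x : 𝓞 L, σ • x - x ∈ Q) → σ = 1) ∧
      ∀ σ : Gal(L/ℚ), MulAction.stabilizer Gal(L/ℚ) Q = Subgroup.zpowers σ → σ ∈ Fx) :
    Nat.card Gal(L/ℚ) * P.card ≤ 2 * ∑ σ ∈ Fx, (PF (KK σ) x).card := by
  have hT : ∀ p ∈ P, ∃ T : Finset (Gal(L/ℚ) × Ideal (𝓞 L)), Nat.card Gal(L/ℚ) ≤ 2 * T.card ∧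
      ∀ t ∈ T, t.2.IsPrime ∧ (p : 𝓞 L) ∈ t.2 ∧ MulAction.stabilizer Gal(L/ℚ) t.2 = Subgroup.zpowers t.1 :=
    fun p hp => pair_count (hP p hp).1 h2 (fun Q hQ hpQ => ((hP p hp).2.2 Q hQ hpQ).1)
  choose! T hT1 hT2 using hT
  have hdisj : (P : Set ℕ).PairwiseDisjoint T := by
    intro p hp q hq hne
    rw [Function.onFun, Finset.disjoint_left]
    intro t ht ht'
    exact hne (prime_eq (hP p hp).1 (hP q hq).1 (hT2 p hp t ht).1 (hT2 p hp t ht).2.1 (hT2 q hq t ht').2.1)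
  have hcard : (P.biUnion T).card ≤ (Fx.sigma (fun σ => PF (KK σ) x)).card := by
    refine Finset.card_le_card_of_injOn (fun t => ⟨t.1, t.2.under (𝓞 (KK t.1))⟩) ?_ ?_
    · intro t ht
      obtain ⟨p, hp, ht⟩ := Finset.mem_biUnion.mp ht
      obtain ⟨hQ, hpQ, hst⟩ := hT2 p hp t ht
      simp only [Finset.coe_sigma, Set.mem_sigma_iff, Finset.mem_coe]
      refine ⟨((hP p hp).2.2 _ hQ hpQ).2 _ hst, mem_PF.mpr ⟨inferInstance, ?_, (norm_le (hP p hp).1 hpQ hst).trans (hP p hp).2.1⟩⟩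
      intro h0
      have : (p : 𝓞 (KK t.1)) ∈ t.2.under (𝓞 (KK t.1)) := by
        rw [Ideal.under_def, Ideal.mem_comap]; simpa using hpQ
      rw [h0] at this
      simp at this
      exact (hP p hp).1.ne_zero this
    · rintro ⟨σ, Q⟩ ht ⟨σ', Q'⟩ ht' h
      obtain ⟨p, hp, ht⟩ := Finset.mem_biUnion.mp ht
      obtain ⟨p', hp', ht'⟩ := Finset.mem_biUnion.mp ht'
      obtain ⟨hQ, hpQ, hst⟩ := hT2 p hp _ ht
      obtain ⟨hQ', hpQ', hst'⟩ := hT2 p' hp' _ ht'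
      simp only [Sigma.mk.injEq] at h
      obtain ⟨rfl, h⟩ := h
      rw [heq_eq_eq] at h
      have e : Q = Q' := inj_aux (hQ := hQ) (hQ' := hQ') hst h
      rw [e]
  rw [Finset.card_sigma, Finset.card_biUnion hdisj] at hcard
  calc Nat.card Gal(L/ℚ) * P.card = ∑ p ∈ P, Nat.card Gal(L/ℚ) := by rw [Finset.sum_const, smul_eq_mul, mul_comm]
    _ ≤ ∑ p ∈ P, 2 * (T p).card := Finset.sum_le_sum fun p hp => hT1 p hp
    _ = 2 * ∑ p ∈ P, (T p).card := by rw [Finset.mul_sum]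
    _ ≤ _ := Nat.mul_le_mul_left _ hcard

theorem density_bound (g : ℤ[X]) (R : Finset (𝓞 L)) (hg : g.map (algebraMap ℤ (𝓞 L)) = ∏ ρ ∈ R, (X - C ρ))
    (hgen : ∀ σ : Gal(L/ℚ), (∀ ρ ∈ R, σ • ρ = ρ) → σ = 1) (h2 : IsPGroup 2 Gal(L/ℚ))
    (Fx : Finset Gal(L/ℚ)) (hFx : ∀ σ : Gal(L/ℚ), (∃ ρ ∈ R, σ • ρ = ρ) → σ ∈ Fx) :
    ∃ N : ℕ, ∀ᶠ x : ℕ in atTop,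
      (((Finset.range (x+1)).filter (fun p : ℕ => p.Prime ∧ ∃ r : ℤ, (p : ℤ) ∣ g.eval r)).card : ℝ) * Nat.card Gal(L/ℚ)
        ≤ N * Nat.card Gal(L/ℚ) + 10 * Fx.card * (x / Real.log x) := by
  have hR : ∀ ρ ∈ R, ∀ σ : Gal(L/ℚ), σ • ρ ∈ R := by
    intro ρ hρ σ
    have h0 : aeval ρ g = 0 := by
      rw [← eval_map_algebraMap, hg, eval_prod]
      exact Finset.prod_eq_zero hρ (by simp)
    have h1 : aeval (σ • ρ) g = 0 := by
      rw [Polynomial.aeval_smul, h0, smul_zero]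
    rw [← eval_map_algebraMap, hg, eval_prod, Finset.prod_eq_zero_iff] at h1
    obtain ⟨ρ', h, h'⟩ := h1
    simp only [eval_sub, eval_X, eval_C, sub_eq_zero] at h'
    rw [h']; exact h
  set Δ : 𝓞 L := ∏ t ∈ R.offDiag, (t.1 - t.2) with hΔ
  have hΔ0 : Δ ≠ 0 := by
    rw [hΔ, Finset.prod_ne_zero_iff]
    rintro ⟨a, b⟩ h
    rw [Finset.mem_offDiag] at h
    exact sub_ne_zero.mpr h.2.2
  set N := Ideal.absNorm (Ideal.span {Δ}) with hN
  have hN0 : N ≠ 0 := by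
    rw [hN, Ne, Ideal.absNorm_eq_zero_iff, Ideal.span_singleton_eq_bot]; exact hΔ0
  have good : ∀ p : ℕ, p.Prime → N < p → ∀ Q : Ideal (𝓞 L), Q.IsPrime → (p : 𝓞 L) ∈ Q →
      ∀ ρ ∈ R, ∀ ρ' ∈ R, ρ - ρ' ∈ Q → ρ = ρ' := by
    intro p hp hNp Q hQ hpQ ρ hρ ρ' hρ' h
    by_contra hne
    have h1 : Δ ∈ Q := by
      rw [hΔ, hQ.prod_mem_iff]
      exact ⟨(ρ, ρ'), Finset.mem_offDiag.mpr ⟨hρ, hρ', hne⟩, h⟩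
    have h3 : (N : 𝓞 L) ∈ Q := by
      have := Ideal.absNorm_mem (Ideal.span {Δ})
      exact (Ideal.span_singleton_le_iff_mem (I := Q)).mpr h1 this
    have hc : Nat.Coprime p N := (Nat.Prime.coprime_iff_not_dvd hp).mpr (fun h => by
      have := Nat.le_of_dvd (Nat.pos_of_ne_zero hN0) h; omega)
    obtain ⟨a, b, hab⟩ := Nat.isCoprime_iff_coprime.mpr hc
    apply hQ.ne_top
    rw [Ideal.eq_top_iff_one]
    have : (1 : 𝓞 L) = (a : 𝓞 L) * p + b * N := by exact_mod_cast (congrArg (fun z : ℤ => (z : 𝓞 L)) hab).symm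
    rw [this]
    exact Ideal.add_mem _ (Ideal.mul_mem_left _ _ hpQ) (Ideal.mul_mem_left _ _ h3)
  refine ⟨N + 1, ?_⟩
  have hev : ∀ᶠ x : ℕ in atTop, ∀ σ ∈ Fx, ((PF (KK σ) x).card : ℝ) ≤ 5 * (x / Real.log x) := by
    rw [Finset.eventually_all]
    intro σ _
    exact prime_ideal_bound (KK σ)
  filter_upwards [hev] with x hx
  set S := (Finset.range (x+1)).filter (fun p : ℕ => p.Prime ∧ ∃ r : ℤ, (p : ℤ) ∣ g.eval r) with hS
  have hmain := count_bound Fx (S.filter (fun p => N < p)) x h2 (by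
    intro p hp
    simp only [hS, Finset.mem_filter, Finset.mem_range] at hp
    obtain ⟨⟨hpx, hpp, r, hr⟩, hNp⟩ := hp
    refine ⟨hpp, by omega, fun Q hQ hpQ => ⟨fun σ hσ => hgen σ fun ρ hρ => ?_, fun σ hst => hFx σ ?_⟩⟩
    · exact good p hpp hNp Q hQ hpQ _ (hR ρ hρ σ) _ hρ (hσ ρ)
    · have h1 : ((g.eval r : ℤ) : 𝓞 L) ∈ Q := by
        obtain ⟨c, hc⟩ := hr
        rw [hc]; push_cast
        exact Ideal.mul_mem_right _ _ hpQ
      have h3 : ((g.eval r : ℤ) : 𝓞 L) = ∏ ρ ∈ R, ((r : 𝓞 L) - ρ) := by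
        have := congrArg (eval (r : 𝓞 L)) hg
        rw [eval_prod, eval_map_algebraMap] at this
        simp only [eval_sub, eval_X, eval_C] at this
        rw [← this]
        have e := Polynomial.aeval_algebraMap_apply (𝓞 L) r g
        simp at e
        exact e.symm
      rw [h3, hQ.prod_mem_iff] at h1
      obtain ⟨ρ, hρ, h1⟩ := h1
      refine ⟨ρ, hρ, ?_⟩
      have hσ : σ • Q = Q := by
        have : σ ∈ MulAction.stabilizer Gal(L/ℚ) Q := by rw [hst]; exact Subgroup.mem_zpowers σ
        exact this
      apply good p hpp hNp Q hQ hpQ _ (hR ρ hρ σ) _ hρ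
      have h4 : σ • ((r : 𝓞 L) - ρ) ∈ Q := by
        rw [← hσ]; exact Ideal.smul_mem_pointwise_smul σ _ Q h1
      have h5 : σ • ((r : 𝓞 L) - ρ) = r - σ • ρ := by
        rw [smul_sub]
        congr 1
        have := map_intCast (MulSemiringAction.toRingHom Gal(L/ℚ) (𝓞 L) σ) r
        exact this
      rw [h5] at h4
      have := Ideal.sub_mem _ h1 h4
      ring_nf at this ⊢
      exact this)
  have hsplit : S.card ≤ (N + 1) + (S.filter (fun p => N < p)).card := by
    rw [← Finset.card_filter_add_card_filter_not (s := S) (fun p => N < p), add_comm]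
    gcongr
    calc _ ≤ (Finset.range (N+1)).card := Finset.card_le_card (by
            intro p hp
            simp only [Finset.mem_filter, Finset.mem_range] at hp ⊢
            omega)
      _ = N + 1 := Finset.card_range _
  have hsum : ((∑ σ ∈ Fx, (PF (KK σ) x).card : ℕ) : ℝ) ≤ Fx.card * (5 * (x / Real.log x)) := by
    push_cast
    rw [← nsmul_eq_mul]
    exact Finset.sum_le_card_nsmul _ _ _ hx
  have hmain' : (Nat.card Gal(L/ℚ) : ℝ) * (S.filter (fun p => N < p)).card ≤ 2 * ((∑ σ ∈ Fx, (PF (KK σ) x).card : ℕ) : ℝ) := by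
    exact_mod_cast hmain
  have hsplit' : (S.card : ℝ) ≤ (N + 1) + (S.filter (fun p => N < p)).card := by exact_mod_cast hsplit
  have hG : (0:ℝ) ≤ Nat.card Gal(L/ℚ) := by positivity
  have := mul_le_mul_of_nonneg_right hsplit' hG
  push_cast at this ⊢
  linarith
end DensB

namespace Tree
open scoped Classical

/-- the map z ↦ z² + k on a commutative ring -/
def F {B : Type*} [CommRing B] (k : ℤ) (z : B) : B := z ^ 2 + (k : B)

lemma map_F {B B' : Type*} [CommRing B] [CommRing B'] (φ : B →+* B') (k : ℤ) (n : ℕ) (z : B) :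
    φ ((F k)^[n] z) = (F k)^[n] (φ z) := by
  induction n generalizing z with
  | zero => rfl
  | succ n ih => rw [Function.iterate_succ_apply, Function.iterate_succ_apply, ih]; simp [F]

/-- critical orbit -/
def c (k : ℤ) (n : ℕ) : ℤ := (F k)^[n] 0

lemma c_zero (k : ℤ) : c k 0 = 0 := rfl
lemma c_succ (k : ℤ) (n : ℕ) : c k (n+1) = c k n ^ 2 + k := by
  rw [c, Function.iterate_succ_apply']; simp [F, c]
lemma c_one (k : ℤ) : c k 1 = k := by simp [c_succ, c_zero]

section
variable (L : Type*) [Field L]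
/-- every element of level n < M has a square root of y - k -/
def Sq (k a : ℤ) (M : ℕ) : Prop := ∀ n < M, ∀ y : L, (F k)^[n] y = (a : L) → ∃ z : L, z ^ 2 = y - k

variable {L}
noncomputable def sq (k : ℤ) (y : L) : L := if h : ∃ z : L, z ^ 2 = y - k then h.choose else 0

variable (L) in
noncomputable def R (k a : ℤ) : ℕ → Finset L
  | 0 => {(a : L)}
  | n + 1 => (R k a n).biUnion (fun y => {sq k y, - sq k y})

variable {k a : ℤ} {M : ℕ}

lemma mem_R (h : Sq L k a M) {n : ℕ} (hn : n ≤ M) (z : L) : z ∈ R L k a n ↔ (F k)^[n] z = (a : L) := by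
  induction n generalizing z with
  | zero => simp [R]
  | succ n ih =>
    rw [R, Finset.mem_biUnion, Function.iterate_succ_apply]
    constructor
    · rintro ⟨y, hy, hz⟩
      rw [ih (by omega)] at hy
      have hs : (sq k y) ^ 2 = y - k := by
        have := h n (by omega) y hy
        rw [sq, dif_pos this]; exact this.choose_spec
      have : F k z = y := by
        rw [Finset.mem_insert, Finset.mem_singleton] at hz
        rcases hz with rfl | rfl
        · simp [F, hs]
        · simp [F, hs]
      rw [this]; exact hy
    · intro hz
      refine ⟨F k z, (ih (by omega) _).mpr hz, ?_⟩
      have hs : (sq k (F k z)) ^ 2 = F k z - k := by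
        have := h n (by omega) _ hz
        rw [sq, dif_pos this]; exact this.choose_spec
      have : (sq k (F k z)) ^ 2 = z ^ 2 := by rw [hs]; simp [F]
      rw [Finset.mem_insert, Finset.mem_singleton]
      rcases sq_eq_sq_iff_eq_or_eq_neg.mp this with h | h
      · left; exact h.symm
      · right; rw [h]; simp

lemma F_mem (h : Sq L k a M) {n : ℕ} (hn : n + 1 ≤ M) {z : L} (hz : z ∈ R L k a (n+1)) : F k z ∈ R L k a n := by
  rw [mem_R h hn, Function.iterate_succ_apply] at hz
  rw [mem_R h (by omega)]; exact hz

lemma mem_of_F (h : Sq L k a M) {n : ℕ} (hn : n + 1 ≤ M) {z : L} (hz : F k z ∈ R L k a n) : z ∈ R L k a (n+1) := by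
  rw [mem_R h (by omega)] at hz
  rw [mem_R h hn, Function.iterate_succ_apply]; exact hz

lemma neg_mem (h : Sq L k a M) {n : ℕ} (hn : n + 1 ≤ M) {z : L} (hz : z ∈ R L k a (n+1)) : -z ∈ R L k a (n+1) := by
  apply mem_of_F h hn
  have := F_mem h hn hz
  simpa [F] using this

lemma F_eq {z w : L} (h : F k z = F k w) : w = z ∨ w = - z := by
  have : w ^ 2 = z ^ 2 := by simpa [F] using h.symm
  exact sq_eq_sq_iff_eq_or_eq_neg.mp this

lemma zero_notMem [CharZero L] (h : Sq L k a M) (hc : ∀ m, 1 ≤ m → c k m ≠ a) {n : ℕ} (hn : n + 1 ≤ M) : (0 : L) ∉ R L k a (n+1) := by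
  rw [mem_R h hn]
  intro h0
  have h1 := map_F (Int.castRingHom L) k (n+1) 0
  rw [map_zero, h0] at h1
  apply hc (n+1) (by omega)
  have : ((c k (n+1) : ℤ) : L) = (a : L) := h1
  exact_mod_cast this

lemma sq_spec (h : Sq L k a M) {n : ℕ} (hn : n + 1 ≤ M) {y : L} (hy : y ∈ R L k a n) : (sq k y) ^ 2 = y - k := by
  rw [mem_R h (by omega)] at hy
  have := h n (by omega) y hy
  rw [sq, dif_pos this]; exact this.choose_spec

lemma sq_mem (h : Sq L k a M) {n : ℕ} (hn : n + 1 ≤ M) {y : L} (hy : y ∈ R L k a n) : sq k y ∈ R L k a (n+1) ∧ F k (sq k y) = y := by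
  have : F k (sq k y) = y := by simp [F, sq_spec h hn hy]
  exact ⟨mem_of_F h hn (by rwa [this]), this⟩

lemma sq_ne [CharZero L] (h : Sq L k a M) (hc : ∀ m, 1 ≤ m → c k m ≠ a) {n : ℕ} (hn : n + 1 ≤ M) {y : L} (hy : y ∈ R L k a n) : sq k y ≠ - sq k y := by
  intro he
  have h0 : sq k y = 0 := by
    have : 2 * sq k y = 0 := by linear_combination he
    simpa using this
  have := (sq_mem h hn hy).1
  rw [h0] at this
  exact zero_notMem h hc hn this

lemma prod_R [CharZero L] (h : Sq L k a M) (hc : ∀ m, 1 ≤ m → c k m ≠ a) {n : ℕ} (hn : n + 1 ≤ M) {B : Type*} [CommMonoid B] (φ : L → B) :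
    ∏ z ∈ R L k a (n+1), φ z = ∏ y ∈ R L k a n, (φ (sq k y) * φ (- sq k y)) := by
  rw [R, Finset.prod_biUnion]
  · refine Finset.prod_congr rfl fun y hy => ?_
    rw [Finset.prod_pair (sq_ne h hc hn hy)]
  · intro y hy y' hy' hne
    rw [Function.onFun, Finset.disjoint_left]
    intro z hz hz'
    apply hne
    have e : ∀ y ∈ R L k a n, z ∈ ({sq k y, - sq k y} : Finset L) → F k z = y := by
      intro y hy hz
      rw [Finset.mem_insert, Finset.mem_singleton] at hz
      have := (sq_mem h hn hy).2
      rcases hz with rfl | rfl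
      · exact this
      · simpa [F] using this
    rw [← e y hy hz, ← e y' hy' hz']

lemma prod_formula [CharZero L] (h : Sq L k a M) (hc : ∀ m, 1 ≤ m → c k m ≠ a) {n : ℕ} (hn : n ≤ M) {B : Type*} [CommRing B] (φ : L →+* B) (x : B) :
    ∏ z ∈ R L k a n, (x - φ z) = (F k)^[n] x - (a : B) := by
  induction n generalizing x with
  | zero => simp [R]
  | succ n ih =>
    rw [prod_R h hc hn (fun z => x - φ z), Function.iterate_succ_apply, ← ih (by omega)]
    refine Finset.prod_congr rfl fun y hy => ?_
    have := congrArg φ (sq_spec h hn hy)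
    simp only [map_pow, map_sub, map_intCast] at this
    simp only [map_neg, F]
    linear_combination -this

lemma card_R [CharZero L] (h : Sq L k a M) (hc : ∀ m, 1 ≤ m → c k m ≠ a) {n : ℕ} (hn : n ≤ M) : (R L k a n).card = 2 ^ n := by
  induction n with
  | zero => simp [R]
  | succ n ih =>
    have := prod_R (B := Multiplicative ℕ) h hc hn (fun _ => Multiplicative.ofAdd 1)
    rw [Finset.prod_const, Finset.prod_const] at this
    have h2 := congrArg Multiplicative.toAdd this
    rw [ih (by omega)] at h2
    simp at h2
    rw [h2]; ring

lemma prod_z [CharZero L] (h : Sq L k a M) (hc : ∀ m, 1 ≤ m → c k m ≠ a) {n : ℕ} (hn : n + 1 ≤ M) :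
    ∏ z ∈ R L k a (n+1), z = ((c k (n+1) - a : ℤ) : L) := by
  have h1 := prod_formula h hc hn (RingHom.id L) 0
  have h2 := map_F (Int.castRingHom L) k (n+1) 0
  rw [map_zero] at h2
  rw [← h2] at h1
  have e : ∏ z ∈ R L k a (n+1), ((0:L) - (RingHom.id L) z) = ∏ z ∈ R L k a (n+1), z := by
    simp only [RingHom.id_apply, zero_sub]
    rw [Finset.prod_neg, card_R h hc hn, pow_succ, pow_mul']; simp
  rw [e] at h1
  rw [h1]; simp [c]

lemma prod_sub_k [CharZero L] (h : Sq L k a M) (hc : ∀ m, 1 ≤ m → c k m ≠ a) {n : ℕ} (hn : n ≤ M) :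
    ∏ y ∈ R L k a n, (y - (k : L)) = ((if n = 0 then a - k else c k (n+1) - a : ℤ) : L) := by
  have h1 := prod_formula h hc hn (RingHom.id L) (k : L)
  have h2 := map_F (Int.castRingHom L) k (n+1) 0
  rw [map_zero, Function.iterate_succ_apply (F k) n (0:L)] at h2
  have e0 : F k (0:L) = k := by simp [F]
  rw [e0] at h2
  rw [← h2] at h1
  split_ifs with h0
  · subst h0; simp [R]
  · have e : ∏ z ∈ R L k a n, ((k:L) - (RingHom.id L) z) = ∏ z ∈ R L k a n, (z - (k:L)) := by
      obtain ⟨m, rfl⟩ := Nat.exists_eq_succ_of_ne_zero h0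
      have e2 : ∀ z : L, (k:L) - (RingHom.id L) z = -(z - (k:L)) := fun z => by simp
      simp_rw [e2]
      rw [Finset.prod_neg, card_R h hc hn, Nat.succ_eq_add_one, pow_succ, pow_mul']; simp
    rw [← e, h1]; simp [c]
end
end Tree

namespace Tree
open scoped Classical

variable {L : Type*} [Field L] [NumberField L] [IsGalois ℚ L] {k a : ℤ} {M : ℕ}

lemma sig_F (σ : Gal(L/ℚ)) (z : L) : σ (F k z) = F k (σ z) := by simp [F]

lemma sig_mem (h : Sq L k a M) {n : ℕ} (hn : n ≤ M) (σ : Gal(L/ℚ)) {z : L} (hz : z ∈ R L k a n) : σ z ∈ R L k a n := by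
  rw [mem_R h hn] at hz ⊢
  have := map_F (σ : L →+* L) k n z
  rw [hz] at this
  simp at this
  exact this.symm

/-- nonsquare conditions -/
def NS (k a : ℤ) : Prop := ¬ IsSquare (a - k) ∧ ∀ m, 2 ≤ m → ¬ IsSquare (c k m - a)

lemma NS.ne (h : NS k a) : ∀ m, 1 ≤ m → c k m ≠ a := by
  intro m hm he
  rcases hm.eq_or_lt with rfl | hm
  · rw [c_one] at he; exact h.1 ⟨0, by rw [he]; ring⟩
  · exact h.2 m hm ⟨0, by rw [he]; ring⟩

lemma isSquare_of_rat {d : ℤ} {s : ℚ} (h : s ^ 2 = d) : IsSquare d := by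
  have : IsSquare (d : ℚ) := ⟨s, by rw [← h, pow_two]⟩
  exact Rat.isSquare_intCast_iff.mp this

theorem trans (h : Sq L k a M) (hns : NS k a) {n : ℕ} (hn : n ≤ M) {z w : L} (hz : z ∈ R L k a n) (hw : w ∈ R L k a n) :
    ∃ σ : Gal(L/ℚ), σ z = w := by
  induction n generalizing z w with
  | zero => 
    simp only [R, Finset.mem_singleton] at hz hw
    exact ⟨1, by rw [hz, hw]; rfl⟩
  | succ n ih =>
    have hc := hns.ne
    -- suffices to find σ with σ z = -z
    suffices hneg : ∃ σ : Gal(L/ℚ), σ z = -z by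
      obtain ⟨τ, hτ⟩ := ih (by omega) (F_mem h hn hz) (F_mem h hn hw)
      rw [sig_F] at hτ
      obtain ⟨σ, hσ⟩ := hneg
      rcases F_eq hτ with e | e
      · exact ⟨τ, e.symm⟩
      · exact ⟨τ * σ, by rw [AlgEquiv.mul_apply, hσ, map_neg, e]⟩
    by_contra hneg
    push Not at hneg
    set O : Finset L := Finset.univ.image (fun σ : Gal(L/ℚ) => σ z) with hO
    have hinj : Set.InjOn (F k) (O : Set L) := by
      intro u hu v hv he
      simp only [hO, Finset.coe_image, Finset.coe_univ, Set.image_univ, Set.mem_range] at hu hv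
      obtain ⟨σ, rfl⟩ := hu
      obtain ⟨τ, rfl⟩ := hv
      rcases F_eq he with e | e
      · exact e.symm
      · exfalso
        apply hneg (σ⁻¹ * τ)
        rw [AlgEquiv.mul_apply, e, map_neg]
        congr 1
        exact σ.symm_apply_apply z
    have himg : O.image (F k) = R L k a n := by
      ext y
      simp only [hO, Finset.mem_image, Finset.mem_univ, true_and]
      constructor
      · rintro ⟨_, ⟨σ, rfl⟩, rfl⟩
        exact F_mem h hn (sig_mem h hn σ hz)
      · intro hy
        obtain ⟨σ, hσ⟩ := ih (by omega) (F_mem h hn hz) hy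
        exact ⟨σ z, ⟨σ, rfl⟩, by rw [← sig_F, hσ]⟩
    set s := ∏ u ∈ O, u with hs
    have hfix : ∀ τ : Gal(L/ℚ), τ s = s := by
      intro τ
      rw [hs, map_prod]
      refine Finset.prod_bij (fun u _ => τ u) ?_ ?_ ?_ ?_
      · intro u hu
        obtain ⟨σ, -, rfl⟩ := Finset.mem_image.mp hu
        exact Finset.mem_image.mpr ⟨τ * σ, Finset.mem_univ _, rfl⟩
      · intro u _ v _ he; exact τ.injective he
      · intro u hu
        obtain ⟨σ, -, rfl⟩ := Finset.mem_image.mp hu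
        exact ⟨(τ⁻¹ * σ) z, Finset.mem_image.mpr ⟨τ⁻¹ * σ, Finset.mem_univ _, rfl⟩, τ.apply_symm_apply _⟩
      · intro u _; rfl
    have hs2 : s ^ 2 = ((if n = 0 then a - k else c k (n+1) - a : ℤ) : L) := by
      rw [← prod_sub_k h hc (by omega : n ≤ M), ← himg, Finset.prod_image hinj, hs, ← Finset.prod_pow]
      refine Finset.prod_congr rfl fun u _ => by simp [F]
    obtain ⟨t, ht⟩ := (IsGalois.mem_bot_iff_fixed (F := ℚ) (E := L) s).mpr hfix |> IntermediateField.mem_bot.mp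
    have hsq : IsSquare (if n = 0 then a - k else c k (n+1) - a : ℤ) := by
      apply isSquare_of_rat (s := t)
      apply (algebraMap ℚ L).injective
      rw [map_pow, ht, hs2, map_intCast]
    split_ifs at hsq with h0
    · exact hns.1 hsq
    · exact hns.2 (n+1) (by omega) hsq

lemma pow_fix (h : Sq L k a M) {n : ℕ} (hn : n ≤ M) (σ : Gal(L/ℚ)) {z : L} (hz : z ∈ R L k a n) : (σ ^ 2 ^ n) z = z := by
  induction n generalizing z with
  | zero => 
    simp only [R, Finset.mem_singleton] at hz
    rw [hz]; simp
  | succ n ih =>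
    have h1 := ih (by omega) (F_mem h hn hz)
    rw [sig_F] at h1
    rw [pow_succ, pow_mul, pow_two, AlgEquiv.mul_apply]
    rcases F_eq h1 with e | e
    · rw [← e, ← e]
    · have e' : (σ ^ 2 ^ n) z = -z := by
        conv_rhs => rw [e]
        rw [neg_neg]
      rw [e', map_neg, e', neg_neg]

/-- generation -/
def Gen (L : Type*) [Field L] [NumberField L] (k a : ℤ) (M : ℕ) : Prop :=
  ∀ σ : Gal(L/ℚ), (∀ z ∈ R L k a M, σ z = z) → σ = 1

lemma isPGroup (h : Sq L k a M) (hg : Gen L k a M) : IsPGroup 2 Gal(L/ℚ) := by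
  intro σ
  exact ⟨M, hg _ fun z hz => pow_fix h le_rfl σ hz⟩
end Tree

namespace Tree
open NumberField
open scoped Classical Pointwise

variable {L : Type*} [Field L] [NumberField L] [IsGalois ℚ L] {k a : ℤ} {M : ℕ}

instance perfect_res (p : Ideal ℤ) [hp : p.IsPrime] : PerfectField p.ResidueField := by
  by_cases h0 : p = ⊥
  · have : CharZero p.ResidueField := by
      subst h0
      have hinj : Function.Injective (algebraMap ℤ (Ideal.ResidueField (⊥ : Ideal ℤ))) := by
        rw [injective_iff_map_eq_zero]
        intro x hx
        rw [Ideal.algebraMap_residueField_eq_zero] at hx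
        simpa using hx
      exact charZero_of_injective_algebraMap hinj
    infer_instance
  · have hm : p.IsMaximal := hp.isMaximal h0
    have : Finite (ℤ ⧸ p) := Ideal.finiteQuotientOfFreeOfNeBot p h0
    have : Finite p.ResidueField := Finite.of_surjective _ (Ideal.bijective_algebraMap_quotient_residueField p).2
    infer_instance

lemma exists_inertia {q : ℕ} (hq : q.Prime) {Q : Ideal (𝓞 L)} [hQ : Q.IsPrime] (hqQ : (q : 𝓞 L) ∈ Q)
    {e : ℕ} (he : emultiplicity Q (Ideal.span {(q : 𝓞 L)}) = e) (he1 : e ≠ 1) :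
    ∃ τ : Gal(L/ℚ), τ ≠ 1 ∧ ∀ x : 𝓞 L, τ • x - x ∈ Q := by
  set p := Q.under ℤ with hp
  have hps : p = Ideal.span {(q : ℤ)} := by
    have hm : (Ideal.span {(q:ℤ)}).IsMaximal := PrincipalIdealRing.isMaximal_of_irreducible (Nat.prime_iff_prime_int.mp hq).irreducible
    refine (hm.eq_of_le (Ideal.IsPrime.ne_top inferInstance) ?_).symm
    rw [Ideal.span_singleton_le_iff_mem, hp, Ideal.under_def, Ideal.mem_comap]
    simpa using hqQ
  have hmap : p.map (algebraMap ℤ (𝓞 L)) = Ideal.span {(q : 𝓞 L)} := by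
    rw [hps, Ideal.map_span]; simp
  have h1 := Ideal.card_inertia_eq_ramificationIdxIn (G := Gal(L/ℚ)) p Q
  rw [Ideal.ramificationIdxIn_eq_ramificationIdx p Q Gal(L/ℚ), Ideal.IsDedekindDomain.ramificationIdx_eq_multiplicity p, hmap,
    multiplicity_eq_of_emultiplicity_eq_some he] at h1
  · have h2 : Q.inertia Gal(L/ℚ) ≠ ⊥ := by
      intro h
      rw [h] at h1
      simp at h1
      exact he1 h1.symm
    obtain ⟨⟨τ,hτ⟩,hne⟩ := Subgroup.ne_bot_iff_exists_ne_one.mp h2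
    exact ⟨τ, fun h => hne (Subtype.ext h), fun x => hτ x⟩
  · rw [hmap, Ne, Ideal.span_singleton_eq_bot]
    exact_mod_cast hq.ne_zero

end Tree

namespace Tree
open NumberField
open scoped Classical Pointwise

variable {L : Type*} [Field L] [NumberField L] [IsGalois ℚ L] {k a : ℤ} {M : ℕ}

noncomputable def toO (z : L) : 𝓞 L := if h : ∃ x : 𝓞 L, algebraMap (𝓞 L) L x = z then h.choose else 0

lemma toO_coe {z : L} (h : IsIntegral ℤ z) : algebraMap (𝓞 L) L (toO z) = z := by
  have h' : ∃ x : 𝓞 L, algebraMap (𝓞 L) L x = z := ⟨⟨z, h⟩, rfl⟩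
  rw [toO, dif_pos h']
  exact h'.choose_spec

lemma toO_ext {x y : 𝓞 L} (h : algebraMap (𝓞 L) L x = algebraMap (𝓞 L) L y) : x = y :=
  RingOfIntegers.coe_injective h

lemma integral_R (h : Sq L k a M) {n : ℕ} (hn : n ≤ M) {z : L} (hz : z ∈ R L k a n) : IsIntegral ℤ z := by
  have key : ∀ n : ℕ, ∀ z : L, (F k)^[n] z = (a:L) → IsIntegral ℤ z := by
    intro n
    induction n with
    | zero => intro z hz; simp at hz; rw [hz]; exact isIntegral_algebraMap (R := ℤ) (A := L) (x := a)
    | succ n ih =>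
      intro z hz
      rw [Function.iterate_succ_apply] at hz
      have h1 := ih _ hz
      have h2 : IsIntegral ℤ (z ^ 2) := by
        have : z ^ 2 = F k z - (k:L) := by simp [F]
        rw [this]
        exact h1.sub (isIntegral_algebraMap (R := ℤ) (A := L) (x := k))
      exact IsIntegral.of_pow (by norm_num) h2
  exact key n z ((mem_R h hn z).mp hz)

lemma int_mem {q : ℕ} (hq : q.Prime) {Q : Ideal (𝓞 L)} [hQ : Q.IsPrime] (hqQ : (q : 𝓞 L) ∈ Q) {d : ℤ}
    (hd : (d : 𝓞 L) ∈ Q) : (q:ℤ) ∣ d := by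
  by_contra h
  have hco : IsCoprime (q:ℤ) d := (Prime.coprime_iff_not_dvd (Nat.prime_iff_prime_int.mp hq)).mpr h
  obtain ⟨u, v, huv⟩ := hco
  apply hQ.ne_top
  rw [Ideal.eq_top_iff_one]
  have : (1 : 𝓞 L) = (u : 𝓞 L) * q + v * d := by exact_mod_cast congrArg (Int.cast : ℤ → 𝓞 L) huv.symm
  rw [this]
  exact Q.add_mem (Q.mul_mem_left _ hqQ) (Q.mul_mem_left _ hd)

lemma prod_toO (h : Sq L k a M) (hc : ∀ m, 1 ≤ m → c k m ≠ a) {n : ℕ} (hn : n + 1 ≤ M) :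
    ∏ z ∈ R L k a (n+1), toO z = ((c k (n+1) - a : ℤ) : 𝓞 L) := by
  apply toO_ext
  rw [map_prod]
  have := prod_z h hc hn
  rw [map_intCast, ← this]
  exact Finset.prod_congr rfl fun z hz => toO_coe (integral_R h hn hz)

def OddVal (q : ℕ) (d : ℤ) : Prop := ∃ (v : ℕ) (m : ℤ), Odd v ∧ ¬ (q:ℤ) ∣ m ∧ d = q ^ v * m

def Good (k a : ℤ) (n : ℕ) : Prop := ∃ q : ℕ, q.Prime ∧ q ≠ 2 ∧ (∀ i, 1 ≤ i → i ≤ n → ¬ (q:ℤ) ∣ c k i - a) ∧ OddVal q (c k (n+1) - a)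

lemma congr_eq (h : Sq L k a M) (hc : ∀ m, 1 ≤ m → c k m ≠ a) {n : ℕ} (hn : n + 1 ≤ M)
    {q : ℕ} (hq : q.Prime) (hq2 : q ≠ 2) (hi : ∀ i, 1 ≤ i → i ≤ n → ¬ (q:ℤ) ∣ c k i - a)
    {Q : Ideal (𝓞 L)} [hQ : Q.IsPrime] (hqQ : (q : 𝓞 L) ∈ Q) : ∀ m : ℕ, m ≤ n + 1 → ∀ z ∈ R L k a m, ∀ z' ∈ R L k a m,
    toO z - toO z' ∈ Q → z ≠ z' → m = n + 1 ∧ z' = - z ∧ toO z ∈ Q := by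
  intro m
  induction m with
  | zero =>
    intro _ z hz z' hz' _ hne
    rw [mem_R h (by omega)] at hz hz'
    simp at hz hz'
    exact absurd (hz.trans hz'.symm) hne
  | succ m ih =>
    intro hm z hz z' hz' hQz hne
    have hzi := integral_R h (by omega) hz
    have hzi' := integral_R h (by omega) hz'
    have hF := F_mem h (by omega) hz
    have hF' := F_mem h (by omega) hz'
    have hFi := integral_R h (by omega) hF
    have hFi' := integral_R h (by omega) hF'
    have e1 : toO (F k z) - toO (F k z') = (toO z + toO z') * (toO z - toO z') := by
      apply toO_ext
      simp only [map_sub, map_mul, map_add, toO_coe hzi, toO_coe hzi', toO_coe hFi, toO_coe hFi']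
      simp only [F]
      ring
    have e2 : F k z = F k z' := by
      by_contra hne'
      have := ih (by omega) _ hF _ hF' (by rw [e1]; exact Q.mul_mem_left _ hQz) hne'
      omega
    have e3 : z' = -z := (F_eq e2).resolve_left (fun h => hne h.symm)
    have e4 : toO z - toO z' = ((2:ℤ) : 𝓞 L) * toO z := by
      apply toO_ext
      rw [map_sub, map_mul, toO_coe hzi, toO_coe hzi', e3, map_intCast]
      push_cast
      ring
    rw [e4] at hQz
    have e5 : toO z ∈ Q := by
      rcases hQ.mem_or_mem hQz with h2 | h2
      · exfalso
        have := int_mem hq hqQ h2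
        apply hq2
        exact (Nat.prime_dvd_prime_iff_eq hq Nat.prime_two).mp (by exact_mod_cast this)
      · exact h2
    refine ⟨?_, e3, e5⟩
    by_contra hmn
    apply hi (m+1) (by omega) (by omega)
    apply int_mem hq hqQ
    rw [← prod_toO h hc (by omega)]
    exact Ideal.mem_of_dvd _ (Finset.dvd_prod_of_mem _ hz) e5

theorem transposition (h : Sq L k a M) (hc : ∀ m, 1 ≤ m → c k m ≠ a) {n : ℕ} (hn : n + 1 ≤ M) (hgen : Gen L k a (n+1))
    (hgood : Good k a n) : ∃ z₀ ∈ R L k a (n+1), ∃ τ : Gal(L/ℚ), τ z₀ = - z₀ ∧ ∀ z ∈ R L k a (n+1), z ≠ z₀ → z ≠ -z₀ → τ z = z := by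
  obtain ⟨q, hq, hq2, hi, v, m, hv, hm, hd⟩ := hgood
  obtain ⟨Q, hQ, hqQ⟩ := DensB.exists_prime_over (L := L) hq
  have hintg : ∀ z ∈ R L k a (n+1), IsIntegral ℤ z := fun z hz => integral_R h hn hz
  have hdQ : ((c k (n+1) - a : ℤ) : 𝓞 L) ∈ Q := by
    rw [hd]
    push_cast
    exact Q.mul_mem_right _ (Ideal.pow_mem_of_mem _ hqQ _ hv.pos)
  obtain ⟨z₀, hz₀, hz₀Q⟩ : ∃ z ∈ R L k a (n+1), toO z ∈ Q := by
    rw [← prod_toO h hc hn] at hdQ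
    exact (hQ.prod_mem_iff).mp hdQ
  have hneg : toO (-z₀) = - toO z₀ := by
    apply toO_ext
    rw [map_neg, toO_coe (hintg _ hz₀), toO_coe (hintg _ (neg_mem h hn hz₀))]
  have hcong := congr_eq h hc hn hq hq2 hi hqQ (n+1) le_rfl
  have hpm : ∀ z ∈ R L k a (n+1), toO z ∈ Q → z = z₀ ∨ z = -z₀ := by
    intro z hz hzQ
    by_cases he : z₀ = z
    · exact Or.inl he.symm
    · exact Or.inr (hcong _ hz₀ _ hz (Q.sub_mem hz₀Q hzQ) he).2.1
  have hz0 : z₀ ≠ 0 := fun h0 => zero_notMem h hc hn (h0 ▸ hz₀)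
  have hne : z₀ ≠ -z₀ := fun he => hz0 (by linear_combination he / 2)
  have hq0 : (q : 𝓞 L) ≠ 0 := by exact_mod_cast hq.ne_zero
  have hQ0 : Q ≠ ⊥ := fun hb => hq0 (by rw [hb] at hqQ; simpa using hqQ)
  have hQp : Prime Q := Ideal.prime_of_isPrime hQ0 hQ
  have hmz : ∀ x : 𝓞 L, x ∉ Q → emultiplicity Q (Ideal.span {x}) = 0 := by
    intro x hx
    rw [emultiplicity_eq_zero, Ideal.dvd_span_singleton]; exact hx
  have hsp : Ideal.span {(q : 𝓞 L)} ≠ 0 := by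
    rw [Ideal.zero_eq_bot, Ne, Ideal.span_singleton_eq_bot]; exact hq0
  have hz0s : Ideal.span {toO z₀} ≠ 0 := by
    rw [Ideal.zero_eq_bot, Ne, Ideal.span_singleton_eq_bot]
    intro h0
    apply hz0
    rw [← toO_coe (hintg _ hz₀), h0]; rfl
  obtain ⟨e, he⟩ := ENat.ne_top_iff_exists.mp (finiteMultiplicity_iff_emultiplicity_ne_top.mp (FiniteMultiplicity.of_prime_left hQp hsp))
  obtain ⟨μ, hμ⟩ := ENat.ne_top_iff_exists.mp (finiteMultiplicity_iff_emultiplicity_ne_top.mp (FiniteMultiplicity.of_prime_left hQp hz0s))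
  have hA : emultiplicity Q (Ideal.span {((c k (n+1) - a : ℤ) : 𝓞 L)}) = (v * e : ℕ) := by
    rw [hd]
    push_cast
    rw [← Ideal.span_singleton_mul_span_singleton, ← Ideal.span_singleton_pow, emultiplicity_mul hQp, emultiplicity_pow hQp, ← he, hmz (m : 𝓞 L) (fun hmQ => hm (int_mem hq hqQ hmQ))]
    simp
  have hB : emultiplicity Q (Ideal.span {((c k (n+1) - a : ℤ) : 𝓞 L)}) = (μ + μ : ℕ) := by
    rw [← prod_toO h hc hn, ← Ideal.prod_span_singleton, Finset.emultiplicity_prod hQp]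
    have hsub : ({z₀, -z₀} : Finset L) ⊆ R L k a (n+1) := by
      intro z hz
      simp only [Finset.mem_insert, Finset.mem_singleton] at hz
      rcases hz with rfl | rfl
      · exact hz₀
      · exact neg_mem h hn hz₀
    rw [← Finset.sum_subset hsub, Finset.sum_pair hne, hneg, Ideal.span_singleton_neg, ← hμ]
    · push_cast; rfl
    · intro z hz hz'
      apply hmz
      intro hzQ
      apply hz'
      simpa using hpm z hz hzQ
  have hve : v * e = μ + μ := by
    rw [hA] at hB; exact_mod_cast hB
  have he1 : e ≠ 1 := by
    rintro rfl
    obtain ⟨w, rfl⟩ := hv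
    omega
  obtain ⟨τ, hτ1, hτ⟩ := exists_inertia hq hqQ he.symm he1
  have hmove : ∀ z ∈ R L k a (n+1), τ z ≠ z → τ z = -z ∧ (z = z₀ ∨ z = -z₀) := by
    intro z hz hne'
    have hτz := sig_mem h hn τ hz
    have e1 : toO (τ z) = τ • toO z := by
      apply toO_ext
      rw [toO_coe (hintg _ hτz)]
      have := DensB.smul_coe τ (toO z)
      refine Eq.trans ?_ this.symm
      exact congrArg τ (toO_coe (hintg _ hz)).symm
    have h1 := hτ (toO z)
    rw [← e1, ← neg_mem_iff, neg_sub] at h1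
    have := hcong z hz _ hτz h1 hne'.symm
    exact ⟨this.2.1, hpm z hz this.2.2⟩
  obtain ⟨z, hz, hzne⟩ : ∃ z ∈ R L k a (n+1), τ z ≠ z := by
    by_contra! hcon
    exact hτ1 (hgen τ hcon)
  refine ⟨z₀, hz₀, τ, ?_, ?_⟩
  · obtain ⟨h1, h2 | h2⟩ := hmove z hz hzne
    · rw [← h2]; exact h1
    · rw [h2, map_neg] at h1; exact neg_injective h1
  · intro w hw hw1 hw2
    by_contra hcon
    rcases (hmove w hw hcon).2 with h3 | h3
    · exact hw1 h3
    · exact hw2 h3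

end Tree

namespace Tree
open NumberField
open scoped Classical Pointwise

variable {L : Type*} [Field L] [NumberField L] [IsGalois ℚ L] {k a : ℤ} {M : ℕ}

lemma transposition_lift (h : Sq L k a M) (hc : ∀ m, 1 ≤ m → c k m ≠ a) {n : ℕ} (hn : n + 1 ≤ M)
    (hgood : Good k a n) : ∃ z₀ ∈ R L k a (n+1), ∃ τ : Gal(L/ℚ), τ z₀ = - z₀ ∧ ∀ z ∈ R L k a (n+1), z ≠ z₀ → z ≠ -z₀ → τ z = z := by
  let E : IntermediateField ℚ L := IntermediateField.adjoin ℚ (R L k a (n+1) : Set L)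
  have hE : E = IntermediateField.adjoin ℚ (R L k a (n+1) : Set L) := rfl
  clear_value E
  have hnorm : Normal ℚ E := by
    have hinst : (DivisionRing.toRatAlgebra : Algebra ℚ E) = IntermediateField.algebra' E := Subsingleton.elim _ _
    rw [hinst]
    rw [IntermediateField.normal_iff_forall_map_le']
    intro σ
    conv_lhs => rw [hE]
    rw [IntermediateField.adjoin_map, IntermediateField.adjoin_le_iff]
    rintro _ ⟨z, hz, rfl⟩
    rw [hE]
    exact IntermediateField.subset_adjoin _ _ (sig_mem h hn σ hz)
  have : IsGalois ℚ E := ⟨⟩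
  have hsub : ∀ d j : ℕ, j + d = n + 1 → ∀ z ∈ R L k a j, z ∈ E := by
    intro d
    induction d with
    | zero =>
      rintro j rfl z hz
      rw [hE]
      exact IntermediateField.subset_adjoin _ _ hz
    | succ d ih =>
      intro j hj z hz
      have h1 := sq_mem h (n := j) (by omega) hz
      have h2 := ih (j+1) (by omega) _ h1.1
      rw [← h1.2, F]
      exact E.add_mem (_root_.pow_mem h2 2) (E.intCast_mem k)
  have hco : ∀ (j : ℕ) (y : E), ((F k)^[j] y : E) = ((F k)^[j] (y : L) : L) := fun j y => map_F (algebraMap E L) k j y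
  have hco' : ∀ (j : ℕ) (y : E), (F k)^[j] y = (a : E) ↔ (F k)^[j] (y : L) = (a : L) := by
    intro j y
    rw [← hco, ← Subtype.coe_inj]
    simp
  have hSq : Sq E k a (n+1) := by
    intro m hm y hy
    rw [hco'] at hy
    obtain ⟨z, hz⟩ := h m (by omega) y hy
    have hzR : z ∈ R L k a (m+1) := by
      rw [mem_R h (by omega), Function.iterate_succ_apply, F, hz]
      simpa using hy
    refine ⟨⟨z, hsub (n - m) (m+1) (by omega) z hzR⟩, ?_⟩
    apply Subtype.ext
    simpa using hz
  have hmemE : ∀ y : E, y ∈ R E k a (n+1) ↔ (y : L) ∈ R L k a (n+1) := by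
    intro y
    rw [mem_R hSq le_rfl, mem_R h hn, hco']
  have hgen : Gen E k a (n+1) := by
    intro σ hσ
    have key : ∀ x : L, x ∈ IntermediateField.adjoin ℚ (R L k a (n+1) : Set L) → ∃ hx : x ∈ E, σ ⟨x, hx⟩ = ⟨x, hx⟩ := by
      intro x hx
      induction hx using IntermediateField.adjoin_induction with
      | mem x hx => exact ⟨hsub 0 (n+1) rfl x hx, hσ _ ((hmemE _).mpr hx)⟩
      | algebraMap r =>
        refine ⟨E.algebraMap_mem r, ?_⟩
        have : (⟨algebraMap ℚ L r, E.algebraMap_mem r⟩ : E) = (r : E) := by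
          apply Subtype.ext; simp
        rw [this, map_ratCast]
      | add x y _ _ hx hy =>
        obtain ⟨hx, ex⟩ := hx
        obtain ⟨hy, ey⟩ := hy
        refine ⟨E.add_mem hx hy, ?_⟩
        have := map_add σ (⟨x, hx⟩ : E) ⟨y, hy⟩
        rw [ex, ey] at this
        exact this
      | mul x y _ _ hx hy =>
        obtain ⟨hx, ex⟩ := hx
        obtain ⟨hy, ey⟩ := hy
        refine ⟨E.mul_mem hx hy, ?_⟩
        have := map_mul σ (⟨x, hx⟩ : E) ⟨y, hy⟩
        rw [ex, ey] at this
        exact this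
      | inv x _ hx =>
        obtain ⟨hx, ex⟩ := hx
        refine ⟨E.inv_mem hx, ?_⟩
        have := map_inv₀ σ (⟨x, hx⟩ : E)
        rw [ex] at this
        exact this
    ext x
    obtain ⟨hx, e⟩ := key x (hE ▸ x.2)
    exact congrArg _ e
  obtain ⟨z₀, hz₀, τ, h1, h2⟩ := transposition hSq hc le_rfl hgen hgood
  refine ⟨z₀, (hmemE _).mp hz₀, τ.liftNormal L, ?_, ?_⟩
  · have := AlgEquiv.liftNormal_commutes τ L z₀
    rw [h1] at this
    simpa using this
  · intro z hz hz1 hz2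
    have hzE : z ∈ E := hsub 0 (n+1) rfl z hz
    have := AlgEquiv.liftNormal_commutes τ L ⟨z, hzE⟩
    rw [h2 ⟨z, hzE⟩ ((hmemE _).mpr hz) (fun he => hz1 (by rw [← he])) (fun he => hz2 (by
      have := congrArg (algebraMap E L) he
      simpa using this))] at this
    simpa using this

lemma transposition_at (h : Sq L k a M) (hns : NS k a) {n : ℕ} (hn : n + 1 ≤ M)
    (hgood : Good k a n) {y : L} (hy : y ∈ R L k a n) : ∃ τ : Gal(L/ℚ), ∀ z ∈ R L k a (n+1), τ z = if F k z = y then -z else z := by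
  obtain ⟨z₀, hz₀, τ, h1, h2⟩ := transposition_lift h hns.ne hn hgood
  obtain ⟨σ, hσ⟩ := trans h hns (n := n) (by omega) (F_mem h hn hz₀) hy
  refine ⟨σ * τ * σ⁻¹, fun z hz => ?_⟩
  have hcan : ∀ x : L, σ (σ⁻¹ x) = x := fun x => by
    rw [← AlgEquiv.mul_apply, mul_inv_cancel, AlgEquiv.one_apply]
  have hcan' : ∀ x : L, σ⁻¹ (σ x) = x := fun x => by
    rw [← AlgEquiv.mul_apply, inv_mul_cancel, AlgEquiv.one_apply]
  have hw : σ⁻¹ z ∈ R L k a (n+1) := sig_mem h hn σ⁻¹ hz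
  rw [AlgEquiv.mul_apply, AlgEquiv.mul_apply]
  split_ifs with hF
  · have : F k z₀ = F k (σ⁻¹ z) := by
      rw [← sig_F, hF, ← hσ, hcan']
    have hneg : τ (σ⁻¹ z) = - σ⁻¹ z := by
      rcases F_eq this with e | e
      · rw [e, h1]
      · rw [e, map_neg, h1]
    rw [hneg, map_neg, hcan]
  · rw [h2 _ hw, hcan]
    · intro e
      apply hF
      rw [← hσ, ← e, ← sig_F, hcan]
    · intro e
      apply hF
      have : F k z₀ = F k (σ⁻¹ z) := by rw [e]; simp [F]
      rw [← hσ, this, ← sig_F, hcan]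

lemma exists_flip (h : Sq L k a M) (hns : NS k a) {n : ℕ} (hn : n + 1 ≤ M)
    (hgood : Good k a n) (S : Finset L) (hS : S ⊆ R L k a n) :
    ∃ τ : Gal(L/ℚ), ∀ z ∈ R L k a (n+1), τ z = if F k z ∈ S then -z else z := by
  induction S using Finset.induction_on with
  | empty => exact ⟨1, by simp⟩
  | insert y S hyS ih =>
    obtain ⟨τ, hτ⟩ := ih ((Finset.subset_insert _ _).trans hS)
    obtain ⟨τ', hτ'⟩ := transposition_at h hns hn hgood (hS (Finset.mem_insert_self y S))
    refine ⟨τ' * τ, fun z hz => ?_⟩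
    rw [AlgEquiv.mul_apply, hτ z hz]
    by_cases h1 : F k z ∈ S
    · have h2 : F k z ≠ y := fun e => hyS (e ▸ h1)
      simp [h1, hτ' z hz, h2]
    · by_cases h2 : F k z = y
      · simp [h1, hτ' z hz, h2, h2 ▸ h1]
      · simp [h1, hτ' z hz, h2]

end Tree

namespace Tree
open NumberField
open scoped Classical Pointwise

variable {L : Type*} [Field L] [NumberField L] [IsGalois ℚ L] {k a : ℤ} {M : ℕ}

noncomputable def fixR (k a : ℤ) (n : ℕ) (σ : Gal(L/ℚ)) : Finset L := (R L k a n).filter (fun z => σ z = z)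

variable (L) in
noncomputable def Fx (k a : ℤ) (n : ℕ) : Finset Gal(L/ℚ) := Finset.univ.filter (fun σ => ∃ z ∈ R L k a n, σ z = z)

lemma Fx_mono (h : Sq L k a M) {n : ℕ} (hn : n + 1 ≤ M) : Fx L k a (n+1) ⊆ Fx L k a n := by
  intro σ hσ
  simp only [Fx, Finset.mem_filter, Finset.mem_univ, true_and] at hσ ⊢
  obtain ⟨z, hz, e⟩ := hσ
  exact ⟨F k z, F_mem h hn hz, by rw [sig_F, e]⟩

lemma burnside (h : Sq L k a M) (hns : NS k a) {n : ℕ} (hn : n ≤ M) :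
    ∑ σ : Gal(L/ℚ), (fixR k a n σ).card = Fintype.card Gal(L/ℚ) := by
  have h1 := Finset.sum_card_bipartiteAbove_eq_sum_card_bipartiteBelow (s := (Finset.univ : Finset Gal(L/ℚ))) (t := R L k a n) (fun σ z => σ z = z)
  simp only [Finset.bipartiteAbove, Finset.bipartiteBelow] at h1
  simp only [fixR]
  rw [h1]
  have hne : (R L k a n).Nonempty := by
    rw [← Finset.card_pos, card_R h hns.ne hn]; positivity
  obtain ⟨z₀, hz₀⟩ := hne
  have h2 := Finset.card_eq_sum_card_fiberwise (s := (Finset.univ : Finset Gal(L/ℚ))) (t := R L k a n) (f := fun σ => σ z₀) (fun σ _ => sig_mem h hn σ hz₀)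
  rw [← Finset.card_univ, h2]
  refine Finset.sum_congr rfl fun z hz => ?_
  obtain ⟨ρ, hρ⟩ := trans h hns hn hz₀ hz
  refine Finset.card_bij (fun σ _ => σ * ρ) ?_ ?_ ?_
  · intro σ hσ
    simp only [Finset.mem_filter, Finset.mem_univ, true_and] at hσ ⊢
    rw [AlgEquiv.mul_apply, hρ, hσ]
  · intro σ _ σ' _ e
    exact mul_right_cancel e
  · intro σ hσ
    simp only [Finset.mem_filter, Finset.mem_univ, true_and] at hσ ⊢
    refine ⟨σ * ρ⁻¹, ?_, by group⟩
    have : ρ⁻¹ z = z₀ := by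
      rw [← hρ, ← AlgEquiv.mul_apply, inv_mul_cancel, AlgEquiv.one_apply]
    rw [AlgEquiv.mul_apply, this, hσ]

lemma markov (h : Sq L k a M) (hns : NS k a) {n : ℕ} (hn : n ≤ M) (B : ℕ) :
    (Finset.univ.filter (fun σ : Gal(L/ℚ) => B < (fixR k a n σ).card)).card * B ≤ Fintype.card Gal(L/ℚ) := by
  rw [← burnside h hns hn]
  calc _ ≤ ∑ σ ∈ Finset.univ.filter (fun σ : Gal(L/ℚ) => B < (fixR k a n σ).card), (fixR k a n σ).card := by
        rw [← smul_eq_mul]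
        apply Finset.card_nsmul_le_sum
        intro σ hσ
        simp at hσ
        omega
    _ ≤ _ := Finset.sum_le_sum_of_subset (Finset.subset_univ _)

lemma flip_count (h : Sq L k a M) (hns : NS k a) {n : ℕ} (hn : n + 1 ≤ M) (hgood : Good k a n) (B : ℕ) :
    (Finset.univ.filter (fun σ : Gal(L/ℚ) => 0 < (fixR k a n σ).card ∧ (fixR k a n σ).card ≤ B)).card ≤ 2 ^ B * (Fx L k a n \ Fx L k a (n+1)).card := by
  choose! τ hτ using exists_flip h hns hn hgood
  let S : Gal(L/ℚ) → Finset L := fun σ => (R L k a n).filter (fun y => ∃ z ∈ R L k a (n+1), F k z = y ∧ σ z = z)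
  have hS : ∀ σ, S σ ⊆ R L k a n := fun σ y hy => by simp only [S, Finset.mem_filter] at hy; exact hy.1
  have hSm : ∀ σ y, y ∈ S σ ↔ y ∈ R L k a n ∧ ∃ z ∈ R L k a (n+1), F k z = y ∧ σ z = z := fun σ y => by simp only [S, Finset.mem_filter]
  have hτR : ∀ T ⊆ R L k a n, ∀ y ∈ R L k a n, τ T y = y := by
    intro T hT y hy
    obtain ⟨h1, h2⟩ := sq_mem h hn hy
    have : F k (τ T (sq k y)) = F k (sq k y) := by
      rw [hτ T hT _ h1]
      split_ifs
      · simp [F]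
      · rfl
    rw [← h2, sig_F, this]
  have hfix : ∀ σ, fixR k a n (τ (S σ) * σ) = fixR k a n σ := by
    intro σ
    refine Finset.filter_congr fun y hy => ?_
    rw [AlgEquiv.mul_apply, hτR _ (hS σ) _ (sig_mem h (by omega) σ hy)]
  refine Finset.card_le_mul_card_image_of_maps_to (f := fun σ => τ (S σ) * σ) ?_ _ ?_
  · intro σ hσ
    simp only [Finset.mem_filter, Finset.mem_univ, true_and] at hσ
    rw [Finset.mem_sdiff]
    constructor
    · have h1 := hσ.1
      rw [← hfix, Finset.card_pos] at h1
      obtain ⟨y, hy⟩ := h1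
      simp only [fixR, Finset.mem_filter] at hy
      simp only [Fx, Finset.mem_filter, Finset.mem_univ, true_and]
      exact ⟨y, hy.1, hy.2⟩
    · simp only [Fx, Finset.mem_filter, Finset.mem_univ, true_and]
      rintro ⟨z, hz, e⟩
      have hσz := sig_mem h hn σ hz
      rw [AlgEquiv.mul_apply, hτ _ (hS σ) _ hσz] at e
      by_cases hm : F k (σ z) ∈ S σ
      · rw [if_pos hm] at e
        have hF : F k (σ z) = F k z := by
          conv_rhs => rw [← e]
          simp [F]
        rw [hF, hSm] at hm
        obtain ⟨_, z', hz', e1, e2⟩ := hm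
        have e3 : σ z = z := by
          rcases F_eq e1 with e4 | e4
          · rw [e4, e2]
          · rw [e4, map_neg, e2]
        rw [e3] at e
        have : z = 0 := by linear_combination -e / 2
        exact zero_notMem h hns.ne hn (this ▸ hz)
      · rw [if_neg hm] at e
        apply hm
        rw [hSm, e]
        exact ⟨F_mem h hn hz, z, hz, rfl, e⟩
  · intro ρ _
    by_cases hne : ∃ σ, (0 < (fixR k a n σ).card ∧ (fixR k a n σ).card ≤ B) ∧ τ (S σ) * σ = ρ
    · obtain ⟨σ₀, ⟨_, hB⟩, he⟩ := hne
      rw [← hfix, he] at hB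
      calc _ ≤ (fixR k a n ρ).powerset.card := by
            refine Finset.card_le_card_of_injOn S ?_ ?_
            · intro σ hσ
              simp only [Finset.coe_filter, Finset.mem_filter, Finset.mem_univ, true_and, Set.mem_setOf_eq] at hσ
              rw [Finset.mem_coe, Finset.mem_powerset, ← hσ.2, hfix]
              intro y hy
              rw [hSm] at hy
              obtain ⟨hy, z, hz, e1, e2⟩ := hy
              simp only [fixR, Finset.mem_filter]
              exact ⟨hy, by rw [← e1, sig_F, e2]⟩
            · intro σ hσ σ' hσ' e
              simp only [Finset.coe_filter, Finset.mem_filter, Finset.mem_univ, true_and, Set.mem_setOf_eq] at hσ hσ'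
              have := hσ.2.trans hσ'.2.symm
              rw [e] at this
              exact mul_left_cancel this
        _ = 2 ^ (fixR k a n ρ).card := Finset.card_powerset _
        _ ≤ 2 ^ B := Nat.pow_le_pow_right (by norm_num) hB
    · rw [Finset.filter_eq_empty_iff.mpr]
      · simp
      · intro σ hσ e
        simp only [Finset.mem_filter, Finset.mem_univ, true_and] at hσ
        exact hne ⟨σ, hσ, e⟩

lemma step_count (h : Sq L k a M) (hns : NS k a) {n : ℕ} (hn : n + 1 ≤ M) (hgood : Good k a n) (B : ℕ) :
    (B * (Fx L k a n).card : ℤ) ≤ B * 2 ^ B * ((Fx L k a n).card - (Fx L k a (n+1)).card) + Fintype.card Gal(L/ℚ) := by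
  have h1 := flip_count h hns hn hgood B
  have h2 := markov h hns (n := n) (by omega) B
  have h3 : (Fx L k a n).card ≤ (Finset.univ.filter (fun σ : Gal(L/ℚ) => 0 < (fixR k a n σ).card ∧ (fixR k a n σ).card ≤ B)).card + (Finset.univ.filter (fun σ : Gal(L/ℚ) => B < (fixR k a n σ).card)).card := by
    refine le_trans (Finset.card_le_card ?_) (Finset.card_union_le _ _)
    intro σ hσ
    simp only [Fx, Finset.mem_filter, Finset.mem_univ, true_and] at hσ
    obtain ⟨z, hz, e⟩ := hσ
    have : 0 < (fixR k a n σ).card := Finset.card_pos.mpr ⟨z, Finset.mem_filter.mpr ⟨hz, e⟩⟩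
    simp only [Finset.mem_union, Finset.mem_filter, Finset.mem_univ, true_and]
    omega
  have h4 := Finset.card_sdiff_add_card_eq_card (Fx_mono h hn)
  have h5 : ((Fx L k a n \ Fx L k a (n+1)).card : ℤ) = (Fx L k a n).card - (Fx L k a (n+1)).card := by
    rw [← h4]; push_cast; ring
  rw [← h5]
  zify at h1 h2 h3
  have hB : (0:ℤ) ≤ B := by positivity
  nlinarith [mul_le_mul_of_nonneg_left h3 hB, mul_le_mul_of_nonneg_left h1 hB]

lemma Fx_anti (h : Sq L k a M) {n m : ℕ} (hnm : n ≤ m) (hm : m ≤ M) : Fx L k a m ⊆ Fx L k a n := by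
  induction m, hnm using Nat.le_induction with
  | base => exact subset_rfl
  | succ m hnm ih => exact (Fx_mono h hm).trans (ih (by omega))

theorem fix_count (h : Sq L k a M) (hns : NS k a) (J : Finset ℕ) (hJ : ∀ n ∈ J, n < M ∧ Good k a n) (B : ℕ) :
    J.card * B * (Fx L k a M).card ≤ B * 2 ^ B * Fintype.card Gal(L/ℚ) + J.card * Fintype.card Gal(L/ℚ) := by
  have h1 : ∀ n ∈ J, (B * (Fx L k a M).card : ℤ) ≤ B * 2 ^ B * ((Fx L k a n).card - (Fx L k a (n+1)).card) + Fintype.card Gal(L/ℚ) := by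
    intro n hn
    obtain ⟨hnM, hg⟩ := hJ n hn
    refine le_trans ?_ (step_count h hns (by omega) hg B)
    have := Finset.card_le_card (Fx_anti (L := L) (k := k) (a := a) h hnM.le le_rfl)
    have : ((Fx L k a M).card : ℤ) ≤ (Fx L k a n).card := by exact_mod_cast this
    gcongr
  have h2 := Finset.sum_le_sum h1
  rw [Finset.sum_const, Finset.sum_add_distrib, Finset.sum_const, ← Finset.mul_sum] at h2
  have h3 : ∑ n ∈ J, (((Fx L k a n).card : ℤ) - (Fx L k a (n+1)).card) ≤ ∑ n ∈ Finset.range M, (((Fx L k a n).card : ℤ) - (Fx L k a (n+1)).card) := by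
    apply Finset.sum_le_sum_of_subset_of_nonneg
    · intro n hn; exact Finset.mem_range.mpr (hJ n hn).1
    · intro n hn _
      have := Finset.card_le_card (Fx_mono (L := L) (k := k) (a := a) h (n := n) (Finset.mem_range.mp hn))
      have : ((Fx L k a (n+1)).card : ℤ) ≤ (Fx L k a n).card := by exact_mod_cast this
      linarith
  rw [Finset.sum_range_sub' (fun n => ((Fx L k a n).card : ℤ))] at h3
  have h4 : ((Fx L k a 0).card : ℤ) ≤ Fintype.card Gal(L/ℚ) := by
    exact_mod_cast Finset.card_le_univ _
  have h5 : (0:ℤ) ≤ (Fx L k a M).card := by positivity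
  zify
  simp only [nsmul_eq_mul] at h2
  have h6 := mul_le_mul_of_nonneg_left (h3.trans (show _ ≤ (Fintype.card Gal(L/ℚ) : ℤ) by linarith)) (show (0:ℤ) ≤ B * 2 ^ B by positivity)
  linarith

end Tree

namespace Tree
open NumberField
open scoped Classical Pointwise

noncomputable def gpoly (k a : ℤ) (M : ℕ) : ℤ[X] := (F k)^[M] X - C a

lemma gpoly_hom {B : Type*} [CommRing B] (φ : ℤ[X] →+* B) (k a : ℤ) (M : ℕ) : φ (gpoly k a M) = (F k)^[M] (φ X) - (a : B) := by
  rw [gpoly, map_sub, map_F]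
  simp

lemma gpoly_eval (k a : ℤ) (M : ℕ) (r : ℤ) : (gpoly k a M).eval r = (F k)^[M] r - a := by
  have := gpoly_hom (evalRingHom r) k a M
  simpa using this

lemma gpoly_aeval {B : Type*} [CommRing B] [Algebra ℚ B] (k a : ℤ) (M : ℕ) (r : B) :
    aeval r ((gpoly k a M).map (Int.castRingHom ℚ)) = (F k)^[M] r - (a:B) := by
  have := gpoly_hom (((aeval r : ℚ[X] →ₐ[ℚ] B) : ℚ[X] →+* B).comp (mapRingHom (Int.castRingHom ℚ))) k a M
  simpa using this

lemma gpoly_ne (k a : ℤ) (M : ℕ) : (gpoly k a M).map (Int.castRingHom ℚ) ≠ 0 := by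
  have hd : ∀ n : ℕ, ((F k)^[n] (X : ℚ[X])).Monic ∧ ((F k)^[n] (X : ℚ[X])).natDegree = 2 ^ n := by
    intro n
    induction n with
    | zero => exact ⟨monic_X, by simp⟩
    | succ n ih =>
      rw [Function.iterate_succ_apply', F]
      have h1 : (((F k)^[n] (X : ℚ[X])) ^ 2).natDegree = 2 ^ (n+1) := by
        rw [natDegree_pow, ih.2]; ring
      have h2 : ((k : ℤ) : ℚ[X]) = C (k : ℚ) := by simp
      rw [h2]
      refine ⟨(ih.1.pow 2).add_of_left ?_, by rw [natDegree_add_C, h1]⟩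
      refine lt_of_le_of_lt degree_C_le ?_
      rw [← natDegree_pos_iff_degree_pos, h1]; positivity
  have h1 := gpoly_hom (mapRingHom (Int.castRingHom ℚ)) k a M
  simp only [coe_mapRingHom, map_X] at h1
  intro h0
  rw [h1, sub_eq_zero] at h0
  have := (hd M).2
  have h2 : ((a : ℤ) : ℚ[X]) = C (a : ℚ) := by simp
  rw [h0, h2, natDegree_C] at this
  exact absurd this (by positivity)

lemma exists_field_aux (L : Type) [Field L] [CharZero L] (A : Algebra ℚ L) (k a : ℤ) (M : ℕ)
    (hs : IsSplittingField ℚ L ((gpoly k a M).map (Int.castRingHom ℚ))) :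
    ∃ (_ : NumberField L) (_ : IsGalois ℚ L), Sq L k a M ∧ Gen L k a M := by
  have hA : A = DivisionRing.toRatAlgebra := Subsingleton.elim _ _
  subst hA
  set p := (gpoly k a M).map (Int.castRingHom ℚ) with hp
  have hfd : FiniteDimensional ℚ L := IsSplittingField.finiteDimensional L p
  have hnf : NumberField L := ⟨⟩
  have hnor : Normal ℚ L := Normal.of_isSplittingField p
  have hgal : IsGalois ℚ L := ⟨⟩
  have hSq : Sq L k a M := by
    intro n hn y hy
    let Ω := AlgebraicClosure L
    have hsurj : ∀ m : ℕ, Function.Surjective ((F k)^[m] : Ω → Ω) := by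
      intro m
      apply Function.Surjective.iterate
      intro w
      obtain ⟨z, hz⟩ := IsAlgClosed.exists_pow_nat_eq (w - (k : Ω)) (n := 2) (by norm_num)
      exact ⟨z, by rw [F, hz]; ring⟩
    obtain ⟨z, hz⟩ := IsAlgClosed.exists_pow_nat_eq (algebraMap L Ω y - (k : Ω)) (n := 2) (by norm_num)
    obtain ⟨w, hw⟩ := hsurj (M - n - 1) z
    have hroot : (F k)^[M] w = (a : Ω) := by
      have : M = n + (1 + (M - n - 1)) := by omega
      rw [this, Function.iterate_add_apply, Function.iterate_add_apply, hw]
      have : (F k)^[1] z = algebraMap L Ω y := by simp [F, hz]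
      rw [this, ← map_F, hy]; simp
    have hw2 : ∃ w' : L, algebraMap L Ω w' = w := by
      have hspl : (p.map (algebraMap ℚ L)).Splits := hs.splits
      have hae : aeval w (p.map (algebraMap ℚ L)) = 0 := by
        rw [aeval_map_algebraMap, hp, gpoly_aeval, hroot, sub_self]
      have := hspl.mem_range_of_isRoot (i := algebraMap L Ω) (x := w) (by rw [Polynomial.map_ne_zero_iff (algebraMap ℚ L).injective]; exact gpoly_ne k a M) (by
        rw [IsRoot, eval_map_algebraMap]; exact hae)
      exact this
    obtain ⟨w', hw'⟩ := hw2
    refine ⟨(F k)^[M-n-1] w', ?_⟩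
    apply (algebraMap L Ω).injective
    rw [map_pow, map_F, hw', hw, hz]
    simp
  refine ⟨hnf, hgal, hSq, ?_⟩
  · intro σ hσ
    have h1 : (σ : L →ₐ[ℚ] L) = AlgHom.id ℚ L := by
      apply AlgHom.ext_of_adjoin_eq_top hs.adjoin_rootSet
      intro x hx
      rw [mem_rootSet] at hx
      have hx2 := hx.2
      rw [hp, gpoly_aeval, sub_eq_zero] at hx2
      exact hσ x ((mem_R hSq le_rfl x).mpr hx2)
    ext x
    exact DFunLike.congr_fun h1 x

lemma exists_field (k a : ℤ) (M : ℕ) : ∃ (L : Type) (_ : Field L) (_ : NumberField L) (_ : IsGalois ℚ L), Sq L k a M ∧ Gen L k a M := by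
  let p := (gpoly k a M).map (Int.castRingHom ℚ)
  have : CharZero p.SplittingField := charZero_of_injective_algebraMap (algebraMap ℚ p.SplittingField).injective
  exact ⟨p.SplittingField, inferInstance, exists_field_aux p.SplittingField _ k a M (IsSplittingField.splittingField p)⟩

variable {L : Type*} [Field L] [NumberField L] [IsGalois ℚ L] {k a : ℤ} {M : ℕ}

lemma tree_count (h : Sq L k a M) (hgen : Gen L k a M) (hns : NS k a) : ∃ N : ℕ, ∀ᶠ x : ℕ in atTop,
    (((Finset.range (x+1)).filter (fun p : ℕ => p.Prime ∧ ∃ r : ℤ, (p:ℤ) ∣ (F k)^[M] r - a)).card : ℝ) * Nat.card Gal(L/ℚ)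
      ≤ N * Nat.card Gal(L/ℚ) + 10 * (Fx L k a M).card * (x / Real.log x) := by
  have hintg : ∀ z ∈ R L k a M, IsIntegral ℤ z := fun z hz => integral_R h le_rfl hz
  have hinj : Set.InjOn (toO : L → 𝓞 L) (R L k a M) := by
    intro x hx y hy e
    rw [← toO_coe (hintg x hx), ← toO_coe (hintg y hy), e]
  have hact : ∀ σ : Gal(L/ℚ), ∀ z ∈ R L k a M, (σ • (toO z) = toO z ↔ σ z = z) := by
    intro σ z hz
    have h1 : algebraMap (𝓞 L) L (σ • toO z) = σ z := by
      have := DensB.smul_coe σ (toO z)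
      refine Eq.trans this ?_
      exact congrArg σ (toO_coe (hintg _ hz))
    constructor
    · intro e
      rw [e, toO_coe (hintg z hz)] at h1
      exact h1.symm
    · intro e
      apply toO_ext
      rw [h1, e, toO_coe (hintg z hz)]
  have hb := DensB.density_bound (gpoly k a M) ((R L k a M).image toO) ?_ ?_ (isPGroup h hgen) (Fx L k a M) ?_
  · simpa only [gpoly_eval] using hb
  · apply Polynomial.map_injective (algebraMap (𝓞 L) L) RingOfIntegers.coe_injective
    rw [Finset.prod_image hinj, Polynomial.map_map, Polynomial.map_prod]
    have h1 := gpoly_hom (mapRingHom ((algebraMap (𝓞 L) L).comp (algebraMap ℤ (𝓞 L)))) k a M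
    simp only [coe_mapRingHom, map_X] at h1
    rw [h1, ← prod_formula h hns.ne le_rfl (C : L →+* L[X]) X]
    refine Finset.prod_congr rfl fun z hz => ?_
    rw [Polynomial.map_sub, map_X, map_C, toO_coe (hintg z hz)]
  · intro σ hσ
    apply hgen
    intro z hz
    exact (hact σ z hz).mp (hσ _ (Finset.mem_image_of_mem _ hz))
  · rintro σ ⟨ρ, hρ, e⟩
    obtain ⟨z, hz, rfl⟩ := Finset.mem_image.mp hρ
    simp only [Fx, Finset.mem_filter, Finset.mem_univ, true_and]
    exact ⟨z, hz, (hact σ z hz).mp e⟩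

def TreeSmall (k a : ℤ) : Prop := ∀ ε : ℝ, 0 < ε → ∃ M N : ℕ, ∀ᶠ x : ℕ in atTop,
    (((Finset.range (x+1)).filter (fun p : ℕ => p.Prime ∧ ∃ r : ℤ, (p:ℤ) ∣ (F k)^[M] r - a)).card : ℝ) ≤ N + ε * (x / Real.log x)

lemma small_of_fix (hns : NS k a) (hfix : ∀ ε : ℝ, 0 < ε → ∃ M : ℕ, ∀ (L : Type) [Field L] [NumberField L] [IsGalois ℚ L], Sq L k a M → Gen L k a M → ((Fx L k a M).card : ℝ) ≤ ε * Fintype.card Gal(L/ℚ)) : TreeSmall k a := by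
  intro ε hε
  obtain ⟨M, hM⟩ := hfix (ε / 10) (by positivity)
  obtain ⟨L, i1, i2, i3, h, hgen⟩ := exists_field k a M
  have h1 := hM L h hgen
  obtain ⟨N, hN⟩ := tree_count h hgen hns
  refine ⟨M, N, ?_⟩
  filter_upwards [hN, eventually_gt_atTop 1] with x hx hx1
  have hG : (0:ℝ) < Nat.card Gal(L/ℚ) := by
    rw [Nat.card_eq_fintype_card]; exact_mod_cast Fintype.card_pos
  have hl : 0 ≤ (x:ℝ) / Real.log x := div_nonneg (by positivity) (Real.log_natCast_nonneg x)
  rw [← Nat.card_eq_fintype_card] at h1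
  refine le_of_mul_le_mul_right (hx.trans ?_) hG
  have := mul_le_mul_of_nonneg_right h1 hl
  linarith

theorem small_of_good (hns : NS k a) (hinf : ∀ N, ∃ n, N ≤ n ∧ Good k a n) : TreeSmall k a := by
  apply small_of_fix hns
  intro ε hε
  obtain ⟨B, hB⟩ := exists_nat_gt (2 / ε)
  have hB0 : (0:ℝ) < B := lt_trans (by positivity) hB
  obtain ⟨j, hj⟩ := exists_nat_gt (2 * 2 ^ B / ε)
  have hj0 : (0:ℝ) < j := lt_trans (by positivity) hj
  have hInf : {n | Good k a n}.Infinite := by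
    rw [Set.infinite_iff_exists_gt]
    intro N
    obtain ⟨n, hn, hg⟩ := hinf (N+1)
    exact ⟨n, hg, by omega⟩
  obtain ⟨J, hJ, hJc⟩ := hInf.exists_subset_card_eq j
  refine ⟨J.sup id + 1, ?_⟩
  intro L _ _ _ h hgen
  have h1 := fix_count h hns J (fun n hn => ⟨Nat.lt_succ_of_le (Finset.le_sup (f := id) hn), hJ hn⟩) B
  rw [hJc] at h1
  have h2 : ((j * B * (Fx L k a (J.sup id + 1)).card : ℕ) : ℝ) ≤ ((B * 2 ^ B * Fintype.card Gal(L/ℚ) + j * Fintype.card Gal(L/ℚ) : ℕ) : ℝ) := Nat.cast_le.mpr h1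
  push_cast at h2
  have hG : (0:ℝ) ≤ Fintype.card Gal(L/ℚ) := by positivity
  rw [div_lt_iff₀ hε] at hB hj
  have h3 : (B:ℝ) * 2 ^ B + j ≤ ε * (j * B) := by nlinarith
  refine le_of_mul_le_mul_left ?_ (show (0:ℝ) < j * B by positivity)
  nlinarith [mul_le_mul_of_nonneg_right h3 hG]

end Tree

namespace Tree
open NumberField
open scoped Classical Pointwise

lemma c_neg_two : ∀ m, 2 ≤ m → c (-2) m = 2 := by
  intro m hm
  induction m, hm using Nat.le_induction with
  | base => rw [c_succ, c_one]; norm_num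
  | succ m hm ih => rw [c_succ, ih]; norm_num

lemma not_sq_two : ¬ IsSquare (2:ℤ) := by
  rintro ⟨r, hr⟩
  have h1 : r < 2 := by nlinarith
  have h2 : -2 < r := by nlinarith
  interval_cases r <;> omega

lemma NS_neg_two : NS (-2) 0 := by
  constructor
  · exact not_sq_two
  · intro m hm
    rw [c_neg_two m hm]; exact not_sq_two

lemma cheb_iter {B : Type*} [Field B] {ζ : B} (h0 : ζ ≠ 0) (n : ℕ) : (F (-2))^[n] (ζ + ζ⁻¹) = ζ ^ 2 ^ n + (ζ ^ 2 ^ n)⁻¹ := by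
  induction n with
  | zero => simp
  | succ n ih =>
    rw [Function.iterate_succ_apply', ih, F, pow_succ 2 n, pow_mul]
    have : ζ ^ 2 ^ n ≠ 0 := pow_ne_zero _ h0
    field_simp
    push_cast
    ring

lemma cheb_root {B : Type*} [Field B] [IsAlgClosed B] (z : B) : ∃ ζ : B, ζ ≠ 0 ∧ z = ζ + ζ⁻¹ := by
  have hd : (X ^ 2 - C z * X + C 1 : B[X]).degree = 2 := by
    compute_degree!
  obtain ⟨ζ, hζ⟩ := IsAlgClosed.exists_root (X ^ 2 - C z * X + C 1 : B[X]) (by rw [hd]; decide)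
  simp only [IsRoot, eval_add, eval_sub, eval_pow, eval_X, eval_mul, eval_C] at hζ
  have h0 : ζ ≠ 0 := by rintro rfl; simp at hζ
  refine ⟨ζ, h0, ?_⟩
  field_simp
  linear_combination -hζ

variable {L : Type*} [Field L] [NumberField L] [IsGalois ℚ L] {M : ℕ}

lemma cheb_pow {B : Type*} [Field B] {ζ : B} (h0 : ζ ≠ 0) (n : ℕ) (h : (F (-2))^[n] (ζ + ζ⁻¹) = ((0:ℤ):B)) : ζ ^ 2 ^ (n+1) = -1 := by
  rw [cheb_iter h0] at h
  have : ζ ^ 2 ^ n ≠ 0 := pow_ne_zero _ h0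
  rw [pow_succ 2 n, pow_mul]
  field_simp at h
  push_cast at h
  linear_combination h

lemma Fx_neg_two (h : Sq L (-2) 0 M) (hgen : Gen L (-2) 0 M) : Fx L (-2) 0 M ⊆ {1} := by
  intro σ hσ
  simp only [Fx, Finset.mem_filter, Finset.mem_univ, true_and] at hσ
  obtain ⟨z, hz, e⟩ := hσ
  rw [Finset.mem_singleton]
  apply hgen
  intro w hw
  rw [mem_R h le_rfl] at hz hw
  let Ω := AlgebraicClosure L
  have hz' : (F (-2))^[M] (algebraMap L Ω z) = ((0:ℤ):Ω) := by rw [← map_F, hz]; simp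
  have hw' : (F (-2))^[M] (algebraMap L Ω w) = ((0:ℤ):Ω) := by rw [← map_F, hw]; simp
  obtain ⟨ζ, hζ, ez⟩ := cheb_root (algebraMap L Ω z)
  obtain ⟨ξ, hξ, ew⟩ := cheb_root (algebraMap L Ω w)
  rw [ez] at hz'
  rw [ew] at hw'
  have h1 := cheb_pow hζ M hz'
  have h2 := cheb_pow hξ M hw'
  have h3 : ζ ^ 2 ^ (M+1+1) = 1 := by rw [pow_succ 2 (M+1), pow_mul, h1]; norm_num
  have h4 : ξ ^ 2 ^ (M+1+1) = 1 := by rw [pow_succ 2 (M+1), pow_mul, h2]; norm_num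
  have hord : orderOf ζ = 2 ^ (M+1+1) := by
    have : Fact (Nat.Prime 2) := ⟨Nat.prime_two⟩
    apply orderOf_eq_prime_pow _ h3
    rw [h1]; norm_num
  have hprim : IsPrimitiveRoot ζ (2 ^ (M+1+1)) := hord ▸ IsPrimitiveRoot.orderOf ζ
  obtain ⟨i, _, hi⟩ := hprim.eq_pow_of_pow_eq_one h4
  have h5 : w = aeval z (dickson 1 (1:ℤ) i) := by
    apply (algebraMap L Ω).injective
    rw [ew, ← hi, ← aeval_algebraMap_apply, ez]
    have := dickson_one_one_eval_add_inv ζ ζ⁻¹ (mul_inv_cancel₀ hζ) i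
    rw [← inv_pow, ← this, aeval_def, ← eval_map, map_dickson]
    simp
  have h6 := Polynomial.aeval_algHom_apply ((σ : L →ₐ[ℚ] L).restrictScalars ℤ) z (dickson 1 (1:ℤ) i)
  have h7 : ((σ : L →ₐ[ℚ] L).restrictScalars ℤ) z = z := e
  rw [h7, ← h5] at h6
  exact h6.symm

theorem small_neg_two : TreeSmall (-2) 0 := by
  apply small_of_fix NS_neg_two
  intro ε hε
  obtain ⟨M, hM⟩ := exists_nat_gt (1/ε)
  refine ⟨M, ?_⟩
  intro L _ _ _ h hgen
  have h1 : (Fx L (-2) 0 M).card ≤ 1 := (Finset.card_le_card (Fx_neg_two h hgen)).trans (by simp)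
  have h2 : 2 ^ M ≤ Fintype.card Gal(L/ℚ) := by
    have hc := card_R h NS_neg_two.ne le_rfl
    have hne : (R L (-2) 0 M).Nonempty := by
      rw [← Finset.card_pos, hc]; positivity
    obtain ⟨z, hz⟩ := hne
    rw [← hc, ← Finset.card_univ]
    refine Finset.card_le_card_of_surjOn (fun σ : Gal(L/ℚ) => σ z) ?_
    intro w hw
    obtain ⟨σ, hσ⟩ := trans h NS_neg_two le_rfl hz hw
    exact ⟨σ, by simp, hσ⟩
  have h3 : M ≤ Fintype.card Gal(L/ℚ) := Nat.lt_two_pow_self.le.trans h2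
  have h4 : (M:ℝ) ≤ Fintype.card Gal(L/ℚ) := by exact_mod_cast h3
  have h5 : ((Fx L (-2) 0 M).card : ℝ) ≤ 1 := by exact_mod_cast h1
  rw [div_lt_iff₀ hε] at hM
  nlinarith

end Tree

namespace Tree
open scoped Classical

lemma iter_congr (k : ℤ) {d x y : ℤ} (h : d ∣ x - y) (n : ℕ) : d ∣ (F k)^[n] x - (F k)^[n] y := by
  induction n with
  | zero => simpa using h
  | succ n ih =>
    rw [Function.iterate_succ_apply', Function.iterate_succ_apply', F, F]
    refine ih.trans ⟨(F k)^[n] x + (F k)^[n] y, ?_⟩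
    ring

lemma c_add (k : ℤ) (m n : ℕ) : c k (m + n) = (F k)^[m] (c k n) := by
  rw [c, c, Function.iterate_add_apply]

lemma c_congr (k : ℤ) (m n : ℕ) : c k n ∣ c k (m + n) - c k m := by
  rw [c_add, c]
  exact iter_congr k (by simp) m

lemma c_congr_sq (k : ℤ) {m : ℕ} (hm : 1 ≤ m) (n : ℕ) : c k n ^ 2 ∣ c k (m + n) - c k m := by
  obtain ⟨m, rfl⟩ := Nat.exists_eq_add_of_le' hm
  have h1 : c k (m + 1 + n) = (F k)^[m] (F k (c k n)) := by
    rw [c_add, Function.iterate_succ_apply]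
  have h2 : c k (m + 1) = (F k)^[m] (F k 0) := by
    rw [c, Function.iterate_succ_apply]
  rw [h1, h2]
  apply iter_congr
  simp [F]

lemma c_dvd_mul (k : ℤ) (n j : ℕ) : c k n ∣ c k (n * j) := by
  induction j with
  | zero => simp [c_zero]
  | succ j ih =>
    have := c_congr k (n * j) n
    rw [Nat.mul_succ]
    have h2 := dvd_add this ih
    simpa using h2

lemma c_congr_mul (k : ℤ) (m n j : ℕ) : c k n ∣ c k (m + n * j) - c k m :=
  (c_dvd_mul k n j).trans (c_congr k m (n * j))

/-- the rank of apparition -/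
lemma exists_rank (k : ℤ) (q : ℕ) {m : ℕ} (hm : 1 ≤ m) (h : (q:ℤ) ∣ c k m) :
    ∃ r, 1 ≤ r ∧ (q:ℤ) ∣ c k r ∧ (∀ i, 1 ≤ i → i < r → ¬ (q:ℤ) ∣ c k i) ∧ ∀ n, (q:ℤ) ∣ c k n → r ∣ n := by
  have hex : ∃ r, 1 ≤ r ∧ (q:ℤ) ∣ c k r := ⟨m, hm, h⟩
  have h1 := Nat.find_spec hex
  have h2 : ∀ i, 1 ≤ i → i < Nat.find hex → ¬ (q:ℤ) ∣ c k i := fun i hi hlt hd => Nat.find_min hex hlt ⟨hi, hd⟩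
  refine ⟨Nat.find hex, h1.1, h1.2, h2, ?_⟩
  set r := Nat.find hex
  intro n hn
  have h3 := c_congr_mul k (n % r) r (n / r)
  rw [Nat.mod_add_div] at h3
  have h4 : (q:ℤ) ∣ c k (n % r) := by
    have := dvd_sub hn (h1.2.trans h3)
    simpa using this
  by_contra hnd
  exact h2 (n % r) (Nat.pos_of_ne_zero fun h0 => hnd (Nat.dvd_of_mod_eq_zero h0)) (Nat.mod_lt _ h1.1) h4

lemma exists_val {q : ℕ} (hq : q.Prime) {d : ℤ} (hd : d ≠ 0) : ∃ (v : ℕ) (w : ℤ), d = q ^ v * w ∧ ¬ (q:ℤ) ∣ w := by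
  have hf : FiniteMultiplicity (q:ℤ) d := Int.finiteMultiplicity_iff.mpr ⟨by simpa using hq.one_lt.ne', hd⟩
  obtain ⟨w, hw, hnd⟩ := hf.exists_eq_pow_mul_and_not_dvd
  exact ⟨_, w, hw, hnd⟩

lemma val_unique {q : ℕ} (hq : q.Prime) {a b : ℕ} {x y : ℤ} (hx : ¬ (q:ℤ) ∣ x) (hy : ¬ (q:ℤ) ∣ y) (h : (q:ℤ) ^ a * x = q ^ b * y) : a = b := by
  have hq0 : (q:ℤ) ≠ 0 := by exact_mod_cast hq.ne_zero
  have key : ∀ (a b : ℕ) (x y : ℤ), ¬ (q:ℤ) ∣ x → (q:ℤ) ^ a * x = q ^ b * y → ¬ a < b := by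
    intro a b x y hx h hlt
    obtain ⟨e, rfl⟩ := Nat.exists_eq_add_of_lt hlt
    apply hx
    have : x = q ^ (e+1) * y := by
      apply mul_left_cancel₀ (pow_ne_zero a hq0)
      rw [h]; ring
    rw [this, pow_succ]
    exact ⟨q ^ e * y, by ring⟩
  have h1 := key a b x y hx h
  have h2 := key b a y x hy h.symm
  omega

lemma OddVal.ne_zero {q : ℕ} {d : ℤ} (h : OddVal q d) : (q:ℤ) ∣ d := by
  obtain ⟨v, m, hv, hm, rfl⟩ := h
  exact Dvd.dvd.mul_right (dvd_pow_self _ hv.pos.ne') _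

lemma OddVal.congr {q : ℕ} (hq : q.Prime) {d d' w : ℤ} {v : ℕ} (hd : d = q ^ v * w) (hw : ¬ (q:ℤ) ∣ w) (h : (q:ℤ) ^ (v+1) ∣ d' - d) (hd' : OddVal q d') : OddVal q d := by
  obtain ⟨x, hx⟩ := h
  obtain ⟨v', m', hv', hm', e⟩ := hd'
  have h1 : (q:ℤ) ^ v * (w + q * x) = q ^ v' * m' := by
    rw [← e]
    have : d' = d + q ^ (v+1) * x := by linarith
    rw [this, hd]; ring
  have h2 : ¬ (q:ℤ) ∣ w + q * x := by
    intro h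
    exact hw ((dvd_add_left ⟨x, rfl⟩).mp h)
  have := val_unique hq h2 hm' h1
  exact ⟨v, w, this ▸ hv', hw, hd⟩

/-- rigidity -/
lemma rigid {k : ℤ} {q r : ℕ} (hr : 1 ≤ r) {v : ℕ} {w : ℤ} (hv : 1 ≤ v) (hd : c k r = q ^ v * w) : ∀ j, 1 ≤ j → (q:ℤ) ^ (v+1) ∣ c k (r * j) - c k r := by
  intro j hj
  induction j, hj using Nat.le_induction with
  | base => simp
  | succ j hj ih =>
    have h1 : (q:ℤ) ^ v ∣ c k (r * j) := by
      have := dvd_add ((pow_dvd_pow (q:ℤ) (Nat.le_succ v)).trans ih) (show (q:ℤ) ^ v ∣ c k r from ⟨w, hd⟩)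
      simpa using this
    have h2 := c_congr_sq k hr (r * j)
    have h3 : (q:ℤ) ^ (v + 1) ∣ c k (r * j) ^ 2 := by
      refine (pow_dvd_pow (q:ℤ) (show v + 1 ≤ v * 2 by omega)).trans ?_
      rw [pow_mul]
      exact pow_dvd_pow_of_dvd h1 2
    have := h3.trans h2
    rwa [show r * (j+1) = r + r * j by ring]

lemma rigid_oddVal {k : ℤ} {q : ℕ} (hq : q.Prime) {r m : ℕ} (hr : 1 ≤ r) (hm : 1 ≤ m) (hrm : r ∣ m) (hr0 : c k r ≠ 0) (hqr : (q:ℤ) ∣ c k r) (h : OddVal q (c k m)) : OddVal q (c k r) := by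
  obtain ⟨v, w, e, hw⟩ := exists_val hq hr0
  have hv : 1 ≤ v := by
    by_contra hv
    have : v = 0 := by omega
    rw [this] at e
    rw [e] at hqr
    simp at hqr
    exact hw hqr
  obtain ⟨j, rfl⟩ := hrm
  exact OddVal.congr hq e hw (rigid hr hv e j (Nat.pos_of_ne_zero (by rintro rfl; simp at hm))) h

lemma isSquare_of_not_oddVal {d : ℤ} (hd : d ≠ 0) (h : ∀ q : ℕ, q.Prime → ¬ OddVal q d) : ∃ s : ℤ, d.natAbs = s ^ 2 := by
  obtain ⟨a, b, hab, hsf⟩ := Nat.sq_mul_squarefree d.natAbs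
  have hb0 : b ≠ 0 := by
    rintro rfl
    simp at hab
    exact hd (by omega)
  have ha1 : a = 1 := by
    by_contra ha
    obtain ⟨q, hq, a', rfl⟩ := Nat.exists_prime_and_dvd ha
    apply h q hq
    obtain ⟨s, w, e, hw⟩ := exists_val hq (show (b:ℤ) ≠ 0 by exact_mod_cast hb0)
    have ha' : ¬ (q:ℤ) ∣ (a':ℤ) := by
      intro hdv
      have hdv : q ∣ a' := by exact_mod_cast hdv
      have := hsf q (Nat.mul_dvd_mul_left q hdv)
      exact hq.one_lt.ne' (by simpa using this)
    have hpr : Prime (q:ℤ) := Nat.prime_iff_prime_int.mp hq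
    have hm : ¬ (q:ℤ) ∣ w ^ 2 * a' := by
      intro hdv
      rcases hpr.dvd_or_dvd hdv with h1 | h1
      · exact hw (hpr.dvd_of_dvd_pow h1)
      · exact ha' h1
    have e1 : (d.natAbs : ℤ) = q ^ (2 * s + 1) * (w ^ 2 * a') := by
      rw [← hab]; push_cast; rw [e]; ring
    rcases Int.natAbs_eq d with h2 | h2
    · exact ⟨2 * s + 1, _, ⟨s, rfl⟩, hm, h2.trans e1⟩
    · exact ⟨2 * s + 1, -(w ^ 2 * a'), ⟨s, rfl⟩, by rwa [dvd_neg], by rw [h2, e1]; ring⟩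
  exact ⟨b, by rw [← hab, ha1]; push_cast; ring⟩

/-- If no level `≥ N` is good, odd valuations come from small ranks. -/
lemma odd_small {k : ℤ} {N : ℕ} (hN : 2 ≤ N) (hc : ∀ m, 1 ≤ m → c k m ≠ 0) (hbad : ∀ n, N ≤ n → ¬ Good k 0 n) {q : ℕ} (hq : q.Prime) {m : ℕ} (hm : 1 ≤ m) (h : OddVal q (c k m)) :
    ∃ r, 1 ≤ r ∧ r ≤ N ∧ r ∣ m ∧ OddVal q (c k r) := by
  obtain ⟨r, hr, hqr, hmin, hdv⟩ := exists_rank k q hm h.ne_zero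
  have hrm := hdv m h.ne_zero
  have hov := rigid_oddVal hq hr hm hrm (hc r hr) hqr h
  refine ⟨r, hr, ?_, hrm, hov⟩
  by_contra hlt
  obtain ⟨n, rfl⟩ := Nat.exists_eq_add_of_le' hr
  refine hbad n (by omega) ⟨q, hq, ?_, ?_, by simpa using hov⟩
  · rintro rfl
    have h2 : ¬ ((2:ℕ):ℤ) ∣ c k 2 := hmin 2 (by norm_num) (by omega)
    apply h2
    rw [c_succ, c_one]
    have : Even (k ^ 2 + k) := by
      rw [pow_two, ← mul_add_one]; exact Int.even_mul_succ_self k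
    exact_mod_cast this.two_dvd
  · intro i hi hin
    simpa using hmin i hi (by omega)

end Tree

namespace Tree
open scoped Classical

lemma eq_of_sq_close {A B e : ℤ} (hA : 0 < A) (hB : 0 ≤ B) (h : A ^ 2 - B ^ 2 = e) (he : |e| < A) : A = B := by
  by_contra hne
  rw [abs_lt] at he
  rcases lt_or_gt_of_ne hne with h1 | h1 <;> nlinarith

lemma case_two {K s y u z : ℤ} (hs : s = 1 ∨ s = -1) (hK : 1 ≤ K) (hKs : s = -1 → 3 ≤ K) (hy : 3 ≤ y) (hu : 2 ≤ u) (hz : 0 ≤ z)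
    (h1 : y ^ 2 = K * u ^ 2 + s) (h2 : z ^ 2 = K * y ^ 4 + s) : False := by
  have huy : u ≤ y := by
    rcases hs with rfl | rfl
    · nlinarith
    · have := hKs rfl
      nlinarith
  have hss : s ^ 2 = 1 := by rcases hs with rfl | rfl <;> norm_num
  have hid : (y * (2 * y ^ 2 - s)) ^ 2 - (2 * u * z) ^ 2 = y ^ 2 - 4 * s * u ^ 2 := by
    have e : K * u ^ 2 = y ^ 2 - s := by linarith
    linear_combination (-4 * u ^ 2) * h2 + (-4*y^4) * e + y ^ 2 * hss
  have hA : 5 * y ^ 2 < y * (2 * y ^ 2 - s) := by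
    rcases hs with rfl | rfl <;> nlinarith [pow_pos (show 0 < y by linarith) 3, mul_pos (show 0 < y by linarith) (show 0 < y by linarith)]
  have hE : |y ^ 2 - 4 * s * u ^ 2| ≤ 5 * y ^ 2 := by
    rw [abs_le]
    rcases hs with rfl | rfl <;> constructor <;> nlinarith
  have heq := eq_of_sq_close (by nlinarith) (by positivity) hid (by linarith)
  rw [heq, sub_self] at hid
  rcases hs with rfl | rfl
  · have h3 : (y - 2 * u) * (y + 2 * u) = 0 := by linear_combination -hid
    rcases mul_eq_zero.mp h3 with h4 | h4
    · have : y = 2 * u := by linarith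
      subst this
      have h5 : (4 - K) * u ^ 2 = 1 := by linear_combination h1
      have h6 : 4 ≤ u ^ 2 := by nlinarith
      have h7 : 0 < 4 - K := by
        by_contra h8
        nlinarith
      nlinarith
    · linarith
  · nlinarith

lemma case_one {K s y u w z : ℤ} (hs : s = 1 ∨ s = -1) (hK : 1 ≤ K) (hKs : ¬ IsSquare (K + s)) (hy : K + 40 ≤ y) (hu : 0 ≤ u) (hz : 0 ≤ z)
    (h1 : y ^ 2 = K * u ^ 2 + s) (hw : w = K * y ^ 4 + s) (h2 : z ^ 2 = K * w ^ 2 + s) : False := by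
  have hss : s ^ 2 = 1 := by rcases hs with rfl | rfl <;> norm_num
  have hs1 : s ≤ 1 := by rcases hs with rfl | rfl <;> norm_num
  have hs2 : -1 ≤ s := by rcases hs with rfl | rfl <;> norm_num
  set P := 8 * y ^ 4 - 8 * s * y ^ 2 + 1 with hP
  set Q := 4 * y * u * (2 * y ^ 2 - s) with hQ
  have hPQ : P ^ 2 - K * Q ^ 2 = 1 := by
    rw [hP, hQ]
    have e : K * u ^ 2 = y ^ 2 - s := by linarith
    linear_combination (-16 * y ^ 2 * (2 * y ^ 2 - s) ^ 2) * e + (16*y^2*s)*hss - 16*y^4*hss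
  set w' := w * P - z * Q with hw'
  set z' := z * P - K * w * Q with hz'
  have hn : z' ^ 2 = K * w' ^ 2 + s := by
    rw [hw', hz']
    linear_combination (P ^ 2 - K * Q ^ 2) * h2 + s * hPQ
  have hT : w' * (w * P + z * Q) = w ^ 2 - s * Q ^ 2 := by
    rw [hw']
    linear_combination w ^ 2 * hPQ - Q ^ 2 * h2
  have hmod : y ∣ w' - s := by
    refine ⟨K * y ^ 3 * P + s * (8 * y ^ 3 - 8 * s * y) - z * (4 * u * (2 * y ^ 2 - s)), ?_⟩
    rw [hw', hw, hQ, hP]; ring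
  clear_value w' z'
  have hy2 : 1 ≤ y ^ 2 := by nlinarith
  have hy4 : y ^ 2 * 1600 ≤ y ^ 4 := by
    have : 1600 ≤ y ^ 2 := by nlinarith
    nlinarith
  have hsy : s * y ^ 2 ≤ y ^ 2 := by nlinarith
  have hsy' : - y ^ 2 ≤ s * y ^ 2 := by nlinarith
  have hP1 : y ^ 4 + 1 ≤ P := by rw [hP]; linarith
  have hP2 : P ≤ 17 * y ^ 4 := by rw [hP]; linarith
  have hKy : y ^ 4 ≤ K * y ^ 4 := le_mul_of_one_le_left (by positivity) hK
  have hw1 : w ≤ K * P := by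
    have := mul_le_mul_of_nonneg_left hP1 (show 0 ≤ K by linarith)
    rw [hw]; linarith
  have hw2 : P ≤ 34 * w := by linarith
  have hP0 : 0 < P := by linarith
  have hw0 : 0 < w := by linarith
  have hQ0 : 0 ≤ Q := by
    rw [hQ]
    have : 0 ≤ 2 * y ^ 2 - s := by linarith
    have : 0 ≤ y := by linarith
    positivity
  set T := w * P + z * Q with hTd
  have hT0 : w * P ≤ T := by
    have : 0 ≤ z * Q := by positivity
    linarith
  have hwP : 0 < w * P := by positivity
  have hb1 : w ^ 2 ≤ K * T := by
    have e1 := mul_le_mul_of_nonneg_left hw1 hw0.le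
    have e2 := mul_le_mul_of_nonneg_left hT0 (show 0 ≤ K by linarith)
    linarith
  have hb2 : Q ^ 2 ≤ 34 * T := by
    have e0 : Q ^ 2 ≤ K * Q ^ 2 := le_mul_of_one_le_left (by positivity) hK
    have e1 := mul_le_mul_of_nonneg_right hw2 hP0.le
    linarith
  have hsQ : |s * Q ^ 2| = Q ^ 2 := by
    rcases hs with h | h <;> rw [h] <;> simp
  have hsQ' := abs_le.mp hsQ.le
  have hTpos : 0 < T := by linarith
  have hup : w' ≤ K + 34 := by
    by_contra hcon
    have : (K + 35) * T ≤ w' * T := mul_le_mul_of_nonneg_right (by omega) hTpos.le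
    linarith
  have hlo : -(K + 34) ≤ w' := by
    by_contra hcon
    have : w' * T ≤ -(K + 35) * T := mul_le_mul_of_nonneg_right (by omega) hTpos.le
    linarith [sq_nonneg w]
  have hws : w' = s := by
    have := Int.eq_zero_of_abs_lt_dvd hmod (by rw [abs_lt]; constructor <;> linarith)
    linarith
  apply hKs
  refine ⟨z', ?_⟩
  rw [← pow_two, hn, hws, hss]; ring

/-- normalized orbit -/
def dd (k : ℤ) : ℕ → ℤ
  | 0 => 0
  | n+1 => k * dd k n ^ 2 + 1

lemma c_eq_dd (k : ℤ) (n : ℕ) : c k n = k * dd k n := by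
  induction n with
  | zero => simp [c_zero, dd]
  | succ n ih => rw [c_succ, ih, dd]; ring

lemma dd_not_dvd {k : ℤ} {q : ℕ} (hq : q.Prime) {m : ℕ} (hm : 1 ≤ m) (h : (q:ℤ) ∣ dd k m) : ¬ (q:ℤ) ∣ k := by
  obtain ⟨n, rfl⟩ := Nat.exists_eq_add_of_le' hm
  intro hk
  rw [dd] at h
  have := (Int.dvd_add_right (hk.mul_right _)).mp h
  have h1 : q ∣ 1 := by exact_mod_cast this
  exact hq.one_lt.ne' (by simpa using h1)

lemma OddVal.mul_left {q : ℕ} (hq : q.Prime) {k x : ℤ} (hk : ¬ (q:ℤ) ∣ k) (h : OddVal q x) : OddVal q (k * x) := by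
  obtain ⟨v, m, hv, hm, rfl⟩ := h
  refine ⟨v, k * m, hv, ?_, by ring⟩
  intro hd
  rcases (Nat.prime_iff_prime_int.mp hq).dvd_or_dvd hd with h | h
  · exact hk h
  · exact hm h

lemma OddVal.of_mul_left {q : ℕ} (hq : q.Prime) {k x : ℤ} (hk : ¬ (q:ℤ) ∣ k) (h : OddVal q (k * x)) : OddVal q x := by
  obtain ⟨v, m, hv, hm, e⟩ := h
  have hx : x ≠ 0 := by
    rintro rfl
    rw [mul_zero] at e
    have hq0 : (q:ℤ) ≠ 0 := by exact_mod_cast hq.ne_zero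
    rcases mul_eq_zero.mp e.symm with h | h
    · exact pow_ne_zero _ hq0 h
    · exact hm (h ▸ dvd_zero _)
  obtain ⟨v', w, e', hw⟩ := exists_val hq hx
  have : v' = v := by
    apply val_unique hq (x := k * w) (y := m) _ hm
    · rw [← e, e']; ring
    · intro hd
      rcases (Nat.prime_iff_prime_int.mp hq).dvd_or_dvd hd with h | h
      · exact hk h
      · exact hw h
  exact ⟨v', w, this ▸ hv, hw, e'⟩

lemma not_oddVal_of_sq {q : ℕ} (hq : q.Prime) {d s : ℤ} (hd : d.natAbs = s ^ 2) : ¬ OddVal q d := by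
  rintro ⟨v, m, hv, hm, e⟩
  have hs : s ≠ 0 := by
    rintro rfl
    have h0 : d = 0 := by simpa using hd
    rw [h0] at e
    have hq0 : (q:ℤ) ≠ 0 := by exact_mod_cast hq.ne_zero
    rcases mul_eq_zero.mp e.symm with h | h
    · exact pow_ne_zero _ hq0 h
    · exact hm (h ▸ dvd_zero _)
  obtain ⟨t, w, e', hw⟩ := exists_val hq hs
  have hw2 : ¬ (q:ℤ) ∣ w ^ 2 := fun h => hw ((Nat.prime_iff_prime_int.mp hq).dvd_of_dvd_pow h)
  have h3 : (q:ℤ) ^ (2 * t) * w ^ 2 = s ^ 2 := by rw [e']; ring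
  rw [← hd] at h3
  have : 2 * t = v := by
    rcases Int.natAbs_eq d with h | h
    · exact val_unique hq hw2 hm (by rw [h3, ← h, e])
    · refine val_unique hq hw2 (y := -m) (by rwa [dvd_neg]) ?_
      rw [h3]
      linear_combination h - e
  obtain ⟨x, rfl⟩ := hv
  omega

lemma dd_sq {k : ℤ} {N : ℕ} (hN : 2 ≤ N) (hc : ∀ m, 1 ≤ m → c k m ≠ 0) (hbad : ∀ n, N ≤ n → ¬ Good k 0 n) {m : ℕ} (hm : 1 ≤ m)
    (hr : ∀ r, 1 ≤ r → r ≤ N → r ∣ m → r = 1 ∨ (r = 2 ∧ ∃ s : ℤ, (k+1).natAbs = s ^ 2)) : ∃ s : ℤ, (dd k m).natAbs = s ^ 2 := by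
  apply isSquare_of_not_oddVal
  · intro h
    apply hc m hm
    rw [c_eq_dd, h, mul_zero]
  · intro q hq h
    have hqk := dd_not_dvd hq hm h.ne_zero
    have h1 : OddVal q (c k m) := by rw [c_eq_dd]; exact h.mul_left hq hqk
    obtain ⟨r, hr1, hrN, hrm, hov⟩ := odd_small hN hc hbad hq hm h1
    rcases hr r hr1 hrN hrm with rfl | ⟨rfl, s, hs⟩
    · rw [c_one] at hov
      exact hqk hov.ne_zero
    · rw [c_succ, c_one, show k ^ 2 + k = k * (k + 1) by ring] at hov
      exact not_oddVal_of_sq hq hs (hov.of_mul_left hq hqk)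

end Tree

namespace Tree
open scoped Classical

lemma not_sq_between {n s : ℤ} (hn : 0 ≤ n) (h1 : n ^ 2 < s ^ 2) (h2 : s ^ 2 < (n+1) ^ 2) : False := by
  rw [← sq_abs s] at h1 h2
  have h3 := lt_of_pow_lt_pow_left₀ 2 (abs_nonneg s) h1
  have h4 := lt_of_pow_lt_pow_left₀ 2 (by linarith) h2
  omega

lemma c_ne_zero {k : ℤ} (hk : ¬ IsSquare (-k)) : ∀ m, 1 ≤ m → c k m ≠ 0 := by
  intro m hm
  obtain ⟨n, rfl⟩ := Nat.exists_eq_add_of_le' hm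
  intro h
  rw [c_succ] at h
  exact hk ⟨c k n, by rw [← pow_two]; linarith⟩

lemma NS_zero {k : ℤ} (hk : ¬ IsSquare (-k)) : NS k 0 := by
  refine ⟨by simpa using hk, ?_⟩
  intro m hm
  obtain ⟨n, rfl⟩ := Nat.exists_eq_add_of_le' (show 1 ≤ m by omega)
  have h0 := c_ne_zero hk n (by omega)
  rw [sub_zero, c_succ]
  rintro ⟨s, hs⟩
  rw [← pow_two, ← sq_abs (c k n)] at hs
  have hk0 : k ≠ 0 := by rintro rfl; exact hk ⟨0, by simp⟩
  have hk1 : k ≠ -1 := by rintro rfl; exact hk ⟨1, by simp⟩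
  have hle : |k| ≤ |c k n| := by
    rw [Int.abs_eq_natAbs, Int.abs_eq_natAbs]
    have : k ∣ c k n := ⟨_, c_eq_dd k n⟩
    exact_mod_cast Nat.le_of_dvd (Int.natAbs_pos.mpr h0) (Int.natAbs_dvd_natAbs.mpr this)
  rcases lt_or_gt_of_ne hk0 with h | h
  · rw [abs_of_neg h] at hle
    refine not_sq_between (n := |c k n| - 1) (s := s) (by linarith) ?_ ?_
    · rw [← hs]
      have : k ≤ -2 := by omega
      nlinarith
    · rw [← hs]; nlinarith
  · rw [abs_of_pos h] at hle
    refine not_sq_between (n := |c k n|) (s := s) (by linarith) ?_ ?_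
    · rw [← hs]; linarith
    · rw [← hs]; nlinarith

theorem good_zero {k : ℤ} (hk : ¬ IsSquare (-k)) (hk2 : k ≠ -2) : ∀ N, ∃ n, N ≤ n ∧ Good k 0 n := by
  intro N₀
  by_contra! hbad₀
  set N := N₀ + 2 with hN
  have hbad : ∀ n, N ≤ n → ¬ Good k 0 n := fun n hn => hbad₀ n (by omega)
  have hc := c_ne_zero hk
  have hk0 : k ≠ 0 := by rintro rfl; exact hk ⟨0, by simp⟩
  have hk1 : k ≠ -1 := by rintro rfl; exact hk ⟨1, by simp⟩
  -- sign and size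
  obtain ⟨K, s, hKk, hs, hK, hKs⟩ : ∃ K s : ℤ, k = s * K ∧ (s = 1 ∨ s = -1) ∧ 1 ≤ K ∧ (s = -1 → 3 ≤ K) := by
    rcases lt_or_gt_of_ne hk0 with h | h
    · exact ⟨-k, -1, by ring, Or.inr rfl, by omega, fun _ => by omega⟩
    · exact ⟨k, 1, by ring, Or.inl rfl, by omega, fun h => by omega⟩
  set u : ℕ → ℤ := fun m => ((dd k m).natAbs : ℤ) with hu
  have hu1 : u 1 = 1 := by simp [hu, dd]
  have hupos : ∀ m, 1 ≤ m → 1 ≤ u m := by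
    intro m hm
    have : dd k m ≠ 0 := fun h => hc m hm (by rw [c_eq_dd, h, mul_zero])
    simp only [hu]
    have := Int.natAbs_pos.mpr this
    omega
  have hrec : ∀ m, 1 ≤ m → u (m+1) = K * u m ^ 2 + s := by
    intro m hm
    have h1 := hupos m hm
    simp only [hu] at h1 ⊢
    rw [Int.natAbs_sq, dd, ← Int.abs_eq_natAbs]
    have h2 : 1 ≤ dd k m ^ 2 := by
      rw [← Int.natAbs_sq]; nlinarith
    generalize dd k m = D at h2 ⊢
    rcases hs with rfl | rfl
    · rw [abs_of_pos]
      · rw [hKk]; ring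
      · rw [hKk]; nlinarith
    · have := hKs rfl
      rw [abs_of_neg]
      · rw [hKk]; ring
      · rw [hKk]; nlinarith
  have hgrow : ∀ m : ℕ, 1 ≤ m → (m:ℤ) ≤ u m := by
    intro m hm
    induction m, hm using Nat.le_induction with
    | base => simp [hu1]
    | succ m hm ih =>
      have h1 := hupos m hm
      rw [hrec m hm]
      push_cast
      rcases hs with rfl | rfl
      · nlinarith
      · have := hKs rfl
        nlinarith
  have hfac : ∀ r, 1 ≤ r → r ≤ N → r ∣ N.factorial := fun r h1 h2 => Nat.dvd_factorial h1 h2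
  have hNf : 1 ≤ N.factorial := Nat.factorial_pos N
  have hsq : ∀ m, 1 ≤ m → (∀ r, 1 ≤ r → r ≤ N → r ∣ m → r = 1 ∨ (r = 2 ∧ ∃ s : ℤ, (k+1).natAbs = s ^ 2)) → ∃ y : ℤ, 0 ≤ y ∧ u m = y ^ 2 := by
    intro m hm hr
    obtain ⟨y, hy⟩ := dd_sq (by omega) hc hbad hm hr
    exact ⟨|y|, abs_nonneg y, by rw [sq_abs]; exact hy⟩
  obtain ⟨j, hj⟩ : ∃ j : ℕ, (K + 40) ^ 2 + 5 ≤ j := ⟨((K+40)^2+5).toNat, Int.self_le_toNat _⟩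
  have hj5 : 5 ≤ j := by
    have : (5:ℤ) ≤ j := by nlinarith [sq_nonneg (K+40)]
    exact_mod_cast this
  have hjN : j ≤ j * N.factorial := Nat.le_mul_of_pos_right _ hNf
  have habs : ((k + 1).natAbs : ℤ) = K + s := by
    rw [← Int.abs_eq_natAbs]
    rcases hs with rfl | rfl
    · rw [abs_of_pos (by omega)]; omega
    · have := hKs rfl
      rw [abs_of_neg (by omega)]; omega
  by_cases hKsq : IsSquare (K + s)
  · have hk1sq : ∃ s : ℤ, (k+1).natAbs = s ^ 2 := by
      obtain ⟨t, ht⟩ := hKsq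
      exact ⟨t, by rw [habs, ht]; ring⟩
    set n := 2 * (j * N.factorial) with hn
    obtain ⟨y, hy0, hy⟩ := hsq (n+1) (by omega) (by
      intro r h1 h2 h3
      left
      have h4 : r ∣ n := (hfac r h1 h2).trans ⟨2 * j, by rw [hn]; ring⟩
      have h5 := (Nat.dvd_add_right h4).mp h3
      exact Nat.dvd_one.mp h5)
    obtain ⟨z, hz0, hz⟩ := hsq (n+2) (by omega) (by
      intro r h1 h2 h3
      have h4 : r ∣ n := (hfac r h1 h2).trans ⟨2 * j, by rw [hn]; ring⟩
      have h5 := (Nat.dvd_add_right h4).mp h3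
      rcases (Nat.dvd_prime Nat.prime_two).mp h5 with h6 | h6
      · exact Or.inl h6
      · exact Or.inr ⟨h6, hk1sq⟩)
    have e1 := hrec n (by omega)
    have e2 := hrec (n+1) (by omega)
    rw [hy] at e1
    rw [show n + 1 + 1 = n + 2 from rfl, hz, hy] at e2
    have g1 := hgrow n (by omega)
    have g2 := hgrow (n+1) (by omega)
    rw [hy] at g2
    have hn10 : (10:ℤ) ≤ n := by
      have : 10 ≤ n := by omega
      exact_mod_cast this
    push_cast at g2
    refine case_two hs hK hKs (y := y) (u := u n) (z := z) (by nlinarith) (by linarith) hz0 e1 ?_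
    rw [e2]; ring
  · set n := j * N.factorial - 2 with hn
    obtain ⟨y, hy0, hy⟩ := hsq (n+1) (by omega) (by
      intro r h1 h2 h3
      left
      have h4 : r ∣ n + 1 + 1 := (hfac r h1 h2).trans ⟨j, by rw [hn, mul_comm]; have := hjN; rw [mul_comm] at this; omega⟩
      have h5 := (Nat.dvd_add_right h3).mp h4
      exact Nat.dvd_one.mp h5)
    obtain ⟨z, hz0, hz⟩ := hsq (n+3) (by omega) (by
      intro r h1 h2 h3
      left
      have h4 : r ∣ n + 2 := (hfac r h1 h2).trans ⟨j, by rw [hn, mul_comm]; have := hjN; rw [mul_comm] at this; omega⟩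
      have h5 := (Nat.dvd_add_right h4).mp (show r ∣ n + 2 + 1 from h3)
      exact Nat.dvd_one.mp h5)
    have e1 := hrec n (by omega)
    have e2 := hrec (n+1) (by omega)
    have e3 := hrec (n+2) (by omega)
    have g2 := hgrow (n+1) (by omega)
    rw [hy] at e1 e2 g2
    rw [show n + 2 + 1 = n + 3 from rfl, hz] at e3
    have hnj : (K + 40) ^ 2 ≤ ((n + 1 : ℕ) : ℤ) := by
      have : (j:ℤ) ≤ ((n + 2 : ℕ) : ℤ) := by
        have : j ≤ n + 2 := by omega
        exact_mod_cast this
      push_cast at this ⊢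
      linarith
    refine case_one hs hK hKsq (y := y) (u := u n) (w := u (n+2)) (z := z) ?_ (by have := hupos n (by omega); linarith) hz0 e1 ?_ e3
    · exact le_of_sq_le_sq (hnj.trans g2) hy0
    · rw [e2]; ring

end Tree

namespace Tree
open scoped Classical NumberTheorySymbols

lemma jac_neg_one {D m : ℕ} (hD : 1 ≤ D) (hm : 1 ≤ m) : J(-1 | 4 * D * m - 1) = -1 := by
  have h1 : 1 ≤ D * m := Nat.mul_pos hD hm
  have h0 : 4 * D * m = 4 * (D * m) := by ring
  have h2 : (4 * D * m - 1) % 4 = 3 := by omega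
  rw [jacobiSym.at_neg_one (by rw [Nat.odd_iff]; omega), ZMod.χ₄_nat_three_mod_four h2]

lemma jac_D_one {D : ℕ} (hD : 1 ≤ D) : J((D:ℤ) | 4 * D - 1) = 1 := by
  have hodd : Odd (4 * D - 1) := by rw [Nat.odd_iff]; omega
  have hcast : ((4 * D - 1 : ℕ) : ℤ) = 4 * D - 1 := by omega
  have h4 : J((4:ℤ) * (D : ℤ) | 4 * D - 1) = 1 := by
    rw [jacobiSym.mod_left' (a₂ := 1), jacobiSym.one_left]
    rw [hcast, Int.emod_eq_emod_iff_emod_sub_eq_zero]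
    simp
  have h2 : J((4:ℤ) | 4 * D - 1) = 1 := by
    have := jacobiSym.sq_one' (a := 2) (b := 4 * D - 1) (by
      have : Nat.Coprime 2 (4 * D - 1) := Nat.coprime_two_left.2 hodd
      rw [Int.gcd_eq_natAbs]; exact this)
    norm_num at this
    exact this
  rw [jacobiSym.mul_left, h2, one_mul] at h4
  exact h4

lemma jac_D {D m : ℕ} (hD : 1 ≤ D) (hm : 1 ≤ m) : J((D:ℤ) | 4 * D * m - 1) = 1 := by
  have h1 : 1 ≤ D * m := Nat.mul_pos hD hm
  have h0 : 4 * D * m = 4 * (D * m) := by ring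
  have hodd : Odd (4 * D * m - 1) := by rw [Nat.odd_iff]; omega
  rw [jacobiSym.mod_right _ hodd, ← jac_D_one hD]
  congr 1
  obtain ⟨m, rfl⟩ := Nat.exists_eq_add_of_le' hm
  have : 4 * D * (m+1) - 1 = (4 * D - 1) + 4 * D * m := by
    rw [mul_add, mul_one]; omega
  simp only [Int.natAbs_natCast]
  rw [this, Nat.add_mul_mod_self_left, Nat.mod_eq_of_lt (by omega)]

lemma jac_ne {M : ℕ} {x y : ℤ} (h : (M:ℤ) ∣ y ^ 2 - x) : J(x | M) ≠ -1 := by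
  have : J(y ^ 2 | M) = J(x | M) := by
    apply jacobiSym.mod_left'
    rw [Int.emod_eq_emod_iff_emod_sub_eq_zero]
    exact Int.emod_eq_zero_of_dvd h
  rw [← this, jacobiSym.pow_left]
  nlinarith [pow_two_nonneg (J(y | M))]

end Tree

namespace Tree
open scoped Classical NumberTheorySymbols

lemma c_ne_zero_sq {a : ℤ} (ha : 2 ≤ |a|) : ∀ m, 1 ≤ m → c (-a^2) m ≠ 0 := by
  intro m hm
  obtain ⟨n, rfl⟩ := Nat.exists_eq_add_of_le' hm
  intro h
  rw [c_succ, c_eq_dd] at h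
  have ha2 : 4 ≤ a ^ 2 := by rw [← sq_abs]; nlinarith
  have h1 : a ^ 2 * (a ^ 2 * dd (-a^2) n ^ 2) = a ^ 2 * 1 := by linarith [h]
  have h2 := mul_left_cancel₀ (by linarith) h1
  rcases eq_or_ne (dd (-a^2) n) 0 with h0 | h0
  · rw [h0] at h2; norm_num at h2
  · have : 0 < dd (-a^2) n ^ 2 := by positivity
    nlinarith

lemma NS_sq {a : ℤ} (ha : 2 ≤ |a|) : NS (-a^2) a := by
  have ha2 : 4 ≤ a ^ 2 := by rw [← sq_abs]; nlinarith
  have hle := le_abs_self a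
  have hle' := neg_abs_le a
  have hab : |a| ^ 2 = a ^ 2 := sq_abs a
  constructor
  · rintro ⟨s, hs⟩
    rcases le_or_gt 0 a with h0 | h0
    · rw [abs_of_nonneg h0] at ha
      exact not_sq_between (n := a) (s := s) h0 (by nlinarith) (by nlinarith)
    · rw [abs_of_neg h0] at ha
      exact not_sq_between (n := -a-1) (s := s) (by linarith) (by nlinarith) (by nlinarith)
  · rintro m hm ⟨s, hs⟩
    obtain ⟨n, rfl⟩ := Nat.exists_eq_add_of_le' (by omega : 1 ≤ m)
    have hc := c_ne_zero_sq ha n (by omega)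
    rw [c_succ] at hs
    have hu : a ^ 2 ≤ |c (-a^2) n| := by
      have : a ^ 2 ∣ |c (-a^2) n| := by
        rw [dvd_abs, c_eq_dd]; exact ⟨-dd (-a^2) n, by ring⟩
      exact Int.le_of_dvd (abs_pos.2 hc) this
    rw [← sq_abs (c (-a^2) n)] at hs
    set u := |c (-a^2) n|
    have hlt : a ^ 2 + |a| < 2 * u - 1 := by
      have : |a| < a ^ 2 - 1 := by nlinarith
      linarith
    have hpos : 0 < a ^ 2 + a := by nlinarith
    exact not_sq_between (n := u - 1) (s := s) (by linarith) (by nlinarith) (by nlinarith)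

lemma dd_neg {a : ℤ} (ha : 2 ≤ |a|) : ∀ n, 2 ≤ n → dd (-a^2) n ≤ -1 := by
  intro n hn
  obtain ⟨n, rfl⟩ := Nat.exists_eq_add_of_le' (by omega : 1 ≤ n)
  have hc := c_ne_zero_sq ha n (by omega)
  rw [c_eq_dd] at hc
  have ha2 : 4 ≤ a ^ 2 := by rw [← sq_abs]; nlinarith
  have h0 : dd (-a^2) n ≠ 0 := right_ne_zero_of_mul hc
  have : 0 < dd (-a^2) n ^ 2 := by positivity
  rw [dd]
  nlinarith

lemma e_sq {a : ℤ} (ha : 2 ≤ |a|) {N : ℕ} (hN : 2 ≤ N) (hbad : ∀ n, N ≤ n + 2 → ¬ Good (-a^2) a n) {n : ℕ} (hn : 1 ≤ n)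
    (hr : ∀ r, 1 ≤ r → r ≤ N → r ∣ n + 1 → r = 1) : ∃ s : ℤ, (a * dd (-a^2) n + 1).natAbs = s ^ 2 := by
  have hns := NS_sq ha
  have hce : c (-a^2) n - a = (-a) * (a * dd (-a^2) n + 1) := by rw [c_eq_dd]; ring
  have hfac : ∀ m, c (-a^2) (m+1) = (c (-a^2) m - a) * (c (-a^2) m + a) := fun m => by rw [c_succ]; ring
  apply isSquare_of_not_oddVal
  · intro h
    rw [h, mul_zero] at hce
    exact hns.ne n hn (by linarith)
  intro q hq ho
  have hqa : ¬ (q:ℤ) ∣ a := by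
    intro h
    have h1 : (q:ℤ) ∣ 1 := (Int.dvd_add_right (h.mul_right _)).1 ho.ne_zero
    exact hq.one_lt.ne' (by exact_mod_cast Int.eq_one_of_dvd_one (by positivity) h1)
  have hoc : OddVal q (c (-a^2) n - a) := by
    rw [hce]; exact ho.mul_left hq (by rwa [Int.dvd_neg])
  have hq2 : q ≠ 2 := by
    rintro rfl
    have hev : 2 ∣ n := by
      by_contra h
      have := hr 2 (by norm_num) hN (by omega)
      omega
    obtain ⟨j, rfl⟩ := hev
    have h2 : (2:ℤ) ∣ c (-a^2) 2 := by
      rw [c_succ, c_one]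
      have h3 : (2:ℤ) ∣ (a^2 - 1) * ((a^2-1) + 1) := by
        exact (Int.even_mul_succ_self _).two_dvd
      have : (-a^2)^2 + -a^2 = (a^2 - 1) * ((a^2-1) + 1) := by ring
      rwa [this]
    have h4 := h2.trans (c_dvd_mul (-a^2) 2 j)
    have h5 := hoc.ne_zero
    push_cast at h5 hqa
    exact hqa ((Int.dvd_iff_dvd_of_dvd_sub h5).1 h4)
  obtain ⟨r, hr1, hqr, hmin, hdv⟩ := exists_rank (-a^2) q (m := n + 1) (by omega) (by rw [hfac]; exact hoc.ne_zero.mul_right _)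
  have hrn : r ∣ n + 1 := hdv _ (by rw [hfac]; exact hoc.ne_zero.mul_right _)
  have hrN : N < r := by
    by_contra h
    have := hr r hr1 (by omega) hrn
    subst this
    rw [c_one, Int.dvd_neg] at hqr
    exact hqa ((Nat.prime_iff_prime_int.1 hq).dvd_of_dvd_pow hqr)
  obtain ⟨j, hj⟩ := hrn
  obtain ⟨r, rfl⟩ := Nat.exists_eq_add_of_le' (by omega : 2 ≤ r)
  have hj1 : 1 ≤ j := by
    rcases Nat.eq_zero_or_pos j with h | h
    · subst h; omega
    · exact h
  obtain ⟨j, rfl⟩ := Nat.exists_eq_add_of_le' hj1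
  have hnn : n = (r + 1) + (r+2) * j := by
    have : (r+2) * (j+1) = (r+2) * j + (r+2) := by ring
    omega
  have hcong := c_congr_sq (-a^2) (m := r+1) (by omega) ((r+2) * j)
  rw [← hnn] at hcong
  have hdm := c_dvd_mul (-a^2) (r+2) j
  have hq1 : (q:ℤ) ∣ c (-a^2) (r+1) - a := by
    have h1 : (q:ℤ) ∣ c (-a^2) n - c (-a^2) (r+1) :=
      ((hqr.trans hdm).trans (dvd_pow_self _ (by norm_num))).trans hcong
    have h2 := Int.dvd_sub hoc.ne_zero h1
    simpa using h2
  obtain ⟨v, w, e, hw⟩ := exists_val hq (d := c (-a^2) (r+1) - a) (by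
    intro h; exact hns.ne (r+1) (by omega) (by linarith))
  have hv : 1 ≤ v := by
    by_contra h
    have h0 : v = 0 := by omega
    rw [e, h0] at hq1
    simp at hq1
    exact hw hq1
  have hpow : (q:ℤ)^(v+1) ∣ (c (-a^2) n - a) - (c (-a^2) (r+1) - a) := by
    have h1 : (q:ℤ)^v ∣ c (-a^2) (r+2) := by
      rw [hfac (r+1), e]; exact (dvd_mul_right _ _).mul_right _
    have h2 := (pow_dvd_pow_of_dvd (h1.trans hdm) 2).trans hcong
    rw [← pow_mul] at h2
    have h3 := (pow_dvd_pow (q:ℤ) (by omega : v + 1 ≤ v * 2)).trans h2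
    simpa using h3
  have hodd := OddVal.congr hq e hw hpow hoc
  refine hbad r (by omega) ⟨q, hq, hq2, ?_, hodd⟩
  intro i hi hir hd
  refine hmin (i+1) (by omega) (by omega) ?_
  rw [hfac]
  exact hd.mul_right _

end Tree

namespace Tree
open scoped Classical NumberTheorySymbols

lemma dd_dvd {a : ℤ} (ha : 2 ≤ |a|) (m j : ℕ) : dd (-a^2) 3 ∣ dd (-a^2) (m + 3 * j) - dd (-a^2) m := by
  have h := c_congr_mul (-a^2) m 3 j
  rw [c_eq_dd, c_eq_dd, c_eq_dd, ← mul_sub] at h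
  refine (mul_dvd_mul_iff_left ?_).1 h
  intro h0
  have ha2 : 4 ≤ a ^ 2 := by rw [← sq_abs]; nlinarith
  linarith

lemma dd_three {a : ℤ} {D : ℕ} (hD : 1 ≤ D) (h : a ^ 2 = ((D:ℤ) + 1) ^ 2) :
    ∃ m : ℕ, 1 ≤ m ∧ ((4 * D * m - 1 : ℕ) : ℤ) = - dd (-a^2) 3 := by
  obtain ⟨T, hT⟩ := (Nat.even_mul_succ_self (D+1)).two_dvd
  have hT1 : 1 ≤ T := by
    rcases Nat.eq_zero_or_pos T with h0 | h0
    · rw [h0] at hT; simp at hT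
    · exact h0
  refine ⟨D * T ^ 2, Nat.mul_pos hD (by positivity), ?_⟩
  have hp : 1 ≤ 4 * D * (D * T ^ 2) := by
    have : 0 < 4 * D * (D * T ^ 2) := by positivity
    exact this
  rw [Nat.cast_sub hp]
  have hT' : ((D:ℤ) + 1) * (D + 2) = 2 * T := by
    have := congrArg (fun x : ℕ => (x : ℤ)) hT
    push_cast at this
    linarith
  have hd : dd (-a^2) 3 = 1 - a ^ 2 * (1 - a ^ 2) ^ 2 := by
    simp only [dd]; ring
  rw [hd, h]
  push_cast
  have h2 : 4 * (D:ℤ) * (D * T ^ 2) = (D * (2 * T)) ^ 2 := by ring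
  rw [h2, ← hT']
  ring

lemma good_sq {a : ℤ} (ha : 2 ≤ |a|) : ∀ N, ∃ n, N ≤ n ∧ Good (-a^2) a n := by
  by_contra hcon
  push Not at hcon
  obtain ⟨N₀, hN₀⟩ := hcon
  obtain ⟨N, hN⟩ : ∃ N, N = N₀ + 4 := ⟨_, rfl⟩
  have hbad : ∀ n, N ≤ n + 2 → ¬ Good (-a^2) a n := fun n hn => hN₀ n (by omega)
  have hsq : a ^ 2 = |a| ^ 2 := (sq_abs a).symm
  obtain ⟨D, hD⟩ : ∃ D : ℕ, |a| = D + 1 := ⟨(|a| - 1).toNat, by omega⟩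
  have hD1 : 1 ≤ D := by omega
  obtain ⟨m, hm, hM⟩ := dd_three (a := a) hD1 (by rw [hsq, hD])
  have hf : ∀ r, 1 ≤ r → r ≤ N → r ∣ N.factorial := fun r h1 h2 => Nat.dvd_factorial h1 h2
  have h24 : 24 ≤ N.factorial := by
    have := Nat.factorial_le (by omega : 4 ≤ N)
    exact this
  rcases abs_choice a with h | h
  · -- a > 0
    rw [h] at hD
    obtain ⟨y, hy⟩ := e_sq ha (by omega) hbad (n := 6 * N.factorial) (by omega) (by
      intro r h1 h2 h3
      have := (Nat.dvd_add_right ((hf r h1 h2).mul_left 6)).1 h3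
      simpa using this)
    have hneg := dd_neg ha (6 * N.factorial) (by omega)
    have hdv := dd_dvd ha 0 (2 * N.factorial)
    have e1 : 0 + 3 * (2 * N.factorial) = 6 * N.factorial := by ring
    rw [e1, dd, sub_zero] at hdv
    have hneg' : a * dd (-a^2) (6 * N.factorial) + 1 ≤ 0 := by nlinarith
    rw [Int.ofNat_natAbs_of_nonpos hneg'] at hy
    refine jac_ne (M := 4 * D * m - 1) (x := -1) (y := y) ?_ (jac_neg_one hD1 hm)
    rw [hM, neg_dvd, ← hy]
    obtain ⟨z, hz⟩ := hdv
    exact ⟨-a * z, by rw [hz]; ring⟩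
  · rw [h] at hD
    obtain ⟨y, hy⟩ := e_sq ha (by omega) hbad (n := N.factorial - 2) (by omega) (by
      intro r h1 h2 h3
      have e : N.factorial = (N.factorial - 2 + 1) + 1 := by omega
      have h4 := hf r h1 h2
      rw [e] at h4
      have := (Nat.dvd_add_right h3).1 h4
      simpa using this)
    have hneg := dd_neg ha (N.factorial - 2) (by omega)
    obtain ⟨j, hj⟩ := hf 3 (by omega) (by omega)
    have hdv := dd_dvd ha 1 (j - 1)
    have e1 : 1 + 3 * (j - 1) = N.factorial - 2 := by omega
    have e2 : dd (-a^2) 1 = 1 := by simp [dd]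
    rw [e1, e2] at hdv
    have hpos : 0 ≤ a * dd (-a^2) (N.factorial - 2) + 1 := by nlinarith
    rw [Int.natAbs_of_nonneg hpos] at hy
    refine jac_ne (M := 4 * D * m - 1) (x := -1 * D) (y := y) ?_ (by
      rw [jacobiSym.mul_left, jac_neg_one hD1 hm, jac_D hD1 hm]; norm_num)
    rw [hM, neg_dvd, ← hy]
    obtain ⟨z, hz⟩ := hdv
    refine ⟨a * z, ?_⟩
    have e3 : dd (-a^2) (N.factorial - 2) = 1 + dd (-a^2) 3 * z := by linarith
    have e4 : a = -D - 1 := by linarith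
    rw [e3]
    linear_combination e4

end Tree

namespace Tree
open scoped Classical

lemma primeCount_primes (x : ℕ) : primeCount {p | p.Prime} x = Nat.primeCounting x := by
  rw [primeCount, Nat.primeCounting, Nat.primeCounting', Nat.count_eq_card_filter_range]
  simp only [Set.mem_setOf_eq]

lemma pi_lower {x : ℕ} (hx : 4 ≤ x) : (1/4 : ℝ) * (x / Real.log x) ≤ Nat.primeCounting x := by
  refine le_trans ?_ (Chebyshev.pi_ge x)
  have hx' : (4:ℝ) ≤ x := by exact_mod_cast hx
  have hlog : 0 < Real.log x := Real.log_pos (by linarith)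
  rw [← mul_div_assoc]
  apply div_le_div_of_nonneg_right _ hlog.le
  have h2 := Real.log_two_gt_d9
  have h2' := Real.log_two_lt_d9
  have h4 : Real.log 4 = 2 * Real.log 2 := by
    rw [show (4:ℝ) = 2 ^ 2 by norm_num, Real.log_pow]; norm_num
  have h3 := Real.log_le_sub_one_of_pos (show (0:ℝ) < (x + 1) / 4 by positivity)
  rw [Real.log_div (by positivity) (by norm_num), h4] at h3
  nlinarith

lemma dens_of_bound (S : Set ℕ) (h : ∀ ε : ℝ, 0 < ε → ∃ N : ℕ, ∀ᶠ x : ℕ in atTop,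
    (primeCount S x : ℝ) ≤ N + ε * (x / Real.log x)) : HasPrimeDensityZero S := by
  rw [HasPrimeDensityZero, Metric.tendsto_atTop']
  intro ε hε
  obtain ⟨N, hN⟩ := h (ε / 10) (by positivity)
  have hpi : Tendsto (fun x => (Nat.primeCounting x : ℝ)) atTop atTop :=
    tendsto_natCast_atTop_atTop.comp Nat.tendsto_primeCounting
  have := (hN.and (eventually_ge_atTop 4)).and (hpi.eventually_ge_atTop (10 * N / ε + 1))
  obtain ⟨n, hn⟩ := eventually_atTop.1 this
  refine ⟨n, fun x hx => ?_⟩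
  obtain ⟨⟨h1, h2⟩, h3⟩ := hn x hx.le
  have h4 := pi_lower h2
  rw [primeCount_primes, Real.dist_eq, sub_zero, abs_of_nonneg (by positivity)]
  have hpos : (0:ℝ) < Nat.primeCounting x := lt_of_lt_of_le (by positivity) h3
  rw [div_lt_iff₀ hpos]
  have h5 : (10 * N : ℝ) ≤ ε * Nat.primeCounting x := by
    have : 10 * (N:ℝ) / ε ≤ Nat.primeCounting x := by linarith
    rwa [div_le_iff₀ hε, mul_comm _ ε] at this
  have h6 : ε / 10 * (x / Real.log x) ≤ ε / 10 * (4 * Nat.primeCounting x) := by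
    apply mul_le_mul_of_nonneg_left _ (by positivity)
    linarith
  have h7 : 0 < ε * Nat.primeCounting x := by positivity
  linarith

lemma eval_iter (k a₀ : ℤ) (n : ℕ) : (fun x => Polynomial.eval x (X ^ 2 + C k : ℤ[X]))^[n] a₀ = (F k)^[n] a₀ := by
  have : (fun x => Polynomial.eval x (X ^ 2 + C k : ℤ[X])) = F k := by
    funext x; simp [F]
  rw [this]

lemma orbit_dens (k a₀ : ℤ) (h : ∀ ε : ℝ, 0 < ε → ∃ K N : ℕ, ∀ᶠ x : ℕ in atTop,
    (((Finset.range (x+1)).filter (fun p : ℕ => p.Prime ∧ ∃ n, K ≤ n ∧ (p:ℤ) ∣ (F k)^[n] a₀)).card : ℝ) ≤ N + ε * (x / Real.log x)) :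
    HasPrimeDensityZero (orbitPrimes (X ^ 2 + C k) a₀) := by
  apply dens_of_bound
  intro ε hε
  obtain ⟨K, N, hN⟩ := h ε hε
  obtain ⟨B, hB⟩ : ∃ B, B = ∑ n ∈ Finset.range K, ((F k)^[n] a₀).natAbs := ⟨_, rfl⟩
  refine ⟨(B + 1) + N, ?_⟩
  filter_upwards [hN] with x hx
  have hsub : (Finset.range (x+1)).filter (fun p => p ∈ orbitPrimes (X ^ 2 + C k) a₀) ⊆
      Finset.range (B+1) ∪ (Finset.range (x+1)).filter (fun p : ℕ => p.Prime ∧ ∃ n, K ≤ n ∧ (p:ℤ) ∣ (F k)^[n] a₀) := by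
    intro p hp
    rw [Finset.mem_filter] at hp
    obtain ⟨hpx, hpp, n, hn0, hnd⟩ := hp
    rw [eval_iter] at hn0 hnd
    rw [Finset.mem_union]
    rcases le_or_gt K n with hKn | hKn
    · right
      exact Finset.mem_filter.2 ⟨hpx, hpp, n, hKn, hnd⟩
    · left
      have h1 : p ≤ ((F k)^[n] a₀).natAbs := Nat.le_of_dvd (Int.natAbs_pos.2 hn0) (Int.natCast_dvd.1 hnd)
      have h2 : ((F k)^[n] a₀).natAbs ≤ B := by
        rw [hB]
        exact Finset.single_le_sum (f := fun n => ((F k)^[n] a₀).natAbs) (fun _ _ => Nat.zero_le _) (Finset.mem_range.2 hKn)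
      rw [Finset.mem_range]; omega
  have h1 := (Finset.card_le_card hsub).trans (Finset.card_union_le _ _)
  rw [Finset.card_range] at h1
  have h2 : (primeCount (orbitPrimes (X ^ 2 + C k) a₀) x : ℝ) ≤ (B + 1 : ℕ) +
    (((Finset.range (x+1)).filter (fun p : ℕ => p.Prime ∧ ∃ n, K ≤ n ∧ (p:ℤ) ∣ (F k)^[n] a₀)).card : ℝ) := by
    rw [primeCount]; exact_mod_cast h1
  push_cast at h2 ⊢
  linarith

lemma iter_split (k a₀ : ℤ) {M n : ℕ} (h : M ≤ n) : (F k)^[n] a₀ = (F k)^[M] ((F k)^[n - M] a₀) := by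
  rw [← Function.iterate_add_apply]; congr 2; omega

lemma dens_of_small (k a₀ : ℤ) (h : TreeSmall k 0) : HasPrimeDensityZero (orbitPrimes (X ^ 2 + C k) a₀) := by
  apply orbit_dens
  intro ε hε
  obtain ⟨M, N, hN⟩ := h ε hε
  refine ⟨M, N, ?_⟩
  filter_upwards [hN] with x hx
  refine le_trans ?_ hx
  norm_cast
  apply Finset.card_le_card
  intro p hp
  rw [Finset.mem_filter] at hp ⊢
  obtain ⟨h1, h2, n, h3, h4⟩ := hp
  refine ⟨h1, h2, (F k)^[n - M] a₀, ?_⟩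
  rwa [sub_zero, ← iter_split k a₀ h3]

lemma dens_of_small_sq (t a₀ : ℤ) (h : TreeSmall (-t^2) t) (h' : TreeSmall (-t^2) (-t)) :
    HasPrimeDensityZero (orbitPrimes (X ^ 2 + C (-t^2)) a₀) := by
  apply orbit_dens
  intro ε hε
  obtain ⟨M, N, hN⟩ := h (ε/2) (by positivity)
  obtain ⟨M', N', hN'⟩ := h' (ε/2) (by positivity)
  refine ⟨M + M' + 1, N + N', ?_⟩
  filter_upwards [hN, hN'] with x hx hx'
  have hsub : (Finset.range (x+1)).filter (fun p : ℕ => p.Prime ∧ ∃ n, M + M' + 1 ≤ n ∧ (p:ℤ) ∣ (F (-t^2))^[n] a₀) ⊆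
      (Finset.range (x+1)).filter (fun p : ℕ => p.Prime ∧ ∃ r : ℤ, (p:ℤ) ∣ (F (-t^2))^[M] r - t) ∪
      (Finset.range (x+1)).filter (fun p : ℕ => p.Prime ∧ ∃ r : ℤ, (p:ℤ) ∣ (F (-t^2))^[M'] r - (-t)) := by
    intro p hp
    rw [Finset.mem_filter] at hp
    obtain ⟨h1, h2, n, h3, h4⟩ := hp
    obtain ⟨n, rfl⟩ := Nat.exists_eq_add_of_le' (by omega : 1 ≤ n)
    have e : (F (-t^2))^[n+1] a₀ = ((F (-t^2))^[n] a₀ - t) * ((F (-t^2))^[n] a₀ - (-t)) := by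
      rw [Function.iterate_succ_apply', F]; push_cast; ring
    rw [e] at h4
    rw [Finset.mem_union, Finset.mem_filter, Finset.mem_filter]
    rcases (Nat.prime_iff_prime_int.1 h2).dvd_or_dvd h4 with h5 | h5
    · left
      exact ⟨h1, h2, (F (-t^2))^[n - M] a₀, by rwa [← iter_split _ a₀ (by omega)]⟩
    · right
      exact ⟨h1, h2, (F (-t^2))^[n - M'] a₀, by rwa [← iter_split _ a₀ (by omega)]⟩
  have h1 := (Finset.card_le_card hsub).trans (Finset.card_union_le _ _)
  have h2 : (((Finset.range (x+1)).filter (fun p : ℕ => p.Prime ∧ ∃ n, M + M' + 1 ≤ n ∧ (p:ℤ) ∣ (F (-t^2))^[n] a₀)).card : ℝ) ≤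
      (((Finset.range (x+1)).filter (fun p : ℕ => p.Prime ∧ ∃ r : ℤ, (p:ℤ) ∣ (F (-t^2))^[M] r - t)).card : ℝ) +
      (((Finset.range (x+1)).filter (fun p : ℕ => p.Prime ∧ ∃ r : ℤ, (p:ℤ) ∣ (F (-t^2))^[M'] r - (-t))).card : ℝ) := by
    exact_mod_cast h1
  push_cast
  linarith

lemma dens_zero (a₀ : ℤ) : HasPrimeDensityZero (orbitPrimes (X ^ 2 + C 0) a₀) := by
  apply dens_of_bound
  intro ε hε
  refine ⟨a₀.natAbs + 1, ?_⟩
  filter_upwards [eventually_ge_atTop 4] with x hx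
  have hsub : (Finset.range (x+1)).filter (fun p => p ∈ orbitPrimes (X ^ 2 + C 0) a₀) ⊆ Finset.range (a₀.natAbs + 1) := by
    intro p hp
    rw [Finset.mem_filter] at hp
    obtain ⟨hpx, hpp, n, hn0, hnd⟩ := hp
    rw [eval_iter] at hn0 hnd
    have e : (F 0)^[n] a₀ = a₀ ^ (2 ^ n) := by
      clear hn0 hnd
      induction n with
      | zero => simp
      | succ n ih => rw [Function.iterate_succ_apply', ih, F, pow_succ 2 n, pow_mul]; simp
    rw [e] at hn0 hnd
    have h0 : a₀ ≠ 0 := by rintro rfl; simp at hn0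
    have h1 := (Nat.prime_iff_prime_int.1 hpp).dvd_of_dvd_pow hnd
    have := Nat.le_of_dvd (Int.natAbs_pos.2 h0) (Int.natCast_dvd.1 h1)
    rw [Finset.mem_range]; omega
  have h1 := Finset.card_le_card hsub
  rw [Finset.card_range] at h1
  have h2 : (primeCount (orbitPrimes (X ^ 2 + C 0) a₀) x : ℝ) ≤ (a₀.natAbs + 1 : ℕ) := by
    rw [primeCount]; exact_mod_cast h1
  have h3 : 0 ≤ ε * (x / Real.log x) := by
    have : 0 ≤ Real.log x := Real.log_natCast_nonneg x
    positivity
  linarith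

lemma main (k : ℤ) (hk : k ≠ -1) (a₀ : ℤ) : HasPrimeDensityZero (orbitPrimes (X ^ 2 + C k) a₀) := by
  by_cases h2 : k = -2
  · subst h2; exact dens_of_small _ _ small_neg_two
  by_cases hs : IsSquare (-k)
  · obtain ⟨t, ht⟩ := hs
    obtain rfl : k = -t^2 := by rw [pow_two]; linarith
    rcases eq_or_ne t 0 with rfl | h0
    · simpa using dens_zero a₀
    have habs : 2 ≤ |t| := by
      have h1 : 0 < |t| := abs_pos.2 h0
      by_contra h
      have h3 : |t| = 1 := by omega
      apply hk
      rw [← sq_abs, h3]; norm_num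
    have habs' : 2 ≤ |-t| := by rwa [abs_neg]
    have g1 := small_of_good (NS_sq habs) (good_sq habs)
    have g2 := small_of_good (NS_sq habs') (good_sq habs')
    rw [neg_sq] at g2
    exact dens_of_small_sq t a₀ g1 g2
  · exact dens_of_small _ _ (small_of_good (NS_zero hs) (good_zero hs h2))

end Tree

theorem density_zero_of_X_sq_add_k (k : ℤ) (hk : k ≠ -1) (a₀ : ℤ) :
    HasPrimeDensityZero (orbitPrimes (X ^ 2 + C k) a₀) := by
  exact Tree.main k hk a₀
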